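/- For every η ∈ (0,1] there exist constants c₁ > 0 and c₂ > 0, depending only on η, with the following property. Let L ≠ ℚ be a number field, let β₁ be an exceptional real zero of ζ_L, i.e. a real zero of ζ_L in (0,1) with β₁ ≥ 1 − 1/(29.57(log d_L + n_L log 2)), and let ρ = β' + it be a nontrivial zero of ζ_L with ρ ≠ β₁. Write τ = |t| + 2. Then either β' ≤ 1 − η, or β' ≤ 1 − c₂ · log( c₁ / ((1 − β₁) · log(d_L τ^{n_L})) ) / log(d_L τ^{n_L}). -/

import Mathlib

open NumberField

section

open Finset

namespace DH

lemma fejer_ident (z : ℂ) (hz : ‖z‖ = 1) (K : ℕ) :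
    Complex.normSq (∑ j ∈ range (K + 1), z ^ j) =
      (K + 1) + 2 * ∑ k ∈ range K, ((K : ℝ) - k) * (z ^ (k + 1)).re := by
  induction K with
  | zero => simp
  | succ K ih =>
    have hzz : z * (starRingEnd ℂ) z = 1 := by
      rw [Complex.mul_conj, Complex.normSq_eq_norm_sq, hz]; simp
    have key : z ^ (K + 1) * (starRingEnd ℂ) (∑ j ∈ range (K + 1), z ^ j)
        = ∑ k ∈ range (K + 1), z ^ (k + 1) := by
      rw [map_sum, mul_sum, ← sum_range_reflect]
      refine sum_congr rfl fun j hj => ?_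
      have hj' := mem_range.1 hj
      have : K + 1 = (K + 1 - 1 - j) + (j + 1) := by omega
      rw [map_pow]
      conv_lhs => rw [this, pow_add]
      have h2 : K + 1 - 1 - (K + 1 - 1 - j) = j := by omega
      calc _ = z ^ (j + 1) * (z * (starRingEnd ℂ) z) ^ (K + 1 - 1 - j) := by
            rw [mul_pow]
            have : K + 1 - 1 - j + (j + 1) - 1 - j = K + 1 - 1 - j := by omega
            rw [this]; ring
        _ = _ := by rw [hzz]; simp
    rw [sum_range_succ, add_comm, Complex.normSq_add, ih, key]
    have h1 : Complex.normSq (z ^ (K + 1)) = 1 := by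
      rw [Complex.normSq_eq_norm_sq, norm_pow, hz]; simp
    rw [h1, Complex.re_sum]
    have e1 : ∑ k ∈ range (K + 1), (((K + 1 : ℕ) : ℝ) - k) * (z ^ (k + 1)).re
        = ∑ k ∈ range (K + 1), ((K : ℝ) - k) * (z ^ (k + 1)).re
          + ∑ k ∈ range (K + 1), (z ^ (k + 1)).re := by
      rw [← sum_add_distrib]
      refine sum_congr rfl fun k _ => ?_
      push_cast; ring
    rw [e1, sum_range_succ (fun k => ((K : ℝ) - k) * (z ^ (k + 1)).re)]
    push_cast; ring

/-- the Fejér-type sum `∑_{k=1}^K (1 - k/(K+1)) Re z^k`. -/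
noncomputable def fej (K : ℕ) (z : ℂ) : ℂ :=
  ∑ k ∈ range K, ((((K : ℝ) - k) / (K + 1) : ℝ) : ℂ) * z ^ (k + 1)

lemma fej_re (K : ℕ) (z : ℂ) :
    (fej K z).re = ∑ k ∈ range K, (((K : ℝ) - k) / (K + 1)) * (z ^ (k + 1)).re := by
  unfold fej
  rw [Complex.re_sum]
  refine sum_congr rfl fun k _ => ?_
  rw [Complex.re_ofReal_mul]

lemma fej_ge_circle (K : ℕ) (z : ℂ) (hz : ‖z‖ = 1) : -(1 / 2 : ℝ) ≤ (fej K z).re := by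
  have h := fejer_ident z hz K
  have h0 := Complex.normSq_nonneg (∑ j ∈ range (K + 1), z ^ j)
  rw [h] at h0
  have hK : (0 : ℝ) < K + 1 := by positivity
  have e : (fej K z).re = (∑ k ∈ range K, ((K : ℝ) - k) * (z ^ (k + 1)).re) / (K + 1) := by
    rw [fej_re, sum_div]
    refine sum_congr rfl fun k _ => ?_
    ring
  rw [e, le_div_iff₀ hK]
  linarith

lemma fej_ge (K : ℕ) (z : ℂ) (hz : ‖z‖ ≤ 1) : -(1 / 2 : ℝ) ≤ (fej K z).re := by
  have hd : Differentiable ℂ (fun z => Complex.exp (-(fej K z))) := by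
    unfold fej; fun_prop
  have h := Complex.norm_le_of_forall_mem_frontier_norm_le (U := Metric.ball (0 : ℂ) 1)
    (f := fun z => Complex.exp (-(fej K z))) (C := Real.exp (1 / 2)) Metric.isBounded_ball
    hd.diffContOnCl ?_ (z := z) ?_
  · rw [Complex.norm_exp, Real.exp_le_exp, Complex.neg_re] at h
    linarith
  · intro w hw
    rw [frontier_ball _ one_ne_zero] at hw
    have hw' : ‖w‖ = 1 := by simpa using hw
    have := fej_ge_circle K w hw'
    rw [Complex.norm_exp, Real.exp_le_exp, Complex.neg_re]
    linarith
  · rw [closure_ball _ one_ne_zero]; simpa using hz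

/-- one-sided power sum bound. -/
lemma power_sum {ι : Type*} (s : Finset ι) (z : ι → ℂ) (hz : ∀ i ∈ s, ‖z i‖ ≤ 1)
    (i0 : ι) (hi0 : i0 ∈ s) (h1 : ‖z i0‖ = 1) (K : ℕ) :
    ∃ w : ℕ → ℝ, (∀ k ∈ range K, 0 ≤ w k ∧ w k ≤ 2) ∧
      (K : ℝ) / 4 - s.card ≤ ∑ k ∈ range K, w k * (∑ i ∈ s, z i ^ (k + 1)).re := by
  set u := z i0 with hu
  have hK : (0 : ℝ) < K + 1 := by positivity
  refine ⟨fun k => ((K : ℝ) - k) / (K + 1) * (1 + (u ^ (k + 1)).re), ?_, ?_⟩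
  · intro k hk
    have hk' : (k : ℝ) < K := by exact_mod_cast mem_range.1 hk
    have a1 : 0 ≤ ((K : ℝ) - k) / (K + 1) := div_nonneg (by linarith) hK.le
    have a2 : ((K : ℝ) - k) / (K + 1) ≤ 1 := by
      rw [div_le_one hK]
      have : (0 : ℝ) ≤ k := by positivity
      linarith
    have b := Complex.abs_re_le_norm (u ^ (k + 1))
    rw [norm_pow, h1, one_pow, abs_le] at b
    constructor
    · exact mul_nonneg a1 (by linarith)
    · nlinarith
  · -- per point quantity
    have hB : ∀ x : ℂ, ∑ k ∈ range K, ((K : ℝ) - k) / (K + 1) * (1 + (u ^ (k + 1)).re)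
          * (x ^ (k + 1)).re = (fej K x).re + (fej K (x * u)).re / 2
            + (fej K (x * (starRingEnd ℂ) u)).re / 2 := by
      intro x
      rw [fej_re, fej_re, fej_re, sum_div, sum_div, ← sum_add_distrib, ← sum_add_distrib]
      refine sum_congr rfl fun k _ => ?_
      rw [mul_pow, mul_pow, ← map_pow, Complex.mul_re, Complex.mul_re, Complex.conj_re,
        Complex.conj_im]
      ring
    have hge : ∀ x : ℂ, ‖x‖ ≤ 1 → -1 ≤ ∑ k ∈ range K, ((K : ℝ) - k) / (K + 1) *
        (1 + (u ^ (k + 1)).re) * (x ^ (k + 1)).re := by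
      intro x hx
      rw [hB]
      have e1 := fej_ge K x hx
      have e2 := fej_ge K (x * u) (by rw [norm_mul, h1, mul_one]; exact hx)
      have e3 := fej_ge K (x * (starRingEnd ℂ) u) (by
        rw [norm_mul, RCLike.norm_conj, h1, mul_one]; exact hx)
      linarith
    have hmain : (K : ℝ) / 4 - 3 / 4 ≤ ∑ k ∈ range K, ((K : ℝ) - k) / (K + 1) *
        (1 + (u ^ (k + 1)).re) * (u ^ (k + 1)).re := by
      rw [hB]
      have e1 := fej_ge K u h1.le
      have e2 := fej_ge K (u * u) (by rw [norm_mul, h1, mul_one])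
      have e3 : (fej K (u * (starRingEnd ℂ) u)).re = K / 2 := by
        rw [Complex.mul_conj, Complex.normSq_eq_norm_sq, h1, fej_re]
        simp only [one_pow, Complex.ofReal_one, Complex.one_re, mul_one]
        rw [← sum_div, sum_sub_distrib, sum_const, card_range, ← Nat.cast_sum]
        have := Finset.sum_range_id_mul_two K
        have h2 : (((∑ i ∈ range K, i) : ℕ) : ℝ) * 2 = K * (K - 1) := by
          rcases K with _ | K
          · simp
          · have h3 : (((∑ i ∈ range (K+1), i) * 2 : ℕ) : ℝ) = (((K+1) * (K + 1 - 1) : ℕ) : ℝ) := by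
              exact_mod_cast this
            push_cast at h3 ⊢
            rw [h3]; simp
        rw [div_eq_div_iff hK.ne' two_ne_zero, nsmul_eq_mul]
        nlinarith
      linarith
    have hsw : ∑ k ∈ range K, ((K : ℝ) - k) / (K + 1) * (1 + (u ^ (k + 1)).re) *
        (∑ i ∈ s, z i ^ (k + 1)).re = ∑ i ∈ s, ∑ k ∈ range K, ((K : ℝ) - k) / (K + 1) *
        (1 + (u ^ (k + 1)).re) * (z i ^ (k + 1)).re := by
      rw [sum_comm]
      refine sum_congr rfl fun k _ => ?_
      rw [Complex.re_sum, mul_sum]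
    rw [hsw]
    classical
    rw [← add_sum_erase s _ hi0]
    have h5 : ∑ i ∈ s.erase i0, (-1 : ℝ) ≤ ∑ i ∈ s.erase i0, ∑ k ∈ range K,
        ((K : ℝ) - k) / (K + 1) * (1 + (u ^ (k + 1)).re) * (z i ^ (k + 1)).re :=
      sum_le_sum fun i hi => hge _ (hz i (mem_of_mem_erase hi))
    rw [sum_const, card_erase_of_mem hi0, nsmul_eq_mul] at h5
    have hc : 1 ≤ s.card := card_pos.2 ⟨i0, hi0⟩
    rw [Nat.cast_sub hc] at h5
    push_cast at h5
    linarith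

end DH

end

section

open Metric Finset

namespace DH

/-- factorisation of `H` with `N` zeros in the disc -/
def Fact (H : ℂ → ℂ) (c : ℂ) (N : ℕ) (ρ : Fin N → ℂ) (G : ℂ → ℂ) : Prop :=
  (∀ i, ρ i ∈ closedBall c (5/2)) ∧ Differentiable ℂ G ∧ ∀ s, H s = (∏ i, (s - ρ i)) * G s

lemma fact_bound {H : ℂ → ℂ} {c : ℂ} {B : ℝ} {N : ℕ} {ρ : Fin N → ℂ} {G : ℂ → ℂ}
    (hF : Fact H c N ρ G) (hB : ∀ s ∈ closedBall c 6, ‖H s‖ ≤ Real.exp B * ‖H c‖) :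
    ∀ s ∈ closedBall c 6, ‖G s‖ * (7/5) ^ N ≤ Real.exp B * ‖G c‖ := by
  obtain ⟨h1, h2, h3⟩ := hF
  have key : ∀ s ∈ sphere c 6, ‖G s‖ ≤ Real.exp B * ‖G c‖ / (7/5) ^ N := by
    intro s hs
    have hs' : s ∈ closedBall c 6 := sphere_subset_closedBall hs
    have := hB s hs'
    rw [h3 s, h3 c, norm_mul, norm_mul, norm_prod, norm_prod] at this
    have hlow : ((7:ℝ)/2) ^ N ≤ ∏ i, ‖s - ρ i‖ := by
      rw [← Fin.prod_const]
      refine Finset.prod_le_prod (fun _ _ => by norm_num) (fun i _ => ?_)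
      have a1 := h1 i
      rw [mem_closedBall, dist_eq_norm] at a1
      rw [mem_sphere, dist_eq_norm] at hs
      have : ‖s - c‖ ≤ ‖s - ρ i‖ + ‖ρ i - c‖ := by
        have := norm_add_le (s - ρ i) (ρ i - c)
        simpa using this
      linarith
    have hup : ∏ i, ‖c - ρ i‖ ≤ ((5:ℝ)/2) ^ N := by
      rw [← Fin.prod_const]
      refine Finset.prod_le_prod (fun _ _ => norm_nonneg _) (fun i _ => ?_)
      have a1 := h1 i
      rw [mem_closedBall, dist_eq_norm] at a1
      rwa [norm_sub_rev]
    have e1 : ((7:ℝ)/2) ^ N * ‖G s‖ ≤ Real.exp B * (((5:ℝ)/2) ^ N * ‖G c‖) := by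
      calc _ ≤ (∏ i, ‖s - ρ i‖) * ‖G s‖ := by gcongr
        _ ≤ _ := this
        _ ≤ _ := by gcongr
    rw [le_div_iff₀ (by positivity)]
    have : ((7:ℝ)/5) ^ N = (7/2) ^ N / (5/2) ^ N := by
      rw [← div_pow]; norm_num
    rw [this, mul_div_assoc', div_le_iff₀ (by positivity)]
    nlinarith [e1]
  intro s hs
  have := Complex.norm_le_of_forall_mem_frontier_norm_le (f := G) (U := ball c 6)
    (C := Real.exp B * ‖G c‖ / (7/5) ^ N) isBounded_ball h2.diffContOnCl (by
      intro z hz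
      rw [frontier_ball c (by norm_num)] at hz
      exact key z hz) (z := s) (by rwa [closure_ball c (by norm_num)])
  rwa [le_div_iff₀ (by positivity)] at this

lemma fact_exists {H : ℂ → ℂ} (hH : Differentiable ℂ H) {c : ℂ} (hc : H c ≠ 0) {B : ℝ}
    (hB : ∀ s ∈ closedBall c 6, ‖H s‖ ≤ Real.exp B * ‖H c‖) :
    ∃ N, ∃ ρ : Fin N → ℂ, ∃ G, Fact H c N ρ G ∧ (7/5 : ℝ) ^ N ≤ Real.exp B ∧
      ∀ s ∈ closedBall c (5/2), G s ≠ 0 := by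
  have hNb : ∀ N, (∃ ρ : Fin N → ℂ, ∃ G, Fact H c N ρ G) → (7/5 : ℝ) ^ N ≤ Real.exp B := by
    rintro N ⟨ρ, G, hF⟩
    have := fact_bound hF hB c (by simp)
    have hG : G c ≠ 0 := by
      intro h
      apply hc
      rw [hF.2.2, h, mul_zero]
    have : 0 < ‖G c‖ := norm_pos_iff.2 hG
    nlinarith
  have h0 : ∃ ρ : Fin 0 → ℂ, ∃ G, Fact H c 0 ρ G :=
    ⟨Fin.elim0, H, fun i => i.elim0, hH, fun s => by simp⟩
  have hex : ∃ N, (∃ ρ : Fin N → ℂ, ∃ G, Fact H c N ρ G) ∧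
      ¬ (∃ ρ : Fin (N+1) → ℂ, ∃ G, Fact H c (N+1) ρ G) := by
    by_contra! hcon
    have hall : ∀ N, ∃ ρ : Fin N → ℂ, ∃ G, Fact H c N ρ G := by
      intro N
      induction N with
      | zero => exact h0
      | succ k ih =>
        exact hcon k ih
    obtain ⟨N, hN⟩ := pow_unbounded_of_one_lt (Real.exp B) (show (1:ℝ) < 7/5 by norm_num)
    exact absurd (hNb N (hall N)) (not_le.2 hN)
  obtain ⟨N, ⟨ρ, G, hF⟩, hn⟩ := hex
  refine ⟨N, ρ, G, hF, hNb N ⟨ρ, G, hF⟩, ?_⟩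
  intro s hs hG
  apply hn
  refine ⟨Fin.cons s ρ, dslope G s, ?_, ?_, ?_⟩
  · intro i
    refine Fin.cases ?_ (fun j => ?_) i
    · simpa using hs
    · simpa using hF.1 j
  · rw [← differentiableOn_univ]
    rw [Complex.differentiableOn_dslope (by simp)]
    exact hF.2.1.differentiableOn
  · intro z
    rw [Fin.prod_univ_succ]
    simp only [Fin.cons_zero, Fin.cons_succ]
    rw [hF.2.2 z]
    have := sub_smul_dslope G s z
    rw [hG, smul_eq_mul, sub_zero] at this
    rw [← this]; ring

lemma iteratedDeriv_inv_sub (k : ℕ) (a c : ℂ) :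
    iteratedDeriv k (fun s : ℂ => (s - a)⁻¹) c = (-1) ^ k * k.factorial * ((c - a)⁻¹) ^ (k + 1) := by
  rw [iteratedDeriv_eq_iterate]
  have := congrFun (iter_deriv_inv_linear_sub k (1:ℂ) a) c
  simp only [one_mul, one_pow, mul_one] at this
  rw [this]
  congr 1
  rw [inv_pow, ← zpow_natCast, ← zpow_neg]
  congr 1
  push_cast; ring

/-- bound on derivatives of logarithmic derivative of a zero free function. -/
lemma logDeriv_bound {G : ℂ → ℂ} (hG : Differentiable ℂ G) {c : ℂ} {B : ℝ} (hB0 : 0 < B)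
    (h0 : ∀ s ∈ closedBall c (5/2), G s ≠ 0)
    (hB : ∀ s ∈ closedBall c (5/2), ‖G s‖ ≤ Real.exp B * ‖G c‖) (k : ℕ) :
    ‖iteratedDeriv k (logDeriv G) c‖ ≤ k.factorial * (18 * B * (k + 1) * (4/9) ^ (k + 1)) := by
  have hd : DifferentiableOn ℂ (logDeriv G) (ball c (5/2)) := by
    intro s hs
    apply DifferentiableAt.differentiableWithinAt
    unfold logDeriv
    have : DifferentiableAt ℂ (deriv G) s := (hG.analyticAt s).deriv.differentiableAt
    exact this.div (hG s) (h0 s (ball_subset_closedBall hs))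
  obtain ⟨g, hg0, hg⟩ := (hd.isExactOn_ball).with_val_at c 0
  have hGc : G c ≠ 0 := h0 c (mem_closedBall_self (by norm_num))
  -- G = G c * exp g
  have hexp : ∀ s ∈ ball c (5/2), G s = G c * Complex.exp (g s) := by
    have hconst : ∀ s ∈ ball c (5/2), G s * Complex.exp (- g s) = G c * Complex.exp (- g c) := by
      intro s hs
      refine (isOpen_ball (x := c) (ε := (5/2:ℝ))).is_const_of_deriv_eq_zero
        (f := fun s => G s * Complex.exp (- g s))
        (convex_ball c (5/2)).isPreconnected ?_ ?_ hs (mem_ball_self (by norm_num))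
      · intro z hz
        exact ((hG z).mul ((hg z hz).differentiableAt.neg.cexp)).differentiableWithinAt
      · intro z hz
        have h1 := (hG z).hasDerivAt.mul ((hg z hz).neg.cexp)
        have h2 := h1.deriv
        simp only [Pi.zero_apply]
        refine Eq.trans h2 ?_
        have := h0 z (ball_subset_closedBall hz)
        simp only [logDeriv_apply, Pi.neg_apply]
        field_simp
        ring
    intro s hs
    have := hconst s hs
    rw [hg0, neg_zero, Complex.exp_zero, mul_one] at this
    rw [← this, mul_assoc, ← Complex.exp_add]
    simp
  have hre : ∀ s ∈ ball c (5/2), (g s).re ≤ B := by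
    intro s hs
    have h1 := hB s (ball_subset_closedBall hs)
    rw [hexp s hs, norm_mul, Complex.norm_exp, mul_comm] at h1
    have := le_of_mul_le_mul_right h1 (norm_pos_iff.2 hGc)
    exact Real.exp_le_exp.1 this
  have hgd : DifferentiableOn ℂ g (ball c (5/2)) := fun s hs =>
    (hg s hs).differentiableAt.differentiableWithinAt
  have hgb : ∀ s ∈ sphere c (9/4), ‖g s‖ ≤ 18 * B := by
    intro s hs
    rw [mem_sphere, dist_eq_norm] at hs
    have hmap : ∀ z ∈ ball (0:ℂ) (5/2), c + z ∈ ball c (5/2) := by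
      intro z hz; simpa using hz
    have := Complex.borelCaratheodory_zero (f := fun z => g (c + z)) (M := B) (R := 5/2) (z := s - c)
      hB0 (by
        refine hgd.comp ?_ hmap
        fun_prop) (by
        intro z hz
        exact hre _ (hmap z hz)) (by norm_num) (by simp; rw [hs]; norm_num) (by simpa using hg0)
    simp only [add_sub_cancel] at this
    rw [hs] at this
    refine this.trans (le_of_eq ?_)
    ring
  have hcau := Complex.norm_iteratedDeriv_le_of_forall_mem_sphere_norm_le (c := c) (R := 9/4)
    (f := g) (k + 1) (by norm_num)
    ((hgd.mono (by
      rw [closure_ball c (by norm_num)]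
      exact closedBall_subset_ball (by norm_num))).diffContOnCl) hgb
  rw [iteratedDeriv_succ'] at hcau
  have heq : iteratedDeriv k (logDeriv G) c = iteratedDeriv k (deriv g) c := by
    apply Filter.EventuallyEq.iteratedDeriv_eq
    filter_upwards [isOpen_ball.mem_nhds (mem_ball_self (x := c) (show (0:ℝ) < 5/2 by norm_num))]
      with z hz
    exact (hg z hz).deriv.symm
  rw [heq]
  refine hcau.trans (le_of_eq ?_)
  rw [Nat.factorial_succ]
  have : ((4:ℝ)/9) ^ (k+1) = 1 / (9/4) ^ (k+1) := by
    rw [← one_div_pow]; norm_num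
  rw [this]
  push_cast
  ring

theorem zeros_approx {H : ℂ → ℂ} (hH : Differentiable ℂ H) {c : ℂ} (hc : H c ≠ 0) {B : ℝ}
    (hB0 : 0 < B) (hB : ∀ s ∈ closedBall c 6, ‖H s‖ ≤ Real.exp B * ‖H c‖) :
    ∃ N, ∃ ρ : Fin N → ℂ, (∀ s ∈ closedBall c (5/2), H s = 0 → ∃ i, ρ i = s) ∧
      (∀ i, H (ρ i) = 0) ∧ (7/5 : ℝ) ^ N ≤ Real.exp B ∧
      ∀ k : ℕ, ‖(∑ i, ((c - ρ i)⁻¹) ^ (k + 1)) -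
        (-1) ^ k / (k.factorial : ℂ) * iteratedDeriv k (logDeriv H) c‖
          ≤ 18 * B * (k + 1) * (4/9) ^ (k + 1) := by
  obtain ⟨N, ρ, G, hF, hN, hG⟩ := fact_exists hH hc hB
  have hρ : ∀ i, H (ρ i) = 0 := by
    intro i
    rw [hF.2.2, Finset.prod_eq_zero (mem_univ i) (sub_self _), zero_mul]
  refine ⟨N, ρ, ?_, hρ, hN, ?_⟩
  · intro s hs h
    rw [hF.2.2, mul_eq_zero] at h
    rcases h with h | h
    · obtain ⟨i, -, hi⟩ := Finset.prod_eq_zero_iff.1 h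
      exact ⟨i, (sub_eq_zero.1 hi).symm⟩
    · exact absurd h (hG s hs)
  · intro k
    have hcne : ∀ i, c ≠ ρ i := fun i h => hc (h ▸ hρ i)
    have hGb : ∀ s ∈ closedBall c (5/2), ‖G s‖ ≤ Real.exp B * ‖G c‖ := by
      intro s hs
      have h1 := fact_bound hF hB s (closedBall_subset_closedBall (by norm_num) hs)
      have : (1:ℝ) ≤ (7/5) ^ N := one_le_pow₀ (by norm_num)
      nlinarith [norm_nonneg (G s)]
    have hb := logDeriv_bound hF.2.1 hB0 hG hGb k
    have hH0 : ∀ᶠ z in nhds c, H z ≠ 0 := hH.continuous.continuousAt.eventually_ne hc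
    have hev : logDeriv H =ᶠ[nhds c] fun s => (∑ i, (s - ρ i)⁻¹) + logDeriv G s := by
      filter_upwards [hH0] with z hz
      have hHeq : H = fun s => (∏ i, (s - ρ i)) * G s := funext hF.2.2
      have hz' := hz
      rw [hF.2.2, mul_ne_zero_iff] at hz'
      rw [hHeq]
      rw [logDeriv_mul z hz'.1 hz'.2 (by fun_prop) (hF.2.1 z)]
      congr 1
      rw [logDeriv_prod (f := fun i (s : ℂ) => s - ρ i)]
      · refine Finset.sum_congr rfl fun i _ => ?_
        rw [logDeriv_apply]
        simp
      · intro i _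
        exact (Finset.prod_ne_zero_iff.1 hz'.1) i (mem_univ i)
      · intro i _; fun_prop
    rw [hev.iteratedDeriv_eq]
    have hcd : ∀ i ∈ Finset.univ, ContDiffAt ℂ k (fun s : ℂ => (s - ρ i)⁻¹) c := by
      intro i _
      exact (contDiffAt_id.sub contDiffAt_const).inv (sub_ne_zero.2 (hcne i))
    have hcG : ContDiffAt ℂ k (logDeriv G) c := by
      have a1 : AnalyticAt ℂ (logDeriv G) c :=
        (hF.2.1.analyticAt c).deriv.div (hF.2.1.analyticAt c) (hG c (mem_closedBall_self (by norm_num)))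
      exact a1.contDiffAt
    rw [iteratedDeriv_fun_add (ContDiffAt.sum hcd) hcG, iteratedDeriv_fun_sum hcd]
    simp only [iteratedDeriv_inv_sub]
    have hk : (k.factorial : ℂ) ≠ 0 := by exact_mod_cast k.factorial_ne_zero
    have : (∑ i, ((c - ρ i)⁻¹) ^ (k + 1)) - (-1) ^ k / (k.factorial : ℂ) *
        ((∑ i, (-1) ^ k * k.factorial * ((c - ρ i)⁻¹) ^ (k + 1)) + iteratedDeriv k (logDeriv G) c)
        = - ((-1) ^ k / (k.factorial : ℂ) * iteratedDeriv k (logDeriv G) c) := by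
      rw [← Finset.mul_sum, mul_add, ← mul_assoc]
      have h1 : (-1 : ℂ) ^ k / (k.factorial : ℂ) * ((-1) ^ k * k.factorial) = 1 := by
        field_simp
        rw [← pow_mul, mul_comm, pow_mul]; simp
      rw [h1]; ring
    rw [this, norm_neg, norm_mul, norm_div, norm_pow, norm_neg, norm_one, one_pow, Complex.norm_natCast]
    have hk' : (0:ℝ) < k.factorial := by exact_mod_cast k.factorial_pos
    rw [one_div, inv_mul_le_iff₀ hk']
    exact hb

end DH

end

section

open Metric Finset MeasureTheory ProbabilityTheory

namespace DH

lemma norm_pow_sub_pow_le' {a b : ℂ} (ha : ‖a‖ ≤ 1) (hb : ‖b‖ ≤ 1) (m : ℕ) :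
    ‖a ^ m - b ^ m‖ ≤ m * ‖a - b‖ := by
  induction m with
  | zero => simp
  | succ n ih =>
    have e : a ^ (n+1) - b ^ (n+1) = a ^ n * (a - b) + (a ^ n - b ^ n) * b := by ring
    rw [e]
    refine (norm_add_le _ _).trans ?_
    rw [norm_mul, norm_mul, norm_pow]
    have h1 : ‖a‖ ^ n ≤ 1 := pow_le_one₀ (norm_nonneg _) ha
    have h2 := norm_nonneg (a - b)
    push_cast
    nlinarith [norm_nonneg (a ^ n - b ^ n)]

lemma iteratedDeriv_deriv_mgf_re {Ω : Type*} [MeasurableSpace Ω] {μ : Measure Ω} {X : Ω → ℝ}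
    (hX : ∀ ω, X ω ≤ 0) (hintg : Set.Ioi 1 ⊆ integrableExpSet X μ) (t : ℝ) (k : ℕ) :
    ((-1) ^ k * iteratedDeriv k (deriv (complexMGF X μ)) 2 +
      (-1) ^ k * iteratedDeriv k (deriv (complexMGF X μ)) (2 + t * Complex.I)).re ≤ 0 := by
  have hin : ∀ c : ℂ, c.re = 2 → c.re ∈ interior (integrableExpSet X μ) := by
    intro c hc
    rw [mem_interior]
    exact ⟨Set.Ioi 1, hintg, isOpen_Ioi, by rw [hc]; norm_num⟩
  have h1 := hin 2 (by simp)
  have h2 := hin (2 + t * Complex.I) (by simp)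
  rw [← iteratedDeriv_succ', iteratedDeriv_complexMGF h1,
    iteratedDeriv_complexMGF h2]
  have i1 := integrable_pow_mul_cexp_of_re_mem_interior_integrableExpSet h1 (k+1)
  have i2 := integrable_pow_mul_cexp_of_re_mem_interior_integrableExpSet h2 (k+1)
  rw [← mul_add, ← integral_add i1 i2, ← integral_const_mul]
  have i3 : Integrable (fun ω => (-1:ℂ) ^ k * ((X ω : ℂ) ^ (k+1) * Complex.exp (2 * X ω) +
      (X ω : ℂ) ^ (k+1) * Complex.exp ((2 + t * Complex.I) * X ω))) μ := (i1.add i2).const_mul _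
  rw [← Complex.reCLM_apply, ← ContinuousLinearMap.integral_comp_comm _ i3]
  apply integral_nonpos
  intro ω
  simp only [Complex.reCLM_apply, Pi.zero_apply]
  have e : ((-1:ℂ)) ^ k * ((X ω : ℂ) ^ (k+1) * Complex.exp (2 * X ω) +
      (X ω : ℂ) ^ (k+1) * Complex.exp ((2 + t * Complex.I) * X ω)) =
      ((-(-X ω)^(k+1) * Real.exp (2 * X ω) : ℝ) : ℂ) * (1 + Complex.exp (((t * X ω : ℝ) : ℂ) * Complex.I)) := by
    have : (2 + t * Complex.I) * (X ω : ℂ) = 2 * X ω + ((t * X ω : ℝ) : ℂ) * Complex.I := by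
      push_cast; ring
    rw [this, Complex.exp_add]
    push_cast
    rw [neg_pow (X ω : ℂ)]
    ring
  rw [e, Complex.re_ofReal_mul]
  have h3 : 0 ≤ (-X ω)^(k+1) := pow_nonneg (by linarith [hX ω]) _
  have h4 : 0 ≤ (1 + Complex.exp (((t * X ω : ℝ) : ℂ) * Complex.I)).re := by
    rw [Complex.add_re, Complex.exp_ofReal_mul_I_re, Complex.one_re]
    linarith [Real.neg_one_le_cos (t * X ω)]
  have h5 := Real.exp_pos (2 * X ω)
  have : 0 ≤ (-X ω)^(k+1) * Real.exp (2 * X ω) * (1 + Complex.exp (((t * X ω : ℝ) : ℂ) * Complex.I)).re := by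
    positivity
  linarith

theorem hpos_of_mgf {Ω : Type*} [MeasurableSpace Ω] {μ : Measure Ω} {X : Ω → ℝ}
    (hX : ∀ ω, X ω ≤ 0) (hintg : Set.Ioi 1 ⊆ integrableExpSet X μ) {H : ℂ → ℂ} {β : ℝ}
    (hβ1 : β < 1)
    (hH : ∀ s : ℂ, 1 < s.re → H s = (s - 1) / (s - β) * Complex.exp (complexMGF X μ s)) (t : ℝ) (k : ℕ) :
    ((-1) ^ k / (k.factorial : ℂ) * iteratedDeriv k (logDeriv H) 2 +
      (-1) ^ k / (k.factorial : ℂ) * iteratedDeriv k (logDeriv H) (2 + t * Complex.I)).re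
        ≤ 2 * (k + 1) * (1 - β) := by
  have han : ∀ c : ℂ, 1 < c.re → AnalyticAt ℂ (complexMGF X μ) c := by
    intro c hc
    apply analyticAt_complexMGF
    rw [mem_interior]
    exact ⟨Set.Ioi 1, hintg, isOpen_Ioi, hc⟩
  have hopen : IsOpen {s : ℂ | 1 < s.re} := isOpen_lt continuous_const Complex.continuous_re
  have hne1 : ∀ s : ℂ, 1 < s.re → s - 1 ≠ 0 := by
    intro s hs h
    have := congrArg Complex.re h; simp at this; linarith
  have hneβ : ∀ s : ℂ, 1 < s.re → s - β ≠ 0 := by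
    intro s hs h
    have := congrArg Complex.re h; simp at this; linarith
  have hlog : ∀ s : ℂ, 1 < s.re → logDeriv H s =
      (s - 1)⁻¹ - (s - (β:ℂ))⁻¹ + deriv (complexMGF X μ) s := by
    intro s hs
    have hev : H =ᶠ[nhds s] fun s => ((s - 1) / (s - β)) * Complex.exp (complexMGF X μ s) := by
      filter_upwards [hopen.mem_nhds hs] with z hz using hH z hz
    have hd : HasDerivAt (fun s => ((s - 1) / (s - β)) * Complex.exp (complexMGF X μ s))
        (((1 * (s - β) - (s - 1) * 1) / (s - β)^2) * Complex.exp (complexMGF X μ s) +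
         ((s - 1) / (s - β)) * (Complex.exp (complexMGF X μ s) * deriv (complexMGF X μ) s)) s := by
      have a1 : HasDerivAt (fun s : ℂ => s - 1) 1 s := (hasDerivAt_id s).sub_const 1
      have a2 : HasDerivAt (fun s : ℂ => s - (β:ℂ)) 1 s := (hasDerivAt_id s).sub_const _
      have a3 := (han s hs).differentiableAt.hasDerivAt.cexp
      exact (a1.div a2 (hneβ s hs)).mul a3
    rw [logDeriv_apply, hev.deriv_eq, hev.eq_of_nhds, hd.deriv]
    have := hne1 s hs
    have := hneβ s hs
    have := Complex.exp_ne_zero (complexMGF X μ s)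
    field_simp
  have hit : ∀ c : ℂ, 1 < c.re → (-1) ^ k / (k.factorial : ℂ) * iteratedDeriv k (logDeriv H) c =
      ((c-1)⁻¹)^(k+1) - ((c - β)⁻¹)^(k+1) +
      (1 / (k.factorial:ℝ) : ℝ) * ((-1)^k * iteratedDeriv k (deriv (complexMGF X μ)) c) := by
    intro c hc
    have hev : logDeriv H =ᶠ[nhds c] fun s => ((s - 1)⁻¹ - (s - (β:ℂ))⁻¹) + deriv (complexMGF X μ) s := by
      filter_upwards [hopen.mem_nhds hc] with z hz using hlog z hz
    rw [hev.iteratedDeriv_eq]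
    have c1 : ContDiffAt ℂ k (fun s : ℂ => (s - 1)⁻¹) c :=
      (contDiffAt_id.sub contDiffAt_const).inv (hne1 c hc)
    have c2 : ContDiffAt ℂ k (fun s : ℂ => (s - (β:ℂ))⁻¹) c :=
      (contDiffAt_id.sub contDiffAt_const).inv (hneβ c hc)
    have c3 : ContDiffAt ℂ k (deriv (complexMGF X μ)) c := (han c hc).deriv.contDiffAt
    rw [iteratedDeriv_fun_add (c1.sub c2) c3, iteratedDeriv_fun_sub c1 c2]
    rw [iteratedDeriv_inv_sub, iteratedDeriv_inv_sub]
    have hk : (k.factorial : ℂ) ≠ 0 := by exact_mod_cast k.factorial_ne_zero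
    have h1 : ((-1 : ℂ) ^ k) * (-1) ^ k = 1 := by
      rw [← mul_pow]; simp
    push_cast
    field_simp
    linear_combination (k.factorial * (((c-1)⁻¹)^(k+1) - ((c - β)⁻¹)^(k+1))) * h1
  have hsm : ∀ c : ℂ, c.re = 2 → (((c-1)⁻¹)^(k+1) - ((c - β)⁻¹)^(k+1)).re ≤ (k+1) * (1-β) := by
    intro c hc
    refine (Complex.re_le_norm _).trans ?_
    have n1 : 1 ≤ ‖c - 1‖ := by
      have := Complex.re_le_norm (c - 1); simp [hc] at this; linarith
    have n2 : 1 ≤ ‖c - β‖ := by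
      have := Complex.re_le_norm (c - β); simp [hc] at this; linarith
    have m1 : ‖(c-1)⁻¹‖ ≤ 1 := by rw [norm_inv]; exact inv_le_one_of_one_le₀ n1
    have m2 : ‖(c-β)⁻¹‖ ≤ 1 := by rw [norm_inv]; exact inv_le_one_of_one_le₀ n2
    refine (norm_pow_sub_pow_le' m1 m2 (k+1)).trans ?_
    push_cast
    gcongr
    have e : (c-1)⁻¹ - (c - (β:ℂ))⁻¹ = ((1 - β : ℝ) : ℂ) * ((c-1)⁻¹ * (c-β)⁻¹) := by
      have := hne1 c (by rw [hc]; norm_num)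
      have := hneβ c (by rw [hc]; norm_num)
      push_cast
      field_simp
      ring
    rw [e, norm_mul, norm_mul, Complex.norm_real, Real.norm_eq_abs, abs_of_pos (by linarith)]
    have : ‖(c-1)⁻¹‖ * ‖(c-β)⁻¹‖ ≤ 1 := mul_le_one₀ m1 (norm_nonneg _) m2
    nlinarith
  have q1 := hsm 2 (by simp)
  have q2 := hsm (2 + t * Complex.I) (by simp)
  have q3 := iteratedDeriv_deriv_mgf_re hX hintg t k
  rw [hit 2 (by simp), hit (2 + t * Complex.I) (by simp)]
  rw [Complex.add_re, Complex.add_re, Complex.add_re, Complex.re_ofReal_mul, Complex.re_ofReal_mul]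
  rw [Complex.add_re] at q3
  have q4 : 0 ≤ 1 / (k.factorial:ℝ) := by positivity
  nlinarith [mul_nonneg q4 (neg_nonneg.2 q3)]

end DH

end

section

open Metric Finset

namespace DH

lemma sum_geom_bound (K : ℕ) : ∑ k ∈ range K, ((k:ℝ)+1) * (8/9) ^ (k+1) ≤ 72 := by
  have : ∀ K : ℕ, ∑ k ∈ range K, ((k:ℝ)+1) * (8/9) ^ (k+1) = 72 - (8*K + 72) * (8/9)^K := by
    intro K
    induction K with
    | zero => simp
    | succ n ih => rw [sum_range_succ, ih]; push_cast; ring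
  rw [this]
  have : (0:ℝ) ≤ (8*K + 72) * (8/9)^K := by positivity
  linarith

lemma N_le_of_pow {N : ℕ} {B : ℝ} (h : (7/5 : ℝ) ^ N ≤ Real.exp B) : (N:ℝ) ≤ 3 * B := by
  have h1 : Real.exp 1 ≤ (7/5:ℝ)^3 := by
    have := Real.exp_one_lt_d9
    norm_num at *
    linarith
  have h2 : Real.exp (N:ℝ) ≤ Real.exp (3 * B) := by
    calc Real.exp (N:ℝ) = Real.exp 1 ^ N := by rw [← Real.exp_nat_mul]; simp
      _ ≤ ((7/5:ℝ)^3)^N := by gcongr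
      _ = ((7/5:ℝ)^N)^3 := by rw [← pow_mul, ← pow_mul, mul_comm]
      _ ≤ (Real.exp B)^3 := by gcongr
      _ = Real.exp (3*B) := by rw [← Real.exp_nat_mul]; simp
  exact Real.exp_le_exp.1 h2

theorem dh_core {H : ℂ → ℂ} (hH : Differentiable ℂ H) {t B δ : ℝ} (hB0 : 0 < B) (hδ : 0 < δ)
    (hc0 : H 2 ≠ 0) (hc1 : H (2 + t * Complex.I) ≠ 0)
    (hB : ∀ s ∈ closedBall 2 6, ‖H s‖ ≤ Real.exp B * ‖H 2‖)
    (hB' : ∀ s ∈ closedBall (2 + t * Complex.I) 6, ‖H s‖ ≤ Real.exp B * ‖H (2 + t * Complex.I)‖)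
    (hpos : ∀ k : ℕ, ((-1) ^ k / (k.factorial : ℂ) * iteratedDeriv k (logDeriv H) 2 +
      (-1) ^ k / (k.factorial : ℂ) * iteratedDeriv k (logDeriv H) (2 + t * Complex.I)).re
        ≤ 2 * (k + 1) * δ)
    {ρ : ℂ} (hρ : H ρ = 0) (hre0 : 0 < ρ.re) (hre1 : ρ.re < 1) (him : ρ.im = t)
    (K : ℕ) (hK1 : 1 ≤ K) (hK : 41520 * B ≤ K) :
    Real.log (1 / (32 * δ * K)) ≤ K * (1 - ρ.re) := by
  obtain ⟨N0, ρ0, -, hz0, hN0, ha0⟩ := zeros_approx hH hc0 hB0 hB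
  obtain ⟨N1, ρ1, hin, hz1, hN1, ha1⟩ := zeros_approx hH hc1 hB0 hB'
  set β := ρ.re with hβ
  have hdiff : (2 + t * Complex.I) - ρ = ((2 - β : ℝ) : ℂ) := by
    apply Complex.ext <;> simp [hβ, him]
  have hnorm : ‖(2 + t * Complex.I) - ρ‖ = 2 - β := by
    rw [hdiff, Complex.norm_real, Real.norm_eq_abs, abs_of_pos (by linarith)]
  obtain ⟨i1, hi1⟩ := hin ρ (by
    rw [mem_closedBall, dist_comm, dist_eq_norm, hnorm]; linarith) hρ
  set z : Fin N0 ⊕ Fin N1 → ℂ := Sum.elim (fun i => (2 - ρ0 i)⁻¹)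
    (fun i => (2 + t * Complex.I - ρ1 i)⁻¹) with hz
  obtain ⟨im, -, hmax⟩ := Finset.exists_max_image (Finset.univ : Finset (Fin N0 ⊕ Fin N1))
    (fun i => ‖z i‖) ⟨Sum.inr i1, mem_univ _⟩
  set r := ‖z im‖ with hr
  have hr0 : 1 / (2 - β) ≤ r := by
    have := hmax (Sum.inr i1) (mem_univ _)
    simp only [hz, Sum.elim_inr, hi1, norm_inv] at this
    rw [hnorm] at this
    simpa [hr, hz] using this
  have h2β : 0 < 2 - β := by linarith
  have hrpos : 0 < r := lt_of_lt_of_le (by positivity) hr0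
  have hrinv : r⁻¹ ≤ 2 - β := by
    rw [inv_le_comm₀ hrpos h2β]; simpa using hr0
  obtain ⟨w, hw, hsum⟩ := power_sum (Finset.univ : Finset (Fin N0 ⊕ Fin N1))
    (fun i => ((r⁻¹ : ℝ) : ℂ) * z i) (by
      intro i hi
      rw [norm_mul, Complex.norm_real, Real.norm_eq_abs, abs_of_pos (by positivity)]
      rw [inv_mul_le_iff₀ hrpos, mul_one]
      exact hmax i hi) im (mem_univ _) (by
      rw [norm_mul, Complex.norm_real, Real.norm_eq_abs, abs_of_pos (by positivity)]
      rw [← hr, inv_mul_cancel₀ hrpos.ne']) K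
  have hS : ∀ k : ℕ, (∑ i, z i ^ (k+1)).re ≤ 2 * (k+1) * δ + 36 * B * (k+1) * (4/9)^(k+1) := by
    intro k
    have e : ∑ i, z i ^ (k+1) = (∑ i, ((2 - ρ0 i)⁻¹) ^ (k + 1)) +
        (∑ i, ((2 + t * Complex.I - ρ1 i)⁻¹) ^ (k + 1)) := by
      rw [Fintype.sum_sum_type]; simp [hz]
    rw [e, Complex.add_re]
    have b0 := (Complex.re_le_norm _).trans (ha0 k)
    have b1 := (Complex.re_le_norm _).trans (ha1 k)
    have b2 := hpos k
    rw [Complex.sub_re] at b0 b1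
    rw [Complex.add_re] at b2
    linarith
  have hterm : ∀ k ∈ range K, w k * (∑ i, (((r⁻¹ : ℝ) : ℂ) * z i) ^ (k+1)).re ≤
      4 * δ * K * (2 - β)^K + 72 * B * (((k:ℝ)+1) * (8/9)^(k+1)) := by
    intro k hk
    have hkK : k + 1 ≤ K := by simpa using hk
    obtain ⟨w0, w2⟩ := hw k hk
    have e : (∑ i, (((r⁻¹ : ℝ) : ℂ) * z i) ^ (k+1)).re = (r⁻¹)^(k+1) * (∑ i, z i ^ (k+1)).re := by
      simp_rw [mul_pow]
      rw [← Finset.mul_sum, ← Complex.ofReal_pow, Complex.re_ofReal_mul]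
    rw [e]
    have s1 : 0 ≤ 2 * ((k:ℝ)+1) * δ := by positivity
    have s2 : 0 ≤ 36 * B * (k+1) * (4/9)^(k+1) := by positivity
    have p1 : (r⁻¹)^(k+1) ≤ (2-β)^K := by
      calc (r⁻¹)^(k+1) ≤ (2-β)^(k+1) := by gcongr
        _ ≤ (2-β)^K := pow_le_pow_right₀ (by linarith) hkK
    have p2 : (r⁻¹)^(k+1) ≤ 2^(k+1) := by
      have : r⁻¹ ≤ 2 := by linarith
      gcongr
    have p0 : 0 ≤ (r⁻¹)^(k+1) := by positivity
    have hkK' : (k:ℝ) + 1 ≤ K := by exact_mod_cast hkK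
    calc w k * ((r⁻¹)^(k+1) * (∑ i, z i ^ (k+1)).re)
        ≤ w k * ((r⁻¹)^(k+1) * (2 * (k+1) * δ + 36 * B * (k+1) * (4/9)^(k+1))) := by
          gcongr; exact hS k
      _ ≤ 2 * ((r⁻¹)^(k+1) * (2 * (k+1) * δ + 36 * B * (k+1) * (4/9)^(k+1))) := by
          gcongr
      _ = 2 * ((r⁻¹)^(k+1) * (2 * (k+1) * δ)) + 2 * ((r⁻¹)^(k+1) * (36 * B * (k+1) * (4/9)^(k+1))) := by
          ring
      _ ≤ 2 * ((2-β)^K * (2 * K * δ)) + 2 * (2^(k+1) * (36 * B * (k+1) * (4/9)^(k+1))) := by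
          gcongr
      _ = _ := by
          have : ((8:ℝ)/9)^(k+1) = 2^(k+1) * (4/9)^(k+1) := by rw [← mul_pow]; norm_num
          rw [this]; ring
  have htot := hsum.trans (Finset.sum_le_sum hterm)
  rw [Finset.sum_add_distrib, ← Finset.mul_sum (range K) (fun k => ((k:ℝ)+1) * (8/9)^(k+1))] at htot
  simp only [sum_const, card_range, nsmul_eq_mul] at htot
  have hg := sum_geom_bound K
  have n0 := N_le_of_pow hN0
  have n1 := N_le_of_pow hN1
  have hcard : ((Finset.univ : Finset (Fin N0 ⊕ Fin N1)).card : ℝ) = N0 + N1 := by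
    simp
  rw [hcard] at htot
  have hmain : (K:ℝ)/8 ≤ 4 * δ * K * K * (2-β)^K := by
    have hg' := mul_le_mul_of_nonneg_left hg (show 0 ≤ 72 * B by positivity)
    nlinarith
  have hKpos : (0:ℝ) < K := by exact_mod_cast hK1
  have h3 : 1 / (32 * δ * K) ≤ (2-β)^K := by
    rw [div_le_iff₀ (by positivity)]
    have : (K:ℝ) * 1 ≤ K * ((2-β)^K * (32 * δ * K)) := by nlinarith
    exact le_of_mul_le_mul_left this hKpos
  rw [Real.log_le_iff_le_exp (by positivity)]
  refine h3.trans ?_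
  rw [Real.exp_nat_mul]
  gcongr
  have := Real.add_one_le_exp (1-β)
  linarith

end DH

end

section

open NumberField IsDedekindDomain Finset

namespace DH

section euler
variable {L : Type*} [Field L] [NumberField L]

/-- nonzero ideals supported on `S` -/
def suppOn (S : Finset (HeightOneSpectrum (𝓞 L))) : Set (Ideal (𝓞 L)) :=
  {I | I ≠ ⊥ ∧ ∀ P : HeightOneSpectrum (𝓞 L), P.asIdeal ∣ I → P ∈ S}

lemma hos_dvd_iff (P Q : HeightOneSpectrum (𝓞 L)) (h : P.asIdeal ∣ Q.asIdeal) : P = Q := by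
  have h1 := Q.prime.irreducible
  have := (P.prime.irreducible.dvd_irreducible_iff_associated h1).1 h
  exact HeightOneSpectrum.ext (associated_iff_eq.1 this)

open Classical in
lemma suppOn_bij (S : Finset (HeightOneSpectrum (𝓞 L))) (P : HeightOneSpectrum (𝓞 L)) (hP : P ∉ S) :
    ∃ e : (ℕ × suppOn S) ≃ suppOn (insert P S), ∀ x, (e x : Ideal (𝓞 L)) = P.asIdeal ^ x.1 * x.2 := by
  have hnd : ∀ I : suppOn S, ¬ P.asIdeal ∣ (I : Ideal (𝓞 L)) := fun I h => hP (I.2.2 P h)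
  let F : (ℕ × suppOn S) → suppOn (insert P S) := fun x => ⟨P.asIdeal ^ x.1 * x.2, by
    refine ⟨mul_ne_zero (pow_ne_zero _ P.ne_bot) x.2.2.1, fun Q hQ => ?_⟩
    rcases Q.prime.dvd_or_dvd hQ with h | h
    · have := hos_dvd_iff Q P (Q.prime.dvd_of_dvd_pow h)
      simp [this]
    · simp [x.2.2.2 Q h]⟩
  have hF : Function.Bijective F := by
    constructor
    · rintro ⟨j, I⟩ ⟨j', I'⟩ h
      have h' : P.asIdeal ^ j * (I : Ideal (𝓞 L)) = P.asIdeal ^ j' * I' := congrArg Subtype.val h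
      have key : ∀ (j j' : ℕ) (I I' : suppOn S), P.asIdeal ^ j * (I : Ideal (𝓞 L)) = P.asIdeal ^ j' * I' →
          j ≤ j' → j = j' := by
        intro j j' I I' h hle
        by_contra hne
        obtain ⟨m, rfl⟩ := Nat.exists_eq_add_of_lt (lt_of_le_of_ne hle hne)
        rw [add_assoc, pow_add, mul_assoc] at h
        have := mul_left_cancel₀ (pow_ne_zero j P.ne_bot) h
        apply hnd I
        rw [this, pow_succ', mul_assoc]
        exact dvd_mul_right _ _
      have hj : j = j' := by
        rcases le_total j j' with hl | hl
        · exact key j j' I I' h' hl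
        · exact (key j' j I' I h'.symm hl).symm
      subst hj
      have := mul_left_cancel₀ (pow_ne_zero j P.ne_bot) h'
      rw [Subtype.ext this]
    · rintro ⟨I, hI0, hI⟩
      have hfin : FiniteMultiplicity P.asIdeal I :=
        FiniteMultiplicity.of_prime_left P.prime hI0
      obtain ⟨c, hc, hnc⟩ := hfin.exists_eq_pow_mul_and_not_dvd
      refine ⟨⟨multiplicity P.asIdeal I, ⟨c, ?_, ?_⟩⟩, Subtype.ext hc.symm⟩
      · rintro rfl
        apply hI0
        rw [hc]; simp
      · intro Q hQ
        have := hI Q (by rw [hc]; exact hQ.mul_left _)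
        rw [Finset.mem_insert] at this
        rcases this with rfl | h
        · exact absurd hQ hnc
        · exact h
  exact ⟨Equiv.ofBijective F hF, fun x => rfl⟩

lemma suppOn_empty : suppOn (∅ : Finset (HeightOneSpectrum (𝓞 L))) = {1} := by
  ext I
  simp only [suppOn, Set.mem_ofPred_eq, Finset.notMem_empty, imp_false, Set.mem_singleton_iff]
  constructor
  · rintro ⟨h0, h⟩
    by_contra hne
    obtain ⟨M, hM, hIM⟩ := Ideal.exists_le_maximal I (by simpa using hne)
    have hM0 : M ≠ ⊥ := by
      rintro rfl
      exact h0 (le_bot_iff.1 hIM)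
    exact h ⟨M, hM.isPrime, hM0⟩ (Ideal.dvd_iff_le.2 hIM)
  · rintro rfl
    refine ⟨one_ne_zero, fun P h => P.prime.not_isUnit (isUnit_of_dvd_one h)⟩

lemma euler_finite (f : Ideal (𝓞 L) →* ℂ) (hf : ∀ P : HeightOneSpectrum (𝓞 L), ‖f P.asIdeal‖ < 1)
    (S : Finset (HeightOneSpectrum (𝓞 L))) :
    Summable (fun I : suppOn S => ‖f I‖) ∧
      HasSum (fun I : suppOn S => f I) (∏ P ∈ S, (1 - f P.asIdeal)⁻¹) := by
  classical
  induction S using Finset.induction_on with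
  | empty =>
    rw [suppOn_empty]
    refine ⟨Summable.of_finite, ?_⟩
    have := hasSum_fintype (fun I : ({1} : Set (Ideal (𝓞 L))) => f I)
    have h1 : f ⊤ = 1 := by rw [← Ideal.one_eq_top, map_one]
    simpa [h1] using this
  | insert P S hP ih =>
    obtain ⟨ih1, ih2⟩ := ih
    obtain ⟨e, he⟩ := suppOn_bij S P hP
    have g1 : Summable (fun j : ℕ => ‖f P.asIdeal ^ j‖) := by
      simp_rw [norm_pow]
      exact summable_geometric_of_lt_one (norm_nonneg _) (hf P)
    have g2 : HasSum (fun j : ℕ => f P.asIdeal ^ j) (1 - f P.asIdeal)⁻¹ :=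
      hasSum_geometric_of_norm_lt_one (hf P)
    have hcomp : (fun x : ℕ × suppOn S => f (e x)) = fun x => f P.asIdeal ^ x.1 * f x.2 := by
      ext x; rw [he, map_mul, map_pow]
    constructor
    · rw [← e.summable_iff]
      have := g1.mul_norm ih1
      refine this.congr fun x => ?_
      simp [he]
    · rw [← e.hasSum_iff, Finset.prod_insert hP]
      have hs : Summable (fun x : ℕ × suppOn S => f P.asIdeal ^ x.1 * f x.2) :=
        summable_mul_of_summable_norm (f := fun j : ℕ => f P.asIdeal ^ j)
          (g := fun I : suppOn S => f I) g1 ih1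
      have := HasSum.mul (f := fun j : ℕ => f P.asIdeal ^ j)
          (g := fun I : suppOn S => f I) g2 ih2 hs
      rw [← hcomp] at this
      exact this

lemma absNorm_gt_one (P : HeightOneSpectrum (𝓞 L)) : 1 < Ideal.absNorm P.asIdeal := by
  have h0 : Ideal.absNorm P.asIdeal ≠ 0 := by
    rw [Ne, Ideal.absNorm_eq_zero_iff]; exact P.ne_bot
  have h1 : Ideal.absNorm P.asIdeal ≠ 1 := by
    rw [Ne, Ideal.absNorm_eq_one_iff]; exact P.isPrime.ne_top
  omega

lemma minFac_spec (P : HeightOneSpectrum (𝓞 L)) :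
    P.asIdeal ∣ Ideal.span {((Ideal.absNorm P.asIdeal).minFac : 𝓞 L)} := by
  have hN := absNorm_gt_one P
  have hmem := Ideal.absNorm_mem P.asIdeal
  have hex : ∃ q : ℕ, q.Prime ∧ (q : 𝓞 L) ∈ P.asIdeal := by
    have : ((Ideal.absNorm P.asIdeal).primeFactorsList.prod : ℕ) = Ideal.absNorm P.asIdeal :=
      Nat.prod_primeFactorsList (by omega)
    rw [← this] at hmem
    have hp : ∀ l : List ℕ, (∀ q ∈ l, q.Prime) → ((l.prod : ℕ) : 𝓞 L) ∈ P.asIdeal →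
        ∃ q : ℕ, q.Prime ∧ (q : 𝓞 L) ∈ P.asIdeal := by
      intro l
      induction l with
      | nil =>
        intro _ h
        simp only [List.prod_nil, Nat.cast_one] at h
        exact absurd ((Ideal.eq_top_iff_one _).2 h) P.isPrime.ne_top
      | cons a l ih =>
        intro hl h
        rw [List.prod_cons, Nat.cast_mul] at h
        rcases P.isPrime.mem_or_mem h with h | h
        · exact ⟨a, hl a (by simp), h⟩
        · exact ih (fun q hq => hl q (by simp [hq])) h
    exact hp _ (fun q hq => Nat.prime_of_mem_primeFactorsList hq) hmem
  obtain ⟨q, hq, hqP⟩ := hex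
  have hdvd : P.asIdeal ∣ Ideal.span {(q : 𝓞 L)} := by
    rw [Ideal.dvd_iff_le, Ideal.span_singleton_le_iff_mem]; exact hqP
  have hn : Ideal.absNorm P.asIdeal ∣ q ^ Module.finrank ℚ L := by
    have := Ideal.absNorm_dvd_absNorm_of_le (Ideal.dvd_iff_le.1 hdvd)
    rw [Ideal.absNorm_span_singleton] at this
    have e : (Algebra.norm ℤ ((q : 𝓞 L))).natAbs = q ^ Module.finrank ℚ L := by
      have : ((q : 𝓞 L)) = algebraMap ℤ (𝓞 L) (q : ℤ) := by simp
      rw [this, Algebra.norm_algebraMap_of_basis (RingOfIntegers.basis L)]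
      rw [← Module.finrank_eq_card_basis (RingOfIntegers.basis L), RingOfIntegers.rank]
      simp [Int.natAbs_pow]
    rwa [e] at this
  obtain ⟨f, -, hf⟩ := (Nat.dvd_prime_pow hq).1 hn
  have hf0 : f ≠ 0 := by
    rintro rfl
    simp at hf
    exact P.isPrime.ne_top hf
  rw [hf, Nat.Prime.pow_minFac hq hf0]
  exact hdvd

lemma norm_span_nat (q : ℕ) : Ideal.absNorm (Ideal.span {(q : 𝓞 L)}) = q ^ Module.finrank ℚ L := by
  rw [Ideal.absNorm_span_singleton]
  have : ((q : 𝓞 L)) = algebraMap ℤ (𝓞 L) (q : ℤ) := by simp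
  rw [this, Algebra.norm_algebraMap_of_basis (RingOfIntegers.basis L)]
  rw [← Module.finrank_eq_card_basis (RingOfIntegers.basis L), RingOfIntegers.rank]
  simp [Int.natAbs_pow]

open Classical in
lemma card_fiber_le (S : Finset (HeightOneSpectrum (𝓞 L))) (q : ℕ) (hq : 1 < q) :
    (S.filter (fun P => (Ideal.absNorm P.asIdeal).minFac = q)).card ≤ Module.finrank ℚ L := by
  set T := S.filter (fun P => (Ideal.absNorm P.asIdeal).minFac = q) with hT
  have hprod : (∏ P ∈ T, P.asIdeal) ∣ Ideal.span {(q : 𝓞 L)} := by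
    have : ∏ P ∈ T, P.asIdeal = ∏ I ∈ T.image (fun P => P.asIdeal), I := by
      rw [Finset.prod_image]
      intro P _ Q _ h
      exact HeightOneSpectrum.ext h
    rw [this]
    apply Finset.prod_primes_dvd
    · intro I hI
      obtain ⟨P, -, rfl⟩ := Finset.mem_image.1 hI
      exact P.prime
    · intro I hI
      obtain ⟨P, hP, rfl⟩ := Finset.mem_image.1 hI
      have h1 := minFac_spec P
      rwa [(Finset.mem_filter.1 hP).2] at h1
  have h2 := Ideal.absNorm_dvd_absNorm_of_le (Ideal.dvd_iff_le.1 hprod)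
  rw [norm_span_nat, map_prod] at h2
  have h3 := Nat.le_of_dvd (by positivity) h2
  have h4 : q ^ T.card ≤ ∏ P ∈ T, Ideal.absNorm P.asIdeal := by
    rw [← Finset.prod_const]
    refine Finset.prod_le_prod' fun P hP => ?_
    rw [← (Finset.mem_filter.1 hP).2]
    exact Nat.minFac_le (by have := absNorm_gt_one P; omega)
  exact (Nat.pow_le_pow_iff_right hq).1 (h4.trans h3)

lemma sum_primes_le (S : Finset (HeightOneSpectrum (𝓞 L))) {σ : ℝ} (hσ : 1 < σ) :
    ∑ P ∈ S, (Ideal.absNorm P.asIdeal : ℝ) ^ (-σ) ≤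
      Module.finrank ℚ L * ∑' m : ℕ, (m : ℝ) ^ (-σ) := by
  classical
  have hs : Summable (fun m : ℕ => (m : ℝ) ^ (-σ)) := Real.summable_nat_rpow.2 (by linarith)
  calc ∑ P ∈ S, (Ideal.absNorm P.asIdeal : ℝ) ^ (-σ)
      ≤ ∑ P ∈ S, ((Ideal.absNorm P.asIdeal).minFac : ℝ) ^ (-σ) := by
        refine Finset.sum_le_sum fun P _ => ?_
        have h1 := absNorm_gt_one P
        apply Real.rpow_le_rpow_of_nonpos
        · exact_mod_cast Nat.minFac_pos _
        · exact_mod_cast Nat.minFac_le (by omega)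
        · linarith
    _ = ∑ q ∈ S.image (fun P => (Ideal.absNorm P.asIdeal).minFac),
          (S.filter (fun P => (Ideal.absNorm P.asIdeal).minFac = q)).card • (q : ℝ) ^ (-σ) :=
        Finset.sum_comp (fun q : ℕ => (q : ℝ) ^ (-σ)) _
    _ ≤ ∑ q ∈ S.image (fun P => (Ideal.absNorm P.asIdeal).minFac),
          (Module.finrank ℚ L : ℝ) * (q : ℝ) ^ (-σ) := by
        refine Finset.sum_le_sum fun q hq => ?_
        rw [nsmul_eq_mul]
        gcongr
        apply card_fiber_le
        obtain ⟨P, -, rfl⟩ := Finset.mem_image.1 hq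
        exact (Nat.minFac_prime (by have := absNorm_gt_one P; omega)).one_lt
    _ = Module.finrank ℚ L * ∑ q ∈ S.image (fun P => (Ideal.absNorm P.asIdeal).minFac), (q : ℝ) ^ (-σ) := by
        rw [Finset.mul_sum]
    _ ≤ _ := by
        gcongr
        exact hs.sum_le_tsum _ (fun m _ => by positivity)

lemma summable_primes {σ : ℝ} (hσ : 1 < σ) :
    Summable (fun P : HeightOneSpectrum (𝓞 L) => (Ideal.absNorm P.asIdeal : ℝ) ^ (-σ)) :=
  summable_of_sum_le (fun _ => by positivity) (fun S => sum_primes_le S hσ)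

end euler
end DH

end

section

open NumberField IsDedekindDomain Finset MeasureTheory ProbabilityTheory

namespace DH

section euler
variable {L : Type*} [Field L] [NumberField L]

lemma absNorm_pos' {I : Ideal (𝓞 L)} (hI : I ≠ ⊥) : 0 < Ideal.absNorm I :=
  Nat.pos_of_ne_zero (by rwa [Ne, Ideal.absNorm_eq_zero_iff])

/-- the multiplicative function `I ↦ N I ^ (-s)` -/
noncomputable def idF (L : Type*) [Field L] [NumberField L] (s : ℂ) : Ideal (𝓞 L) →* ℂ where
  toFun I := (Ideal.absNorm I : ℂ) ^ (-s)
  map_one' := by simp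
  map_mul' I J := by
    rw [map_mul, Nat.cast_mul, Complex.natCast_mul_natCast_cpow]

lemma idF_apply (s : ℂ) (I : Ideal (𝓞 L)) : idF L s I = (Ideal.absNorm I : ℂ) ^ (-s) := rfl

lemma norm_idF {I : Ideal (𝓞 L)} (hI : I ≠ ⊥) (s : ℂ) :
    ‖idF L s I‖ = (Ideal.absNorm I : ℝ) ^ (-s.re) := by
  rw [idF_apply, Complex.norm_natCast_cpow_of_pos (absNorm_pos' hI)]; simp

lemma rpow_neg_le_half {N : ℕ} (hN : 1 < N) {σ : ℝ} (hσ : 1 < σ) : (N:ℝ) ^ (-σ) ≤ 1/2 := by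
  have h2 : (2:ℝ) ≤ N := by exact_mod_cast hN
  calc (N:ℝ) ^ (-σ) ≤ (N:ℝ) ^ (-1:ℝ) :=
        Real.rpow_le_rpow_of_exponent_le (by linarith) (by linarith)
    _ = (N:ℝ)⁻¹ := Real.rpow_neg_one _
    _ ≤ 1/2 := by rw [one_div]; gcongr

lemma norm_idF_lt (P : HeightOneSpectrum (𝓞 L)) {s : ℂ} (hs : 1 < s.re) :
    ‖idF L s P.asIdeal‖ ≤ 1/2 := by
  rw [norm_idF P.ne_bot]
  exact rpow_neg_le_half (absNorm_gt_one P) hs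

lemma norm_idF_lt' (P : HeightOneSpectrum (𝓞 L)) {s : ℂ} (hs : 1 < s.re) :
    ‖idF L s P.asIdeal‖ < 1 := (norm_idF_lt P hs).trans_lt (by norm_num)

lemma finite_primeDivisors {I : Ideal (𝓞 L)} (hI : I ≠ ⊥) :
    {P : HeightOneSpectrum (𝓞 L) | P.asIdeal ∣ I}.Finite := Ideal.finite_factors hI

lemma sum_ideals_le (u : Finset {I : Ideal (𝓞 L) // I ≠ ⊥}) {σ : ℝ} (hσ : 1 < σ) :
    ∑ I ∈ u, (Ideal.absNorm I.1 : ℝ) ^ (-σ) ≤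
      Real.exp (2 * (Module.finrank ℚ L * ∑' m : ℕ, (m : ℝ) ^ (-σ))) := by
  classical
  set S : Finset (HeightOneSpectrum (𝓞 L)) := u.biUnion (fun I => (finite_primeDivisors I.2).toFinset) with hS
  have hsub : ∀ I ∈ u, I.1 ∈ suppOn S := by
    intro I hI
    refine ⟨I.2, fun P hP => ?_⟩
    rw [hS, Finset.mem_biUnion]
    exact ⟨I, hI, by simpa using hP⟩
  have hs : (1:ℝ) < ((σ : ℂ)).re := by simpa
  obtain ⟨h1, h2⟩ := euler_finite (idF L σ) (fun P => norm_idF_lt' P hs) S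
  have hval : ∀ I : suppOn S, ((‖idF L σ I‖ : ℝ) : ℂ) = idF L σ I := by
    intro I
    rw [norm_idF I.2.1, idF_apply]
    rw [← Complex.ofReal_natCast, ← Complex.ofReal_neg, ← Complex.ofReal_cpow (by positivity)]
    simp
  have h3 : ‖∏ P ∈ S, (1 - idF L σ P.asIdeal)⁻¹‖ = ∑' I : suppOn S, ‖idF L σ I‖ := by
    rw [← h2.tsum_eq]
    have hf : (fun I : suppOn S => idF L σ I) = fun I : suppOn S => ((‖idF L σ I‖ : ℝ) : ℂ) :=
      funext fun I => (hval I).symm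
    rw [hf, ← Complex.ofReal_tsum, Complex.norm_real, Real.norm_eq_abs, abs_of_nonneg]
    exact tsum_nonneg fun _ => norm_nonneg _
  have h4 : ∑ I ∈ u, (Ideal.absNorm I.1 : ℝ) ^ (-σ) ≤ ∑' I : suppOn S, ‖idF L σ I‖ := by
    let v : Finset (suppOn S) := u.attach.map ⟨fun I => ⟨I.1.1, hsub I.1 I.2⟩, by
      intro a b h
      have h' : a.1.1 = b.1.1 := congrArg (fun x : suppOn S => x.1) h
      exact Subtype.ext (Subtype.ext h')⟩
    have : ∑ I ∈ u, (Ideal.absNorm I.1 : ℝ) ^ (-σ) = ∑ I ∈ v, ‖idF L σ I‖ := by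
      rw [Finset.sum_map, ← Finset.sum_attach]
      refine Finset.sum_congr rfl fun I _ => ?_
      have := norm_idF I.1.2 (σ : ℂ)
      rw [Complex.ofReal_re] at this
      exact this.symm
    rw [this]
    exact h1.sum_le_tsum _ (fun _ _ => norm_nonneg _)
  refine h4.trans ?_
  rw [← h3, norm_prod]
  calc ∏ P ∈ S, ‖(1 - idF L σ P.asIdeal)⁻¹‖
      ≤ ∏ P ∈ S, Real.exp (2 * (Ideal.absNorm P.asIdeal : ℝ) ^ (-σ)) := by
        refine Finset.prod_le_prod (fun _ _ => norm_nonneg _) fun P _ => ?_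
        have a1 := norm_idF_lt P hs
        have a2 := norm_idF P.ne_bot (σ : ℂ)
        rw [Complex.ofReal_re] at a2
        rw [← a2]
        set x := ‖idF L σ P.asIdeal‖
        have a3 : 1 - x ≤ ‖1 - idF L σ P.asIdeal‖ := by
          have := norm_sub_norm_le 1 (idF L σ P.asIdeal); simpa using this
        have hx0 : 0 ≤ x := norm_nonneg _
        rw [norm_inv]
        have a4 : 1 ≤ Real.exp (2*x) * (1 - x) := by
          have := Real.add_one_le_exp (2*x)
          nlinarith
        rw [inv_le_iff_one_le_mul₀ (by linarith)]
        refine a4.trans ?_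
        gcongr
    _ = Real.exp (2 * ∑ P ∈ S, (Ideal.absNorm P.asIdeal : ℝ) ^ (-σ)) := by
        rw [← Real.exp_sum, Finset.mul_sum]
    _ ≤ _ := by
        gcongr
        exact sum_primes_le S hσ

lemma summable_ideals {σ : ℝ} (hσ : 1 < σ) :
    Summable (fun I : {I : Ideal (𝓞 L) // I ≠ ⊥} => (Ideal.absNorm I.1 : ℝ) ^ (-σ)) :=
  summable_of_sum_le (fun _ => by positivity) (fun u => sum_ideals_le u hσ)

lemma tsum_ideals_le {σ : ℝ} (hσ : 1 < σ) :
    ∑' I : {I : Ideal (𝓞 L) // I ≠ ⊥}, (Ideal.absNorm I.1 : ℝ) ^ (-σ) ≤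
      Real.exp (2 * (Module.finrank ℚ L * ∑' m : ℕ, (m : ℝ) ^ (-σ))) :=
  (summable_ideals hσ).tsum_le_of_sum_le (fun u => sum_ideals_le u hσ)

lemma summable_idF {s : ℂ} (hs : 1 < s.re) :
    Summable (fun I : {I : Ideal (𝓞 L) // I ≠ ⊥} => ‖idF L s I.1‖) :=
  (summable_ideals hs).congr fun I => (norm_idF I.2 s).symm

open Filter in
lemma euler_tendsto {s : ℂ} (hs : 1 < s.re) :
    Tendsto (fun S : Finset (HeightOneSpectrum (𝓞 L)) => ∏ P ∈ S, (1 - idF L s P.asIdeal)⁻¹) atTop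
      (nhds (∑' I : {I : Ideal (𝓞 L) // I ≠ ⊥}, idF L s I.1)) := by
  classical
  have heq : ∀ S : Finset (HeightOneSpectrum (𝓞 L)), ∏ P ∈ S, (1 - idF L s P.asIdeal)⁻¹ =
      ∑' I : {I : Ideal (𝓞 L) // I ≠ ⊥}, if I.1 ∈ suppOn S then idF L s I.1 else 0 := by
    intro S
    obtain ⟨h1, h2⟩ := euler_finite (idF L s) (fun P => norm_idF_lt' P hs) S
    rw [← h2.tsum_eq]
    let i : suppOn S → {I : Ideal (𝓞 L) // I ≠ ⊥} := fun I => ⟨I.1, I.2.1⟩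
    have hi : Function.Injective i := by
      intro a b h
      simpa [i, Subtype.ext_iff] using h
    rw [← hi.tsum_eq (f := fun I => if I.1 ∈ suppOn S then idF L s I.1 else 0)]
    · refine tsum_congr fun I => ?_
      simp [i, I.2]
    · intro I hI
      have : I.1 ∈ suppOn S := by
        by_contra h
        simp [h] at hI
      exact ⟨⟨I.1, this⟩, rfl⟩
  simp_rw [heq]
  refine tendsto_tsum_of_dominated_convergence (summable_idF hs) ?_ ?_
  · intro I
    apply tendsto_const_nhds.congr'
    filter_upwards [eventually_ge_atTop (finite_primeDivisors I.2).toFinset] with S hS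
    rw [if_pos]
    refine ⟨I.2, fun P hP => hS (by simpa using hP)⟩
  · filter_upwards with S I
    split_ifs
    · exact le_rfl
    · simp

lemma countable_hos : Countable (HeightOneSpectrum (𝓞 L)) := by
  have := (summable_primes (L := L) (σ := 2) (by norm_num)).countable_support
  have h : Function.support (fun P : HeightOneSpectrum (𝓞 L) => (Ideal.absNorm P.asIdeal : ℝ) ^ (-2:ℝ)) = Set.univ := by
    ext P
    simp only [Function.mem_support, Set.mem_univ, iff_true]
    have := absNorm_gt_one P
    positivity
  rw [h] at this
  exact Set.countable_univ_iff.1 this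

/-- weights -/
noncomputable def zw (i : HeightOneSpectrum (𝓞 L) × ℕ) : ENNReal := ENNReal.ofReal (1 / ((i.2:ℝ) + 1))
/-- positions -/
noncomputable def zx (i : HeightOneSpectrum (𝓞 L) × ℕ) : ℝ := (i.2 + 1) * Real.log (Ideal.absNorm i.1.asIdeal)

lemma zx_nonneg (i : HeightOneSpectrum (𝓞 L) × ℕ) : 0 ≤ zx i := by
  unfold zx
  have := absNorm_gt_one i.1
  have : 0 ≤ Real.log (Ideal.absNorm i.1.asIdeal) := Real.log_natCast_nonneg _
  positivity

/-- the log-zeta measure -/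
noncomputable def zmeas (L : Type*) [Field L] [NumberField L] : Measure ℝ :=
  Measure.sum (fun i : HeightOneSpectrum (𝓞 L) × ℕ => zw i • Measure.dirac (zx i))

lemma zw_toReal (i : HeightOneSpectrum (𝓞 L) × ℕ) : (zw i).toReal = 1 / ((i.2:ℝ) + 1) := by
  rw [zw, ENNReal.toReal_ofReal (by positivity)]

lemma zexp (s : ℂ) (i : HeightOneSpectrum (𝓞 L) × ℕ) :
    Complex.exp (s * ((-|zx i| : ℝ) : ℂ)) = idF L s i.1.asIdeal ^ (i.2 + 1) := by
  rw [abs_of_nonneg (zx_nonneg i), idF_apply]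
  have h0 : ((Ideal.absNorm i.1.asIdeal : ℕ) : ℂ) ≠ 0 := by
    have := absNorm_gt_one i.1
    exact_mod_cast (by omega : Ideal.absNorm i.1.asIdeal ≠ 0)
  rw [Complex.cpow_def_of_ne_zero h0, ← Complex.exp_nat_mul, zx, Complex.natCast_log.symm]
  congr 1
  push_cast
  ring

lemma zsummable {s : ℂ} (hs : 1 < s.re) :
    Summable (fun i : HeightOneSpectrum (𝓞 L) × ℕ => (zw i).toReal * ‖Complex.exp (s * ((-|zx i| : ℝ) : ℂ))‖) := by
  have hb : Summable (fun i : HeightOneSpectrum (𝓞 L) × ℕ => (Ideal.absNorm i.1.asIdeal : ℝ) ^ (-s.re) * (1/2) ^ i.2) := by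
    have := (summable_primes (L := L) hs).mul_of_nonneg (summable_geometric_two) (fun _ => by positivity) (fun _ => by positivity)
    simpa using this
  refine Summable.of_nonneg_of_le (fun i => by positivity) (fun i => ?_) hb
  rw [zw_toReal, zexp, norm_pow, pow_succ, ← norm_idF i.1.ne_bot]
  have h1 : 1 / ((i.2:ℝ) + 1) ≤ 1 := by
    rw [div_le_one (by positivity)]; linarith [(Nat.cast_nonneg i.2 : (0:ℝ) ≤ i.2)]
  have h2 := norm_idF_lt i.1 hs
  calc 1 / ((i.2:ℝ) + 1) * (‖idF L s i.1.asIdeal‖ ^ i.2 * ‖idF L s i.1.asIdeal‖)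
      ≤ 1 * ((1/2) ^ i.2 * ‖idF L s i.1.asIdeal‖) := by gcongr
    _ = _ := by ring

lemma zintegrable {s : ℂ} (hs : 1 < s.re) :
    Integrable (fun y : ℝ => Complex.exp (s * ((-|y| : ℝ) : ℂ))) (zmeas L) := by
  have := countable_hos (L := L)
  exact integrable_sum_dirac (fun i => by simp [zw]) (zsummable hs)

lemma zint_set : Set.Ioi 1 ⊆ integrableExpSet (fun y : ℝ => -|y|) (zmeas L) := by
  intro σ hσ
  have h := (zintegrable (L := L) (s := (σ:ℂ)) (by simpa using hσ)).norm
  rw [integrableExpSet, Set.mem_ofPred_eq]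
  refine h.congr (Filter.Eventually.of_forall fun y => ?_)
  simp only [Complex.norm_exp]
  congr 1
  simp

lemma zsum {s : ℂ} (hs : 1 < s.re) :
    HasSum (fun i : HeightOneSpectrum (𝓞 L) × ℕ => idF L s i.1.asIdeal ^ (i.2 + 1) / ((i.2:ℂ) + 1))
      (complexMGF (fun y : ℝ => -|y|) (zmeas L) s) := by
  have h1 := hasSum_integral_measure (zintegrable (L := L) hs)
  have hfun : (fun i : HeightOneSpectrum (𝓞 L) × ℕ => idF L s i.1.asIdeal ^ (i.2 + 1) / ((i.2:ℂ) + 1)) =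
      fun i => ∫ x, Complex.exp (s * ((-|x| : ℝ) : ℂ)) ∂(zw i • Measure.dirac (zx i)) := by
    ext i
    rw [integral_smul_measure, integral_dirac, zexp, zw_toReal]
    rw [Complex.real_smul]
    push_cast
    ring
  rw [hfun]
  exact h1

lemma zsum2 {s : ℂ} (hs : 1 < s.re) :
    HasSum (fun P : HeightOneSpectrum (𝓞 L) => -Complex.log (1 - idF L s P.asIdeal))
      (complexMGF (fun y : ℝ => -|y|) (zmeas L) s) := by
  refine (zsum hs).prod_fiberwise (fun P => ?_)
  have h := Complex.hasSum_taylorSeries_neg_log (norm_idF_lt' P hs)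
  rw [← hasSum_nat_add_iff' 1] at h
  simpa using h

open Filter in
lemma exp_tendsto {s : ℂ} (hs : 1 < s.re) :
    Tendsto (fun S : Finset (HeightOneSpectrum (𝓞 L)) => ∏ P ∈ S, (1 - idF L s P.asIdeal)⁻¹) atTop
      (nhds (Complex.exp (complexMGF (fun y : ℝ => -|y|) (zmeas L) s))) := by
  have := (Complex.continuous_exp.tendsto _).comp (zsum2 (L := L) hs)
  refine Tendsto.congr (fun S => ?_) this
  simp only [Function.comp]
  rw [Complex.exp_sum]
  refine Finset.prod_congr rfl fun P _ => ?_
  rw [Complex.exp_neg, Complex.exp_log]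
  intro h
  have h5 := norm_idF_lt' P hs
  rw [← sub_eq_zero.1 h] at h5
  simp at h5

theorem zeta_exp {s : ℂ} (hs : 1 < s.re) :
    ∑' I : {I : Ideal (𝓞 L) // I ≠ ⊥}, (Ideal.absNorm I.1 : ℂ) ^ (-s) =
      Complex.exp (complexMGF (fun y : ℝ => -|y|) (zmeas L) s) := by
  have h := tendsto_nhds_unique (euler_tendsto (L := L) hs) (exp_tendsto hs)
  simp only [idF_apply] at h
  exact h

end euler
end DH

end

section

open MeasureTheory

namespace DH

section poisson
variable {ι : Type*} [Fintype ι]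

/-- integer vector to real vector -/
def zv (k : ι → ℤ) : ι → ℝ := fun i => (k i : ℝ)

lemma finite_zv_bdd (M : ℝ) : {k : ι → ℤ | ‖zv k‖ ≤ M}.Finite := by
  classical
  refine (Set.finite_Icc (fun _ : ι => -⌈|M|⌉) (fun _ => ⌈|M|⌉)).subset fun k hk => ?_
  rw [Set.mem_ofPred_eq] at hk
  have h : ∀ i, |(k i : ℝ)| ≤ |M| := fun i => (norm_le_pi_norm (zv k) i).trans (hk.trans (le_abs_self M))
  constructor
  · intro i
    have h1 := (abs_le.1 (h i)).1
    have h2 := Int.le_ceil |M|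
    have : (-(⌈|M|⌉ : ℝ)) ≤ k i := by linarith
    exact_mod_cast this
  · intro i
    have h1 := (abs_le.1 (h i)).2
    have h2 := Int.le_ceil |M|
    have : (k i : ℝ) ≤ ⌈|M|⌉ := by linarith
    exact_mod_cast this

lemma support_bdd {g : (ι → ℝ) → ℂ} (hc : HasCompactSupport g) : ∃ M : ℝ, ∀ u, g u ≠ 0 → ‖u‖ ≤ M := by
  obtain ⟨M, hM⟩ := (hc.isCompact.isBounded).exists_norm_le
  exact ⟨M, fun u hu => hM u (subset_tsupport _ hu)⟩

lemma locFin {g : (ι → ℝ) → ℂ} (hc : HasCompactSupport g) :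
    LocallyFinite (fun k : ι → ℤ => Function.support (fun u => g (u + zv k))) := by
  obtain ⟨M, hM⟩ := support_bdd hc
  intro u
  refine ⟨Metric.ball u 1, Metric.ball_mem_nhds _ one_pos, ?_⟩
  refine (finite_zv_bdd (M + ‖u‖ + 1)).subset fun k hk => ?_
  obtain ⟨u', h1, h2⟩ := hk
  have h3 := hM _ h1
  rw [Set.mem_ofPred_eq]
  rw [mem_ball_iff_norm] at h2
  calc ‖zv k‖ = ‖(u' + zv k) - (u' - u) - u‖ := by congr 1; abel
    _ ≤ ‖(u' + zv k) - (u' - u)‖ + ‖u‖ := norm_sub_le _ _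
    _ ≤ ‖u' + zv k‖ + ‖u' - u‖ + ‖u‖ := by gcongr; exact norm_sub_le _ _
    _ ≤ _ := by linarith

lemma finSupp {g : (ι → ℝ) → ℂ} (hc : HasCompactSupport g) (u : ι → ℝ) :
    (Function.support (fun k : ι → ℤ => g (u + zv k))).Finite := (locFin hc).point_finite u

/-- periodization -/
noncomputable def per (g : (ι → ℝ) → ℂ) (u : ι → ℝ) : ℂ := ∑' k : ι → ℤ, g (u + zv k)

lemma per_cont {g : (ι → ℝ) → ℂ} (hg : Continuous g) (hc : HasCompactSupport g) : Continuous (per g) := by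
  have : per g = fun u => ∑ᶠ k : ι → ℤ, g (u + zv k) := by
    ext u
    exact tsum_eq_finsum (finSupp hc u)
  rw [this]
  exact continuous_finsum (fun k => by fun_prop) (locFin hc)

/-- the quotient map -/
def qm : (ι → ℝ) → UnitAddTorus ι := Pi.map (fun _ (x : ℝ) => (x : UnitAddCircle))

lemma qm_quot : IsOpenQuotientMap (qm (ι := ι)) :=
  IsOpenQuotientMap.piMap fun _ => QuotientAddGroup.isOpenQuotientMap_mk

lemma per_lift (g : (ι → ℝ) → ℂ) {a b : ι → ℝ} (h : qm a = qm b) : per g a = per g b := by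
  have h1 : ∀ i, ∃ n : ℤ, (n:ℝ) = b i - a i := by
    intro i
    have : ((b i : ℝ) : UnitAddCircle) - ((a i : ℝ) : UnitAddCircle) = 0 := by
      have := congrFun h i
      simp only [qm, Pi.map] at this
      rw [this, sub_self]
    rw [← AddCircle.coe_sub, AddCircle.coe_eq_zero_iff] at this
    simpa using this
  choose n hn using h1
  have hb : b = a + zv n := by ext i; simp [zv, hn]
  rw [hb, per, per, ← (Equiv.addLeft n).tsum_eq]
  refine tsum_congr fun k => ?_
  congr 1
  ext i
  simp [zv]
  ring

/-- the unit box -/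
def box (k : ι → ℤ) : Set (ι → ℝ) := {x | ∀ i, x i ∈ Set.Ioc (k i : ℝ) (k i + 1)}

lemma box_meas (k : ι → ℤ) : MeasurableSet (box k) := by
  have : box k = Set.pi Set.univ (fun i => Set.Ioc (k i : ℝ) (k i + 1)) := by
    ext x; simp [box]
  rw [this]
  exact MeasurableSet.univ_pi fun i => measurableSet_Ioc

lemma box_iUnion : ⋃ k : ι → ℤ, box k = Set.univ := by
  ext x
  simp only [Set.mem_iUnion, Set.mem_univ, iff_true]
  refine ⟨fun i => ⌈x i⌉ - 1, fun i => ⟨?_, ?_⟩⟩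
  · push_cast; linarith [Int.ceil_lt_add_one (x i)]
  · push_cast; linarith [Int.le_ceil (x i)]

lemma box_disj : Pairwise (Function.onFun Disjoint (box (ι := ι))) := by
  intro k l hkl
  rw [Function.onFun, Set.disjoint_left]
  intro x hx hy
  apply hkl
  ext i
  obtain ⟨h1, h2⟩ := hx i
  obtain ⟨h3, h4⟩ := hy i
  have h5 : (k i : ℝ) < l i + 1 := by linarith
  have h6 : (l i : ℝ) < k i + 1 := by linarith
  norm_cast at h5 h6
  omega

lemma box_shift (h : (ι → ℝ) → ℂ) (k : ι → ℤ) : ∫ x in box k, h x = ∫ x in box 0, h (x + zv k) := by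
  have := (measurePreserving_add_right (volume : Measure (ι → ℝ)) (zv k)).setIntegral_preimage_emb
    (measurableEmbedding_addRight (zv k)) h (box k)
  rw [← this]
  congr 2
  ext x
  simp [box, zv]
  refine forall_congr' fun i => ?_
  constructor <;> rintro ⟨h1, h2⟩ <;> constructor <;> linarith

lemma box_hasSum {h : (ι → ℝ) → ℂ} (hi : Integrable h) :
    HasSum (fun k : ι → ℤ => ∫ x in box 0, h (x + zv k)) (∫ x, h x) := by
  have := hasSum_integral_iUnion (fun k => box_meas k) (box_disj (ι := ι)) (hi.integrableOn)
  rw [box_iUnion, setIntegral_univ] at this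
  have hf : (fun k : ι → ℤ => ∫ x in box 0, h (x + zv k)) = fun k => ∫ x in box k, h x :=
    funext fun k => (box_shift h k).symm
  rw [hf]
  exact this

lemma unfold_box {h : (ι → ℝ) → ℂ} (hi : Integrable h) :
    ∫ x in box 0, ∑' k : ι → ℤ, h (x + zv k) = ∫ x, h x := by
  rw [← (box_hasSum hi).tsum_eq]
  symm
  refine integral_tsum_of_summable_integral_norm (fun k => ?_) ?_
  · exact (hi.comp_add_right (zv k)).integrableOn
  · have hn : Integrable (fun x => ((‖h x‖ : ℝ) : ℂ)) := hi.norm.ofReal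
    have := (box_hasSum hn).summable
    simp only [integral_complex_ofReal] at this
    exact_mod_cast this

lemma mF_eq (m : ι → ℤ) (u : ι → ℝ) : UnitAddTorus.mFourier (-m) (qm u) =
    Complex.exp (-2 * Real.pi * Complex.I * ∑ i, (m i : ℂ) * u i) := by
  simp only [UnitAddTorus.mFourier, ContinuousMap.coe_mk, qm, Pi.map]
  rw [Finset.mul_sum, Complex.exp_sum]
  refine Finset.prod_congr rfl fun i _ => ?_
  rw [fourier_coe_apply]
  congr 1
  simp
  ring

lemma mF_periodic (m k : ι → ℤ) (u : ι → ℝ) :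
    Complex.exp (-2 * Real.pi * Complex.I * ∑ i, (m i : ℂ) * ((u + zv k) i : ℝ)) =
    Complex.exp (-2 * Real.pi * Complex.I * ∑ i, (m i : ℂ) * u i) := by
  rw [← mF_eq, ← mF_eq]
  congr 1
  ext i
  simp [qm, zv]

theorem poisson_pi {g : (ι → ℝ) → ℂ} (hg : Continuous g) (hc : HasCompactSupport g)
    (hs : Summable (fun m : ι → ℤ =>
      ∫ u : ι → ℝ, Complex.exp (-2 * Real.pi * Complex.I * ∑ i, (m i : ℂ) * u i) * g u)) :
    HasSum (fun m : ι → ℤ =>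
      ∫ u : ι → ℝ, Complex.exp (-2 * Real.pi * Complex.I * ∑ i, (m i : ℂ) * u i) * g u)
      (∑' k : ι → ℤ, g (zv k)) := by
  have hq : Topology.IsQuotientMap (ContinuousMap.mk (qm (ι := ι)) qm_quot.continuous) :=
    (qm_quot (ι := ι)).isQuotientMap
  let Φ : C(UnitAddTorus ι, ℂ) := hq.lift ⟨per g, per_cont hg hc⟩ (fun a b h => per_lift g h)
  have hΦ : ∀ u, Φ (qm u) = per g u := by
    intro u
    have := hq.lift_comp ⟨per g, per_cont hg hc⟩ (fun a b h => per_lift g h)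
    exact congrArg (fun F : C(ι → ℝ, ℂ) => F u) this
  have hgi : Integrable g := hg.integrable_of_hasCompactSupport hc
  have hcoef : ∀ m : ι → ℤ, UnitAddTorus.mFourierCoeff Φ m =
      ∫ u : ι → ℝ, Complex.exp (-2 * Real.pi * Complex.I * ∑ i, (m i : ℂ) * u i) * g u := by
    intro m
    rw [UnitAddTorus.mFourierCoeff_eq_integral _ _ 0]
    have hi : Integrable (fun u : ι → ℝ =>
        Complex.exp (-2 * Real.pi * Complex.I * ∑ i, (m i : ℂ) * u i) * g u) := by
      refine Continuous.integrable_of_hasCompactSupport (by fun_prop) (hc.mul_left)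
    rw [← unfold_box hi]
    have hb : {x : ι → ℝ | ∀ i, x i ∈ Set.Ioc ((0 : ι → ℝ) i) ((0 : ι → ℝ) i + 1)} = box 0 := by
      ext x; simp [box]
    rw [hb]
    refine integral_congr_ae (Filter.Eventually.of_forall fun u => ?_)
    simp only [mF_periodic]
    rw [tsum_mul_left]
    have := hΦ u
    rw [per] at this
    rw [← this, ← mF_eq]
    rfl
  have hs' : Summable (UnitAddTorus.mFourierCoeff Φ) := by
    refine hs.congr fun m => (hcoef m).symm
  have h := UnitAddTorus.hasSum_mFourier_series_apply_of_summable hs' (qm 0)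
  rw [hΦ, per] at h
  simp only [zero_add] at h
  have hf : (fun m : ι → ℤ =>
      ∫ u : ι → ℝ, Complex.exp (-2 * Real.pi * Complex.I * ∑ i, (m i : ℂ) * u i) * g u) =
      fun i => UnitAddTorus.mFourierCoeff (⇑Φ) i • (UnitAddTorus.mFourier i) (qm 0) := by
    ext m
    rw [hcoef]
    have := mF_eq (-m) 0
    rw [neg_neg] at this
    rw [this]
    simp
  rw [hf]
  exact h

end poisson
end DH

end

section

open MeasureTheory FourierTransform

namespace DH

/-- truncated power -/
noncomputable def phi (t : ℝ) : ℝ := (max 0 (1 - t)) ^ 20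

lemma hasDerivAt_maxpow (p : ℕ) (t : ℝ) :
    HasDerivAt (fun t : ℝ => (max 0 t) ^ (p + 2)) ((p + 2) * (max 0 t) ^ (p + 1)) t := by
  rcases lt_trichotomy t 0 with h | h | h
  · have h1 : (fun t : ℝ => (max 0 t) ^ (p + 2)) =ᶠ[nhds t] fun _ => 0 := by
      filter_upwards [Iio_mem_nhds h] with x hx
      rw [max_eq_left (le_of_lt hx)]; simp
    rw [max_eq_left h.le]
    refine ((hasDerivAt_const t (0:ℝ)).congr_of_eventuallyEq h1).congr_deriv (by simp)
  · subst h
    rw [hasDerivAt_iff_isLittleO]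
    simp only [max_self, sub_zero, ne_eq, Nat.add_eq_zero_iff, OfNat.ofNat_ne_zero, and_false,
      not_false_eq_true, zero_pow, one_ne_zero, mul_zero, smul_zero]
    have : (fun x : ℝ => (max 0 x) ^ (p + 2)) =O[nhds 0] fun x => x ^ (p + 2) := by
      refine Asymptotics.IsBigO.of_bound 1 (Filter.Eventually.of_forall fun x => ?_)
      rw [norm_pow, norm_pow, one_mul]
      gcongr
      rw [Real.norm_eq_abs, Real.norm_eq_abs, abs_of_nonneg (le_max_left _ _)]
      exact max_le (abs_nonneg _) (le_abs_self _)
    refine this.trans_isLittleO ?_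
    have := Asymptotics.isLittleO_pow_pow (𝕜 := ℝ) (m := 1) (n := p + 2) (by omega)
    simpa using this
  · have h1 : (fun t : ℝ => (max 0 t) ^ (p + 2)) =ᶠ[nhds t] fun t => t ^ (p + 2) := by
      filter_upwards [Ioi_mem_nhds h] with x hx
      rw [max_eq_right (le_of_lt hx)]
    rw [max_eq_right h.le]
    refine ((hasDerivAt_pow (p + 2) t).congr_of_eventuallyEq h1).congr_deriv (by simp)

lemma contDiff_maxpow (p : ℕ) : ContDiff ℝ p (fun t : ℝ => (max 0 t) ^ (p + 1)) := by
  induction p with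
  | zero =>
    rw [Nat.cast_zero, contDiff_zero]; fun_prop
  | succ p ih =>
    have hd : deriv (fun t : ℝ => (max 0 t) ^ (p + 2)) = fun t : ℝ => ((p:ℝ) + 2) * (max 0 t) ^ (p + 1) :=
      funext fun t => (hasDerivAt_maxpow p t).deriv
    rw [Nat.cast_succ, contDiff_succ_iff_deriv]
    refine ⟨fun t => (hasDerivAt_maxpow p t).differentiableAt, by simp, ?_⟩
    rw [hd]
    exact contDiff_const.mul ih

lemma contDiff_phi : ContDiff ℝ 19 phi := by
  have := contDiff_maxpow 19
  have h2 : phi = (fun t : ℝ => (max 0 t) ^ (19 + 1)) ∘ (fun t => 1 - t) := rfl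
  rw [h2]
  exact (by exact_mod_cast this : ContDiff ℝ 19 (fun t : ℝ => (max 0 t) ^ (19 + 1))).comp
    (contDiff_const.sub contDiff_id)

lemma phi_nonneg (t : ℝ) : 0 ≤ phi t := by unfold phi; positivity
lemma phi_le_one {t : ℝ} (ht : 0 ≤ t) : phi t ≤ 1 := by
  unfold phi
  exact pow_le_one₀ (le_max_left _ _) (max_le zero_le_one (by linarith))
lemma phi_zero : phi 0 = 1 := by simp [phi]
lemma phi_eq_zero {t : ℝ} (ht : 1 ≤ t) : phi t = 0 := by
  unfold phi; rw [max_eq_left (by linarith)]; simp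
lemma phi_cont : Continuous phi := contDiff_phi.continuous

section V
variable (V : Type*) [NormedAddCommGroup V] [InnerProductSpace ℝ V] [FiniteDimensional ℝ V]

/-- bump on an inner product space -/
noncomputable def bump (v : V) : ℂ := (phi (‖v‖ ^ 2) : ℝ)

lemma contDiff_bump : ContDiff ℝ 19 (bump V) := by
  unfold bump
  exact Complex.ofRealCLM.contDiff.comp (contDiff_phi.comp (contDiff_norm_sq ℝ))

lemma bump_supp : HasCompactSupport (bump V) := by
  refine HasCompactSupport.of_support_subset_isCompact (isCompact_closedBall (0:V) 1) fun v hv => ?_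
  rw [mem_closedBall_zero_iff]
  by_contra h
  apply hv
  rw [bump, phi_eq_zero (by nlinarith)]
  simp

open Real in
theorem decayV [MeasurableSpace V] [BorelSpace V] : ∃ C : ℝ, 1 ≤ C ∧ ∀ w : V,
    ‖∫ v : V, Complex.exp (((-2 * π * inner ℝ v w : ℝ) : ℂ) * Complex.I) * bump V v‖ ≤ C ∧
    ‖w‖ ^ 18 * ‖∫ v : V, Complex.exp (((-2 * π * inner ℝ v w : ℝ) : ℂ) * Complex.I) * bump V v‖ ≤ C := by
  have h1 : ContDiff ℝ ((18 : ℕ∞) : WithTop ℕ∞) (bump V) := (contDiff_bump V).of_le (by norm_cast)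
  have h2 : ∀ (k n : ℕ), (k : ℕ∞) ≤ 0 → (n : ℕ∞) ≤ (18 : ℕ∞) →
      Integrable (fun v : V => ‖v‖ ^ k * ‖iteratedFDeriv ℝ n (bump V) v‖) := by
    intro k n _ hn
    have hc : Continuous (iteratedFDeriv ℝ n (bump V)) :=
      h1.continuous_iteratedFDeriv (by exact_mod_cast hn)
    refine Continuous.integrable_of_hasCompactSupport (by fun_prop) ?_
    have := ((bump_supp V).iteratedFDeriv (𝕜 := ℝ) n).norm
    exact this.mul_left
  have key : ∀ n : ℕ, n ≤ 18 → ∃ C : ℝ, ∀ w : V, ‖w‖ ^ n * ‖∫ v : V, Complex.exp (((-2 * π * inner ℝ v w : ℝ) : ℂ) * Complex.I) * bump V v‖ ≤ C := by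
    intro n hn
    have := fun w => Real.pow_mul_norm_iteratedFDeriv_fourier_le (f := bump V) h1 h2 (k := 0) (n := n) (by simp)
      (by exact_mod_cast hn) w
    simp only [norm_iteratedFDeriv_zero, Real.fourier_eq'] at this
    exact ⟨_, this⟩
  obtain ⟨C1, hC1⟩ := key 0 (by norm_num)
  obtain ⟨C2, hC2⟩ := key 18 (by norm_num)
  refine ⟨max 1 (max C1 C2), le_max_left _ _, fun w => ⟨?_, ?_⟩⟩
  · have := hC1 w
    rw [pow_zero, one_mul] at this
    exact this.trans ((le_max_left _ _).trans (le_max_right _ _))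
  · exact (hC2 w).trans ((le_max_right _ _).trans (le_max_right _ _))

end V

open Real in
theorem decay : ∃ C : ℝ, 1 ≤ C ∧
    (∀ (w r : ℝ), 0 < r → r⁻¹ ≤ ‖w‖ →
      ‖∫ v : ℝ, Complex.exp (((-2 * π * inner ℝ v w : ℝ) : ℂ) * Complex.I) * bump ℝ v‖ ≤ C * min 1 (r ^ 18)) ∧
    (∀ (w : ℂ) (r : ℝ), 0 < r → r⁻¹ ≤ ‖w‖ →
      ‖∫ v : ℂ, Complex.exp (((-2 * π * inner ℝ v w : ℝ) : ℂ) * Complex.I) * bump ℂ v‖ ≤ C * min 1 (r ^ 18)) := by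
  obtain ⟨C1, h1, h1'⟩ := decayV ℝ
  obtain ⟨C2, h2, h2'⟩ := decayV ℂ
  have aux : ∀ (C x y r : ℝ), 0 < r → r⁻¹ ≤ x → 0 ≤ y → y ≤ C → x ^ 18 * y ≤ C → y ≤ C * min 1 (r ^ 18) := by
    intro C x y r hr hx hy0 hy h
    rcases le_total 1 (r ^ 18) with h3 | h3
    · rw [min_eq_left h3, mul_one]; exact hy
    · rw [min_eq_right h3]
      have h4 : (r⁻¹) ^ 18 * y ≤ C := le_trans (by gcongr) h
      rw [inv_pow] at h4
      rw [mul_comm]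
      exact (inv_mul_le_iff₀ (by positivity)).1 h4
  refine ⟨max C1 C2, h1.trans (le_max_left _ _), fun w r hr hw => ?_, fun w r hr hw => ?_⟩
  · exact aux _ _ _ _ hr hw (norm_nonneg _) ((h1' w).1.trans (le_max_left _ _)) ((h1' w).2.trans (le_max_left _ _))
  · exact aux _ _ _ _ hr hw (norm_nonneg _) ((h2' w).1.trans (le_max_right _ _)) ((h2' w).2.trans (le_max_right _ _))

end DH

end

section

open NumberField NumberField.InfinitePlace NumberField.mixedEmbedding MeasureTheory

namespace DH
open scoped Classical

section mixed
variable {K : Type*} [Field K] [NumberField K]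

lemma norm_split (x : mixedSpace K) :
    mixedEmbedding.norm x = (∏ w, ‖x.1 w‖) * ∏ w, ‖x.2 w‖ ^ 2 := by
  rw [mixedEmbedding.norm_apply, ← Fintype.prod_subtype_mul_prod_subtype (fun w : InfinitePlace K => IsReal w)]
  congr 1
  · refine Fintype.prod_congr _ _ fun w => ?_
    rw [normAtPlace_apply_of_isReal w.2, mult_isReal w, pow_one]
  · refine Fintype.prod_equiv (Equiv.subtypeEquivRight fun w => not_isReal_iff_isComplex) _ _ fun w => ?_
    have hw := not_isReal_iff_isComplex.1 w.2
    rw [normAtPlace_apply_of_isComplex hw, mult, if_neg w.2]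
    rfl

lemma norm_ne_zero_split {x : mixedSpace K} :
    mixedEmbedding.norm x ≠ 0 ↔ (∀ w, x.1 w ≠ 0) ∧ (∀ w, x.2 w ≠ 0) := by
  rw [norm_split]
  simp [Finset.prod_eq_zero_iff]

/-- multiplication as linear map -/
lemma det_mulLeft (a : mixedSpace K) :
    |LinearMap.det (LinearMap.mulLeft ℝ a)| = mixedEmbedding.norm a := by
  have h : LinearMap.mulLeft ℝ a = LinearMap.prodMap
      (LinearMap.pi (fun w => (LinearMap.mulLeft ℝ (a.1 w)).comp (LinearMap.proj w)))
      (LinearMap.pi (fun w => (LinearMap.mulLeft ℝ (a.2 w)).comp (LinearMap.proj w))) := by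
    refine LinearMap.ext fun x => ?_
    rfl
  rw [h, LinearMap.det_prodMap, LinearMap.det_pi, LinearMap.det_pi, norm_split, abs_mul,
    Finset.abs_prod, Finset.abs_prod]
  congr 1
  · refine Finset.prod_congr rfl fun w _ => ?_
    have : LinearMap.det (LinearMap.mulLeft ℝ (a.1 w)) = a.1 w := by
      have := Algebra.norm_apply ℝ (a.1 w)
      rw [Algebra.norm_self] at this
      exact this.symm
    rw [this, Real.norm_eq_abs]
  · refine Finset.prod_congr rfl fun w _ => ?_
    have : LinearMap.det (LinearMap.mulLeft ℝ (a.2 w)) = ‖a.2 w‖ ^ 2 := by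
      have := Algebra.norm_apply ℝ (a.2 w)
      rw [Algebra.norm_complex_apply, Complex.normSq_eq_norm_sq] at this
      exact this.symm
    rw [this, abs_of_nonneg (by positivity)]

lemma continuous_mulE (a : mixedSpace K) : Continuous (fun x : mixedSpace K => a * x) :=
  (LinearMap.mulLeft ℝ a).continuous_of_finiteDimensional

lemma map_mulE {a : mixedSpace K} (ha : mixedEmbedding.norm a ≠ 0) :
    Measure.map (fun x : mixedSpace K => a * x) volume =
      ENNReal.ofReal (mixedEmbedding.norm a)⁻¹ • volume := by
  have hd : LinearMap.det (LinearMap.mulLeft ℝ a) ≠ 0 := by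
    intro h
    apply ha
    rw [← det_mulLeft, h, abs_zero]
  have := Measure.map_linearMap_addHaar_eq_smul_addHaar (volume : Measure (mixedSpace K)) hd
  rw [abs_inv, det_mulLeft] at this
  exact this

lemma lintegral_mulE {a : mixedSpace K} (ha : mixedEmbedding.norm a ≠ 0)
    {h : mixedSpace K → ENNReal} (hh : Measurable h) :
    ∫⁻ x, h (a * x) = ENNReal.ofReal (mixedEmbedding.norm a)⁻¹ * ∫⁻ x, h x := by
  rw [← lintegral_map hh (continuous_mulE a).measurable, map_mulE ha, lintegral_smul_measure, smul_eq_mul]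

lemma integral_mulE {a : mixedSpace K} (ha : mixedEmbedding.norm a ≠ 0)
    {h : mixedSpace K → ℂ} (hh : Continuous h) :
    ∫ x, h (a * x) = ((mixedEmbedding.norm a)⁻¹ : ℝ) * ∫ x, h x := by
  rw [← integral_map (φ := fun x => a * x) (continuous_mulE a).aemeasurable hh.aestronglyMeasurable, map_mulE ha, integral_smul_measure,
    ENNReal.toReal_ofReal (inv_nonneg.2 (mixedEmbedding.norm_nonneg a)), Complex.real_smul]

lemma integral_prodE {𝕜 : Type*} [RCLike 𝕜] (F : {w : InfinitePlace K // IsReal w} → ℝ → 𝕜)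
    (G : {w : InfinitePlace K // IsComplex w} → ℂ → 𝕜) :
    ∫ x : mixedSpace K, (∏ w, F w (x.1 w)) * ∏ w, G w (x.2 w) =
      (∏ w, ∫ y, F w y) * ∏ w, ∫ z, G w z := by
  have := integral_prod_mul (μ := (volume : Measure ({w : InfinitePlace K // IsReal w} → ℝ)))
    (ν := (volume : Measure ({w : InfinitePlace K // IsComplex w} → ℂ)))
    (fun x => ∏ w, F w (x w)) (fun x => ∏ w, G w (x w))
  rw [integral_fintype_prod_volume_eq_prod, integral_fintype_prod_volume_eq_prod] at this
  exact this

lemma integrable_prod_aux {ι κ : Type*} [Fintype ι] [Fintype κ] {F : ι → ℝ → ℝ}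
    {G : κ → ℂ → ℝ} (hF : ∀ w, Integrable (F w)) (hG : ∀ w, Integrable (G w)) :
    Integrable (fun x : (ι → ℝ) × (κ → ℂ) => (∏ w, F w (x.1 w)) * ∏ w, G w (x.2 w)) (volume.prod volume) := by
  have h1 : Integrable (fun x : ι → ℝ => ∏ w, F w (x w)) volume :=
    Integrable.fintype_prod hF
  have h2 : Integrable (fun x : κ → ℂ => ∏ w, G w (x w)) volume :=
    Integrable.fintype_prod hG
  exact Integrable.mul_prod h1 h2

lemma integrable_prodE {F : {w : InfinitePlace K // IsReal w} → ℝ → ℝ}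
    {G : {w : InfinitePlace K // IsComplex w} → ℂ → ℝ} (hF : ∀ w, Integrable (F w)) (hG : ∀ w, Integrable (G w)) :
    Integrable (fun x : mixedSpace K => (∏ w, F w (x.1 w)) * ∏ w, G w (x.2 w)) := by
  exact integrable_prod_aux hF hG

lemma lintegral_prodE {F : {w : InfinitePlace K // IsReal w} → ℝ → ℝ}
    {G : {w : InfinitePlace K // IsComplex w} → ℂ → ℝ} (hF : ∀ w, Integrable (F w)) (hG : ∀ w, Integrable (G w))
    (hF0 : ∀ w y, 0 ≤ F w y) (hG0 : ∀ w z, 0 ≤ G w z) :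
    ∫⁻ x : mixedSpace K, ENNReal.ofReal ((∏ w, F w (x.1 w)) * ∏ w, G w (x.2 w)) =
      ENNReal.ofReal ((∏ w, ∫ y, F w y) * ∏ w, ∫ z, G w z) := by
  rw [← integral_prodE, ofReal_integral_eq_lintegral_ofReal (integrable_prodE hF hG)]
  refine Filter.Eventually.of_forall fun x => ?_
  exact mul_nonneg (Finset.prod_nonneg fun w _ => hF0 w _) (Finset.prod_nonneg fun w _ => hG0 w _)

/-- trace on the mixed space -/
noncomputable def trE (x : mixedSpace K) : ℝ := (∑ w, x.1 w) + ∑ w, 2 * (x.2 w).re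

lemma trE_emb (a : K) : trE (mixedEmbedding K a) = (Algebra.trace ℚ K a : ℝ) := by
  have h1 : ((Algebra.trace ℚ K a : ℚ) : ℂ) = ∑ φ : K →+* ℂ, φ a := by
    have := trace_eq_sum_embeddings (K := ℚ) (L := K) ℂ (x := a)
    rw [eq_ratCast] at this
    rw [this]
    exact Fintype.sum_equiv (RingHom.equivRatAlgHom K ℂ).symm _ _ fun _ => rfl
  have h2 : ((trE (mixedEmbedding K a) : ℝ) : ℂ) = ∑ φ : K →+* ℂ, φ a := by
    rw [← (indexEquiv K).sum_comp, Fintype.sum_sum_type, Fintype.sum_prod_type, trE]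
    push_cast
    congr 1
    · refine Finset.sum_congr rfl fun w _ => ?_
      rw [mixedEmbedding_apply_isReal, indexEquiv_apply_isReal, embedding_of_isReal_apply]
    · refine Finset.sum_congr rfl fun w _ => ?_
      rw [Fin.sum_univ_two, indexEquiv_apply_isComplex_fst, indexEquiv_apply_isComplex_snd,
        mixedEmbedding_apply_isComplex, ComplexEmbedding.conjugate_coe_eq, Complex.add_conj]
      push_cast
      rfl
  rw [← h1] at h2
  exact_mod_cast h2

lemma trE_add (x y : mixedSpace K) : trE (x + y) = trE x + trE y := by
  simp [trE, Finset.sum_add_distrib, mul_add]; ring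

lemma trE_smul (c : ℝ) (x : mixedSpace K) : trE (c • x) = c * trE x := by
  simp [trE, Finset.mul_sum, mul_add]
  refine Finset.sum_congr rfl fun w _ => by ring

end mixed
end DH

end

section

open NumberField NumberField.InfinitePlace NumberField.mixedEmbedding MeasureTheory

namespace DH
open scoped Classical nonZeroDivisors

lemma integral_basis {E : Type*} [NormedAddCommGroup E] [NormedSpace ℝ E] [MeasurableSpace E]
    [BorelSpace E] [FiniteDimensional ℝ E] (μ : Measure E) [μ.IsAddHaarMeasure] {ι : Type*}
    [Fintype ι] (b : Module.Basis ι ℝ E) (h : E → ℂ) :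
    ∫ u : ι → ℝ, h (∑ i, u i • b i) =
      (((μ (ZSpan.fundamentalDomain b)).toReal⁻¹ : ℝ) : ℂ) * ∫ y, h y ∂μ := by
  let e : (ι → ℝ) ≃L[ℝ] E := b.equivFunL.symm
  have he : ∀ u, e u = ∑ i, u i • b i := fun u => by
    change b.equivFun.symm u = _
    rw [Module.Basis.equivFun_symm_apply]
  have := ContinuousLinearEquiv.isAddHaarMeasure_map e (volume : Measure (ι → ℝ))
  obtain ⟨c, hc⟩ : ∃ c : NNReal, Measure.map e (volume : Measure (ι → ℝ)) = c • μ :=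
    ⟨_, Measure.isAddLeftInvariant_eq_smul _ μ⟩
  have hF : (Measure.map e (volume : Measure (ι → ℝ))) (ZSpan.fundamentalDomain b) = 1 := by
    rw [Measure.map_apply e.continuous.measurable (ZSpan.fundamentalDomain_measurableSet b)]
    have : (e ⁻¹' (ZSpan.fundamentalDomain b)) = Set.univ.pi fun _ => Set.Ico 0 1 := by
      ext u
      rw [Set.mem_preimage, ZSpan.mem_fundamentalDomain, Set.mem_univ_pi]
      have : ∀ i, b.repr (e u) i = u i := fun i => by
        change b.equivFun (b.equivFun.symm u) i = _
        rw [LinearEquiv.apply_symm_apply]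
      simp [this]
    rw [this, volume_pi, Measure.pi_pi]
    simp
  rw [hc] at hF
  have hc' : (c : ℝ) = (μ (ZSpan.fundamentalDomain b)).toReal⁻¹ := by
    have : (c : ℝ) * (μ (ZSpan.fundamentalDomain b)).toReal = 1 := by
      have := congrArg ENNReal.toReal hF
      rw [Measure.smul_apply, ENNReal.smul_def, smul_eq_mul, ENNReal.toReal_mul, ENNReal.coe_toReal,
        ENNReal.toReal_one] at this
      exact this
    exact eq_inv_of_mul_eq_one_left this
  have h2 : ∫ u : ι → ℝ, h (∑ i, u i • b i) = ∫ y, h y ∂(Measure.map e (volume : Measure (ι → ℝ))) := by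
    have := (integral_map_equiv (μ := (volume : Measure (ι → ℝ))) e.toHomeomorph.toMeasurableEquiv h).symm
    simp_rw [← he]
    exact this
  rw [h2, hc, integral_smul_nnreal_measure, ← hc']
  rw [NNReal.smul_def, Complex.real_smul]

section mixed
variable {K : Type*} [Field K] [NumberField K]

/-- the test function -/
noncomputable def fE (x : mixedSpace K) : ℝ :=
  (∏ w, phi (‖x.1 w‖ ^ 2)) * ∏ w, phi (‖x.2 w‖ ^ 2)

lemma fE_nonneg (x : mixedSpace K) : 0 ≤ fE x :=
  mul_nonneg (Finset.prod_nonneg fun _ _ => phi_nonneg _) (Finset.prod_nonneg fun _ _ => phi_nonneg _)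

lemma fE_zero : fE (0 : mixedSpace K) = 1 := by
  simp [fE, phi_zero]

lemma fE_cont : Continuous (fE (K := K)) := by
  unfold fE
  have := phi_cont
  fun_prop

lemma fE_supp {x : mixedSpace K} (hx : fE x ≠ 0) : (∀ w, ‖x.1 w‖ ≤ 1) ∧ ∀ w, ‖x.2 w‖ ≤ 1 := by
  have h : ∀ t : ℝ, 0 ≤ t → phi (t ^ 2) ≠ 0 → t ≤ 1 := by
    intro t ht h
    by_contra hlt
    exact h (phi_eq_zero (by nlinarith))
  rw [fE, mul_ne_zero_iff, Finset.prod_ne_zero_iff, Finset.prod_ne_zero_iff] at hx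
  exact ⟨fun w => h _ (norm_nonneg _) (hx.1 w (Finset.mem_univ _)),
    fun w => h _ (norm_nonneg _) (hx.2 w (Finset.mem_univ _))⟩

lemma fE_compact : HasCompactSupport (fE (K := K)) := by
  refine HasCompactSupport.of_support_subset_isCompact (isCompact_closedBall (0 : mixedSpace K) 1) ?_
  intro x hx
  obtain ⟨h1, h2⟩ := fE_supp hx
  rw [mem_closedBall_zero_iff, Prod.norm_def, max_le_iff, pi_norm_le_iff_of_nonneg zero_le_one,
    pi_norm_le_iff_of_nonneg zero_le_one]
  exact ⟨h1, h2⟩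

/-- trace dual basis of a fractional ideal -/
noncomputable def dualB (J : (FractionalIdeal (𝓞 K)⁰ K)ˣ) :
    Module.Basis (Module.Free.ChooseBasisIndex ℤ J) ℚ K :=
  (Algebra.traceForm ℚ K).dualBasis (traceForm_nondegenerate ℚ K) (basisOfFractionalIdeal K J)

lemma trace_dualB (J : (FractionalIdeal (𝓞 K)⁰ K)ˣ) (i j) :
    Algebra.trace ℚ K (dualB J i * basisOfFractionalIdeal K J j) = if j = i then 1 else 0 := by
  rw [← Algebra.traceForm_apply]
  exact LinearMap.BilinForm.apply_dualBasis_left (traceForm_nondegenerate ℚ K) _ i j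

noncomputable def xiJ (J : (FractionalIdeal (𝓞 K)⁰ K)ˣ)
    (m : Module.Free.ChooseBasisIndex ℤ J → ℤ) : K := ∑ i, (m i : ℚ) • dualB J i

lemma xiJ_inj (J : (FractionalIdeal (𝓞 K)⁰ K)ˣ) : Function.Injective (xiJ J) := by
  intro m m' h
  have := (dualB J).linearIndependent
  rw [Fintype.linearIndependent_iff] at this
  have h2 := this (fun i => (m i : ℚ) - m' i) (by
    simp only [sub_smul, Finset.sum_sub_distrib]
    exact sub_eq_zero.2 h)
  funext i
  have := h2 i
  rw [sub_eq_zero] at this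
  exact_mod_cast this

lemma xiJ_zero (J : (FractionalIdeal (𝓞 K)⁰ K)ˣ) : xiJ J 0 = 0 := by simp [xiJ]

lemma xiJ_mem (J : (FractionalIdeal (𝓞 K)⁰ K)ˣ) (m) :
    xiJ J m ∈ FractionalIdeal.dual ℤ ℚ (J : FractionalIdeal (𝓞 K)⁰ K) := by
  rw [FractionalIdeal.mem_dual J.ne_zero]
  intro a ha
  have ha' : a ∈ Submodule.span ℤ (Set.range (basisOfFractionalIdeal K J)) := by
    rw [mem_span_basisOfFractionalIdeal]; exact ha
  rw [Submodule.mem_span_range_iff_exists_fun] at ha'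
  obtain ⟨c, rfl⟩ := ha'
  refine ⟨∑ i, m i * c i, ?_⟩
  rw [Algebra.traceForm_apply, xiJ, Finset.sum_mul, map_sum, map_sum]
  refine Finset.sum_congr rfl fun i _ => ?_
  rw [Finset.mul_sum, map_sum, Finset.sum_eq_single i]
  · rw [mul_smul_comm, smul_mul_assoc, map_zsmul, map_smul, trace_dualB]
    simp [mul_comm]
  · intro j _ hj
    rw [mul_smul_comm, smul_mul_assoc, map_zsmul, map_smul, trace_dualB]
    simp [hj]
  · simp

lemma repr_eq_trE (J : (FractionalIdeal (𝓞 K)⁰ K)ˣ) (y : mixedSpace K) (i) :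
    (fractionalIdealLatticeBasis K J).repr y i = trE (mixedEmbedding K (dualB J i) * y) := by
  let T : mixedSpace K →ₗ[ℝ] ℝ :=
    { toFun := fun y => trE (mixedEmbedding K (dualB J i) * y)
      map_add' := fun a b => by rw [mul_add, trE_add]
      map_smul' := fun c a => by rw [mul_smul_comm, trE_smul]; rfl }
  have : (fractionalIdealLatticeBasis K J).coord i = T := by
    refine (fractionalIdealLatticeBasis K J).ext fun j => ?_
    rw [Module.Basis.coord_apply, Module.Basis.repr_self, Finsupp.single_apply]
    change _ = trE _
    rw [fractionalIdealLatticeBasis_apply, ← map_mul, trE_emb, trace_dualB]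
    split_ifs <;> simp
  exact congrArg (fun f => f y) this

lemma sum_repr (J : (FractionalIdeal (𝓞 K)⁰ K)ˣ) (y : mixedSpace K) (m) :
    ∑ i, (m i : ℝ) * (fractionalIdealLatticeBasis K J).repr y i =
      trE (mixedEmbedding K (xiJ J m) * y) := by
  let T : K →+ ℝ :=
    { toFun := fun a => trE (mixedEmbedding K a * y)
      map_zero' := by simp [trE]
      map_add' := fun a b => by rw [map_add, add_mul, trE_add] }
  have h : ∀ a (k : ℤ), T ((k : ℚ) • a) = k * T a := by
    intro a k
    rw [Int.cast_smul_eq_zsmul, map_zsmul, zsmul_eq_mul]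
  change _ = T _
  rw [xiJ, map_sum]
  refine Finset.sum_congr rfl fun i _ => ?_
  rw [h, repr_eq_trE]; rfl

end mixed
end DH

end

section

open NumberField NumberField.InfinitePlace NumberField.mixedEmbedding MeasureTheory

namespace DH
open scoped Classical nonZeroDivisors

noncomputable def cpsi : ℝ := decay.choose
noncomputable def psi (r : ℝ) : ℝ := cpsi * min 1 (r ^ 18)

lemma cpsi_one : 1 ≤ cpsi := decay.choose_spec.1
lemma psi_nonneg (r : ℝ) : 0 ≤ psi r :=
  mul_nonneg (zero_le_one.trans cpsi_one) (le_min zero_le_one (by positivity))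

section mixed
variable {K : Type*} [Field K] [NumberField K]

noncomputable def gE (x : mixedSpace K) : ℝ := (∏ w, psi ‖x.1 w‖) * ∏ w, psi ‖x.2 w‖
lemma gE_nonneg (x : mixedSpace K) : 0 ≤ gE x :=
  mul_nonneg (Finset.prod_nonneg fun _ _ => psi_nonneg _) (Finset.prod_nonneg fun _ _ => psi_nonneg _)

lemma psi_cont : Continuous psi := by unfold psi; fun_prop

lemma gE_cont : Continuous (gE (K := K)) := by
  unfold gE
  have := psi_cont
  fun_prop

noncomputable def aE (K : Type*) [Field K] [NumberField K] : ℝ := ∫ x : mixedSpace K, fE x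

noncomputable def covol (J : (FractionalIdeal (𝓞 K)⁰ K)ˣ) : ℝ :=
  (volume (ZSpan.fundamentalDomain (fractionalIdealLatticeBasis K J))).toReal

lemma covol_pos (J : (FractionalIdeal (𝓞 K)⁰ K)ˣ) : 0 < covol J := by
  refine ENNReal.toReal_pos (ZSpan.measure_fundamentalDomain_ne_zero _) ?_
  exact (ZSpan.fundamentalDomain_isBounded _).measure_lt_top.ne

lemma fourier_E {c : mixedSpace K} (hc : mixedEmbedding.norm c ≠ 0) :
    ‖∫ z : mixedSpace K, Complex.exp (((-2 * Real.pi * trE (c * z) : ℝ) : ℂ) * Complex.I) * (fE z : ℂ)‖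
      ≤ gE c⁻¹ := by
  rw [norm_ne_zero_split] at hc
  have h1 : ∀ z : mixedSpace K,
      Complex.exp (((-2 * Real.pi * trE (c * z) : ℝ) : ℂ) * Complex.I) * (fE z : ℂ) =
      (∏ w, Complex.exp (((-2 * Real.pi * inner ℝ (z.1 w) (c.1 w) : ℝ) : ℂ) * Complex.I) * bump ℝ (z.1 w)) *
      ∏ w, Complex.exp (((-2 * Real.pi * inner ℝ (z.2 w) (2 * (starRingEnd ℂ) (c.2 w)) : ℝ) : ℂ) * Complex.I)
        * bump ℂ (z.2 w) := by
    intro z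
    rw [Finset.prod_mul_distrib, Finset.prod_mul_distrib, ← Complex.exp_sum, ← Complex.exp_sum,
      mul_mul_mul_comm, ← Complex.exp_add, ← Finset.sum_mul, ← Finset.sum_mul, ← add_mul]
    congr 1
    · congr 2
      rw [← Complex.ofReal_sum, ← Complex.ofReal_sum, ← Complex.ofReal_add, ← Finset.mul_sum,
        ← Finset.mul_sum, ← mul_add]
      congr 2
      rw [trE]
      congr 1
      refine Finset.sum_congr rfl fun w _ => ?_
      rw [Complex.inner]
      simp
      ring
    · simp only [fE, bump]
      push_cast
      rfl
  simp_rw [h1]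
  rw [integral_prodE (K := K)
    (fun w y => Complex.exp (((-2 * Real.pi * inner ℝ y (c.1 w) : ℝ) : ℂ) * Complex.I) * bump ℝ y)
    (fun w z => Complex.exp (((-2 * Real.pi * inner ℝ z (2 * (starRingEnd ℂ) (c.2 w)) : ℝ) : ℂ) * Complex.I)
        * bump ℂ z), norm_mul, norm_prod, norm_prod, gE]
  have hd := decay.choose_spec
  refine mul_le_mul (Finset.prod_le_prod (fun _ _ => norm_nonneg _) fun w _ => ?_)
    (Finset.prod_le_prod (fun _ _ => norm_nonneg _) fun w _ => ?_)
    (Finset.prod_nonneg fun _ _ => norm_nonneg _) (Finset.prod_nonneg fun _ _ => psi_nonneg _)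
  · refine hd.2.1 (c.1 w) ‖(c⁻¹).1 w‖ ?_ ?_
    · exact norm_pos_iff.2 (inv_ne_zero (hc.1 w))
    · change ‖(c.1 w)⁻¹‖⁻¹ ≤ _
      rw [norm_inv, inv_inv]
  · refine hd.2.2 _ ‖(c⁻¹).2 w‖ ?_ ?_
    · exact norm_pos_iff.2 (inv_ne_zero (hc.2 w))
    · change ‖(c.2 w)⁻¹‖⁻¹ ≤ _
      rw [norm_inv, inv_inv, norm_mul, RCLike.norm_conj, Complex.norm_ofNat]
      linarith [norm_nonneg (c.2 w)]

lemma mul_invE {x : mixedSpace K} (hx : mixedEmbedding.norm x ≠ 0) : x⁻¹ * x = 1 := by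
  rw [norm_ne_zero_split] at hx
  refine Prod.ext (funext fun w => ?_) (funext fun w => ?_)
  · exact inv_mul_cancel₀ (hx.1 w)
  · exact inv_mul_cancel₀ (hx.2 w)

lemma continuous_trE : Continuous (trE (K := K)) := by unfold trE; fun_prop

lemma fourier_lattice (J : (FractionalIdeal (𝓞 K)⁰ K)ˣ) {x : mixedSpace K}
    (hx : mixedEmbedding.norm x ≠ 0) (m : Module.Free.ChooseBasisIndex ℤ J → ℤ) :
    ∫ u : Module.Free.ChooseBasisIndex ℤ J → ℝ,
      Complex.exp (-2 * Real.pi * Complex.I * ∑ i, (m i : ℂ) * u i) *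
        (fE (x * ∑ i, u i • fractionalIdealLatticeBasis K J i) : ℂ) =
    (((covol J * mixedEmbedding.norm x)⁻¹ : ℝ) : ℂ) *
    ∫ z : mixedSpace K, Complex.exp (((-2 * Real.pi *
      trE (mixedEmbedding K (xiJ J m) * x⁻¹ * z) : ℝ) : ℂ) * Complex.I) * (fE z : ℂ) := by
  have h1 := integral_basis (volume : Measure (mixedSpace K)) (fractionalIdealLatticeBasis K J)
    (fun y => Complex.exp (((-2 * Real.pi *
      trE (mixedEmbedding K (xiJ J m) * y) : ℝ) : ℂ) * Complex.I) * (fE (x * y) : ℂ))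
  have h2 := integral_mulE hx (h := fun z => Complex.exp (((-2 * Real.pi *
      trE (mixedEmbedding K (xiJ J m) * x⁻¹ * z) : ℝ) : ℂ) * Complex.I) * (fE z : ℂ)) (by
      have h3 := continuous_trE (K := K)
      have h4 := continuous_mulE (mixedEmbedding K (xiJ J m) * x⁻¹)
      have h5 := fE_cont (K := K)
      fun_prop)
  rw [mul_inv, Complex.ofReal_mul, mul_assoc (((covol J)⁻¹ : ℝ) : ℂ), ← h2]
  have h3 : ∀ y : mixedSpace K, mixedEmbedding K (xiJ J m) * x⁻¹ * (x * y) =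
      mixedEmbedding K (xiJ J m) * y := fun y => by
    rw [mul_assoc, ← mul_assoc x⁻¹, mul_invE hx, one_mul]
  simp only [h3]
  rw [covol, ← h1]
  congr 1
  funext u
  congr 2
  rw [← sum_repr]
  have h4 : ∀ i, (fractionalIdealLatticeBasis K J).repr
      (∑ i, u i • fractionalIdealLatticeBasis K J i) i = u i := fun i => by
    rw [Module.Basis.repr_sum_self]
  simp only [h4]
  push_cast
  ring

/-- nonzero elements of a fractional ideal -/
abbrev nz (I : FractionalIdeal (𝓞 K)⁰ K) : Type _ := {a : K // a ∈ I ∧ a ≠ 0}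

noncomputable def psiJ (J : (FractionalIdeal (𝓞 K)⁰ K)ˣ) (x : mixedSpace K) : ℝ :=
  ∑' a : nz (J : FractionalIdeal (𝓞 K)⁰ K), fE (mixedEmbedding K a.1 * x)

noncomputable def latJ (J : (FractionalIdeal (𝓞 K)⁰ K)ˣ)
    (k : Module.Free.ChooseBasisIndex ℤ J → ℤ) : K := ∑ i, k i • basisOfFractionalIdeal K J i

lemma latJ_inj (J : (FractionalIdeal (𝓞 K)⁰ K)ˣ) : Function.Injective (latJ J) := by
  intro m m' h
  have := (basisOfFractionalIdeal K J).linearIndependent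
  rw [Fintype.linearIndependent_iff] at this
  have h2 := this (fun i => (m i : ℚ) - m' i) (by
    simp only [sub_smul, Finset.sum_sub_distrib, Int.cast_smul_eq_zsmul]
    exact sub_eq_zero.2 h)
  funext i
  have := h2 i
  rw [sub_eq_zero] at this
  exact_mod_cast this

lemma latJ_zero (J : (FractionalIdeal (𝓞 K)⁰ K)ˣ) : latJ J 0 = 0 := by simp [latJ]

lemma latJ_range (J : (FractionalIdeal (𝓞 K)⁰ K)ˣ) {a : K} :
    (∃ k, latJ J k = a) ↔ a ∈ (J : FractionalIdeal (𝓞 K)⁰ K) := by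
  have := mem_span_basisOfFractionalIdeal (K := K) (I := J) (x := a)
  rw [Submodule.mem_span_range_iff_exists_fun] at this
  exact this

lemma latJ_emb (J : (FractionalIdeal (𝓞 K)⁰ K)ˣ) (k) :
    ∑ i, (zv k) i • fractionalIdealLatticeBasis K J i = mixedEmbedding K (latJ J k) := by
  rw [latJ, map_sum]
  refine Finset.sum_congr rfl fun i _ => ?_
  rw [fractionalIdealLatticeBasis_apply, map_zsmul]
  exact Int.cast_smul_eq_zsmul ℝ (k i) _

noncomputable def gu (J : (FractionalIdeal (𝓞 K)⁰ K)ˣ) (x : mixedSpace K)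
    (u : Module.Free.ChooseBasisIndex ℤ J → ℝ) : ℂ :=
  (fE (x * ∑ i, u i • fractionalIdealLatticeBasis K J i) : ℂ)

lemma gu_cont (J : (FractionalIdeal (𝓞 K)⁰ K)ˣ) (x : mixedSpace K) : Continuous (gu J x) := by
  unfold gu
  have h1 := fE_cont (K := K)
  have h2 := continuous_mulE x
  have : Continuous fun u : Module.Free.ChooseBasisIndex ℤ J → ℝ =>
      ∑ i, u i • fractionalIdealLatticeBasis K J i := by fun_prop
  exact Complex.continuous_ofReal.comp (h1.comp (h2.comp this))

lemma gu_supp (J : (FractionalIdeal (𝓞 K)⁰ K)ˣ) {x : mixedSpace K}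
    (hx : mixedEmbedding.norm x ≠ 0) : HasCompactSupport (gu J x) := by
  let b := fractionalIdealLatticeBasis K J
  refine HasCompactSupport.of_support_subset_isCompact
    (K := (fun z : mixedSpace K => (b.equivFunL (x⁻¹ * z))) '' (Metric.closedBall 0 1)) ?_ ?_
  · refine (isCompact_closedBall (0 : mixedSpace K) 1).image ?_
    exact b.equivFunL.continuous.comp (continuous_mulE x⁻¹)
  · intro u hu
    have hu' : fE (x * ∑ i, u i • b i) ≠ 0 := by
      intro h
      apply hu
      rw [gu, h, Complex.ofReal_zero]
    obtain ⟨h1, h2⟩ := fE_supp hu'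
    refine ⟨x * ∑ i, u i • b i, ?_, ?_⟩
    · rw [mem_closedBall_zero_iff, Prod.norm_def, max_le_iff, pi_norm_le_iff_of_nonneg zero_le_one,
        pi_norm_le_iff_of_nonneg zero_le_one]
      exact ⟨h1, h2⟩
    · change b.equivFunL (x⁻¹ * (x * ∑ i, u i • b i)) = u
      rw [← mul_assoc, mul_invE hx, one_mul]
      change b.equivFun _ = u
      rw [← Module.Basis.equivFun_symm_apply, LinearEquiv.apply_symm_apply]

lemma gu_finite (J : (FractionalIdeal (𝓞 K)⁰ K)ˣ) {x : mixedSpace K}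
    (hx : mixedEmbedding.norm x ≠ 0) : (Function.support fun k => gu J x (zv k)).Finite := by
  have := finSupp (gu_supp J hx) 0
  simpa only [zero_add] using this

lemma gu_lat (J : (FractionalIdeal (𝓞 K)⁰ K)ˣ) (x : mixedSpace K) (k) :
    gu J x (zv k) = (fE (mixedEmbedding K (latJ J k) * x) : ℂ) := by
  rw [gu, latJ_emb, mul_comm]

noncomputable def nzk (J : (FractionalIdeal (𝓞 K)⁰ K)ˣ) (a : nz (J : FractionalIdeal (𝓞 K)⁰ K)) :
    Module.Free.ChooseBasisIndex ℤ J → ℤ := ((latJ_range J).2 a.2.1).choose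

lemma nzk_spec (J : (FractionalIdeal (𝓞 K)⁰ K)ˣ) (a : nz (J : FractionalIdeal (𝓞 K)⁰ K)) :
    latJ J (nzk J a) = a.1 := ((latJ_range J).2 a.2.1).choose_spec

lemma nzk_inj (J : (FractionalIdeal (𝓞 K)⁰ K)ˣ) : Function.Injective (nzk J) := by
  intro a b h
  apply Subtype.ext
  rw [← nzk_spec, ← nzk_spec, h]

lemma psiJ_finite (J : (FractionalIdeal (𝓞 K)⁰ K)ˣ) {x : mixedSpace K}
    (hx : mixedEmbedding.norm x ≠ 0) :
    (Function.support fun a : nz (J : FractionalIdeal (𝓞 K)⁰ K) => fE (mixedEmbedding K a.1 * x)).Finite := by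
  refine ((gu_finite J hx).preimage (f := nzk J) (nzk_inj J).injOn).subset ?_
  intro a ha
  rw [Set.mem_preimage, Function.mem_support, gu_lat, nzk_spec]
  exact_mod_cast ha

lemma psiJ_nonneg (J : (FractionalIdeal (𝓞 K)⁰ K)ˣ) (x : mixedSpace K) : 0 ≤ psiJ J x :=
  tsum_nonneg fun _ => fE_nonneg _

lemma ofReal_psiJ (J : (FractionalIdeal (𝓞 K)⁰ K)ˣ) {x : mixedSpace K}
    (hx : mixedEmbedding.norm x ≠ 0) :
    ENNReal.ofReal (psiJ J x) = ∑' a : nz (J : FractionalIdeal (𝓞 K)⁰ K),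
      ENNReal.ofReal (fE (mixedEmbedding K a.1 * x)) :=
  ENNReal.ofReal_tsum_of_nonneg (fun _ => fE_nonneg _) (summable_of_hasFiniteSupport (psiJ_finite J hx))

lemma tsum_gu (J : (FractionalIdeal (𝓞 K)⁰ K)ˣ) {x : mixedSpace K}
    (hx : mixedEmbedding.norm x ≠ 0) :
    ∑' k, gu J x (zv k) = ((psiJ J x + 1 : ℝ) : ℂ) := by
  have hs : Summable fun k => gu J x (zv k) := summable_of_hasFiniteSupport (gu_finite J hx)
  rw [hs.tsum_eq_add_tsum_ite 0, gu_lat, latJ_zero, map_zero, zero_mul, fE_zero, psiJ, add_comm,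
    Complex.ofReal_add, Complex.ofReal_tsum]
  congr 1
  rw [← (nzk_inj J).tsum_eq]
  · refine tsum_congr fun a => ?_
    have : nzk J a ≠ 0 := by
      intro h
      apply a.2.2
      rw [← nzk_spec J a, h, latJ_zero]
    rw [if_neg this, gu_lat, nzk_spec]
  · intro k hk
    have hk0 : k ≠ 0 := by
      intro h
      simp [h] at hk
    refine ⟨⟨latJ J k, (latJ_range J).1 ⟨k, rfl⟩, fun h => hk0 (latJ_inj J (h.trans (latJ_zero J).symm))⟩, ?_⟩
    exact latJ_inj J (nzk_spec J _)

lemma emb_norm_ne {a : K} (ha : a ≠ 0) : mixedEmbedding.norm (mixedEmbedding K a) ≠ 0 := by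
  rw [mixedEmbedding.norm_eq_norm]
  have := (Algebra.norm_ne_zero_iff (R := ℚ) (x := a)).2 ha
  exact_mod_cast abs_ne_zero.2 this

lemma emb_inv (a : K) : mixedEmbedding K a⁻¹ = (mixedEmbedding K a)⁻¹ := by
  refine Prod.ext (funext fun w => ?_) (funext fun w => ?_)
  · change _ = ((mixedEmbedding K a).1 w)⁻¹
    rw [mixedEmbedding_apply_isReal, mixedEmbedding_apply_isReal, map_inv₀]
  · change _ = ((mixedEmbedding K a).2 w)⁻¹
    rw [mixedEmbedding_apply_isComplex, mixedEmbedding_apply_isComplex, map_inv₀]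

theorem poisson_bound (J : (FractionalIdeal (𝓞 K)⁰ K)ˣ) {x : mixedSpace K}
    (hx : mixedEmbedding.norm x ≠ 0) :
    ENNReal.ofReal |psiJ J x + 1 - aE K / (covol J * mixedEmbedding.norm x)| ≤
      ENNReal.ofReal ((covol J * mixedEmbedding.norm x)⁻¹) *
        ∑' ξ : nz (FractionalIdeal.dual ℤ ℚ (J : FractionalIdeal (𝓞 K)⁰ K)),
          ENNReal.ofReal (gE (mixedEmbedding K (ξ.1)⁻¹ * x)) := by
  set D := covol J * mixedEmbedding.norm x with hD
  have hDpos : 0 < D := mul_pos (covol_pos J) (lt_of_le_of_ne (mixedEmbedding.norm_nonneg x) (Ne.symm hx))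
  let Fh : (Module.Free.ChooseBasisIndex ℤ J → ℤ) → ℂ := fun m =>
    ∫ u : Module.Free.ChooseBasisIndex ℤ J → ℝ,
      Complex.exp (-2 * Real.pi * Complex.I * ∑ i, (m i : ℂ) * u i) * gu J x u
  have hFh0 : Fh 0 = ((aE K / D : ℝ) : ℂ) := by
    have := fourier_lattice J hx 0
    rw [xiJ_zero, map_zero, zero_mul] at this
    refine this.trans ?_
    have h0 : trE (0 : mixedSpace K) = 0 := by simp [trE]
    simp only [zero_mul, h0, mul_zero, Complex.ofReal_zero, zero_mul, Complex.exp_zero, one_mul]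
    rw [integral_complex_ofReal, aE, ← Complex.ofReal_mul, div_eq_inv_mul]
  have hFh : ∀ m, m ≠ 0 → ‖Fh m‖ₑ ≤ ENNReal.ofReal D⁻¹ *
      ENNReal.ofReal (gE (mixedEmbedding K (xiJ J m)⁻¹ * x)) := by
    intro m hm
    have hxi : xiJ J m ≠ 0 := fun h => hm (xiJ_inj J (h.trans (xiJ_zero J).symm))
    have h1 : Fh m = _ := fourier_lattice J hx m
    rw [← ofReal_norm, ← ENNReal.ofReal_mul (by positivity)]
    refine ENNReal.ofReal_le_ofReal ?_
    rw [h1, norm_mul, Complex.norm_real, Real.norm_of_nonneg (by positivity)]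
    refine mul_le_mul_of_nonneg_left ?_ (by positivity)
    have h2 := fourier_E (K := K) (c := mixedEmbedding K (xiJ J m) * x⁻¹) (by
      rw [map_mul]
      refine mul_ne_zero (emb_norm_ne hxi) ?_
      intro h
      have := congrArg mixedEmbedding.norm (mul_invE hx)
      rw [map_mul, h, zero_mul, map_one] at this
      exact zero_ne_one this)
    rw [mul_inv, inv_inv, ← emb_inv] at h2
    exact h2
  by_cases htop : ENNReal.ofReal D⁻¹ *
        ∑' ξ : nz (FractionalIdeal.dual ℤ ℚ (J : FractionalIdeal (𝓞 K)⁰ K)),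
          ENNReal.ofReal (gE (mixedEmbedding K (ξ.1)⁻¹ * x)) = ⊤
  · rw [htop]; exact le_top
  have hle : ∑' m, (if m = 0 then 0 else ‖Fh m‖ₑ) ≤ ENNReal.ofReal D⁻¹ *
        ∑' ξ : nz (FractionalIdeal.dual ℤ ℚ (J : FractionalIdeal (𝓞 K)⁰ K)),
          ENNReal.ofReal (gE (mixedEmbedding K (ξ.1)⁻¹ * x)) := by
    rw [← ENNReal.tsum_mul_left]
    let φ : {m : Module.Free.ChooseBasisIndex ℤ J → ℤ // m ≠ 0} →
      nz (FractionalIdeal.dual ℤ ℚ (J : FractionalIdeal (𝓞 K)⁰ K)) := fun m =>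
        ⟨xiJ J m.1, xiJ_mem J m.1, fun h => m.2 (xiJ_inj J (h.trans (xiJ_zero J).symm))⟩
    have hφ : Function.Injective φ := fun a b h => Subtype.ext (xiJ_inj J (congrArg Subtype.val h))
    refine le_trans ?_ (ENNReal.tsum_comp_le_tsum_of_injective hφ _)
    rw [← tsum_subtype_eq_of_support_subset (s := {m | m ≠ 0})]
    · refine ENNReal.tsum_le_tsum fun m => ?_
      rw [if_neg m.2]
      exact hFh m.1 m.2
    · intro m hm h
      simp [h] at hm
  have hsumm : Summable fun m => if m = 0 then 0 else Fh m := by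
    refine Summable.of_enorm ?_
    refine ne_top_of_le_ne_top htop (le_trans (le_of_eq ?_) hle)
    refine tsum_congr fun m => ?_
    split_ifs <;> simp
  have hsumm2 : Summable Fh := by
    refine (hsumm.add (summable_of_hasFiniteSupport (f := fun m => if m = 0 then Fh 0 else 0) ?_)).congr fun m => ?_
    · refine (Set.finite_singleton (0 : Module.Free.ChooseBasisIndex ℤ J → ℤ)).subset ?_
      intro m hm
      by_contra h
      have h' : m ≠ 0 := h
      simp [h'] at hm
    · by_cases h : m = 0
      · simp [h]
      · simp [h]
  have hP := (poisson_pi (gu_cont J x) (gu_supp J hx) hsumm2).tsum_eq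
  rw [tsum_gu J hx] at hP
  have hP2 := hsumm2.tsum_eq_add_tsum_ite 0
  rw [hFh0] at hP2
  have hP3 : ((psiJ J x + 1 - aE K / D : ℝ) : ℂ) = ∑' m, (if m = 0 then 0 else Fh m) := by
    rw [Complex.ofReal_sub, ← hP]
    change (∑' m, Fh m) - _ = _
    rw [hP2]; ring
  calc ENNReal.ofReal |psiJ J x + 1 - aE K / D| = ‖((psiJ J x + 1 - aE K / D : ℝ) : ℂ)‖ₑ := by
        rw [← ofReal_norm, Complex.norm_real, Real.norm_eq_abs]
    _ ≤ ∑' m, ‖(if m = 0 then 0 else Fh m)‖ₑ := by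
        rw [hP3]; exact enorm_tsum_le_tsum_enorm
    _ = ∑' m, (if m = 0 then 0 else ‖Fh m‖ₑ) := by
        refine tsum_congr fun m => ?_
        split_ifs <;> simp
    _ ≤ _ := hle

end mixed
end DH

end

section

open NumberField NumberField.InfinitePlace NumberField.mixedEmbedding MeasureTheory
open NumberField.mixedEmbedding.fundamentalCone

namespace DH
open scoped Classical nonZeroDivisors

section mixed
variable {K : Type*} [Field K] [NumberField K]

lemma countable_K (K : Type*) [Field K] [NumberField K] : Countable K :=
  (Module.finBasis ℚ K).equivFun.toEquiv.countable_iff.2 inferInstance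

instance countable_units : Countable (𝓞 K)ˣ := by
  have := countable_K K
  exact Function.Injective.countable (f := fun u : (𝓞 K)ˣ => ((u : 𝓞 K) : K))
    (fun a b h => Units.ext (RingOfIntegers.ext h))

lemma null_norm_zero : volume {x : mixedSpace K | mixedEmbedding.norm x = 0} = 0 := by
  have hsub : {x : mixedSpace K | mixedEmbedding.norm x = 0} ⊆
      (⋃ w : {w : InfinitePlace K // IsReal w}, {x : mixedSpace K | x.1 w = 0}) ∪
      (⋃ w : {w : InfinitePlace K // IsComplex w}, {x : mixedSpace K | x.2 w = 0}) := by
    intro x hx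
    by_contra h
    rw [Set.mem_union, not_or, Set.mem_iUnion, Set.mem_iUnion, not_exists, not_exists] at h
    exact (norm_ne_zero_split.2 h) hx
  refine measure_mono_null hsub ?_
  rw [measure_union_null_iff, measure_iUnion_null_iff, measure_iUnion_null_iff]
  refine ⟨fun w => ?_, fun w => ?_⟩
  · let p : mixedSpace K →ₗ[ℝ] ℝ := (LinearMap.proj w).comp (LinearMap.fst ℝ _ _)
    refine Measure.addHaar_submodule volume (LinearMap.ker p) ?_
    intro h
    have h1 : (1 : mixedSpace K) ∈ LinearMap.ker p := h ▸ Submodule.mem_top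
    exact one_ne_zero (α := ℝ) h1
  · let p : mixedSpace K →ₗ[ℝ] ℂ := (LinearMap.proj w).comp (LinearMap.snd ℝ _ _)
    refine Measure.addHaar_submodule volume (LinearMap.ker p) ?_
    intro h
    have h1 : (1 : mixedSpace K) ∈ LinearMap.ker p := h ▸ Submodule.mem_top
    exact one_ne_zero (α := ℂ) h1

lemma count_cone {x : mixedSpace K} (hx : mixedEmbedding.norm x ≠ 0) :
    ∑' ε : (𝓞 K)ˣ, (fundamentalCone K).indicator (1 : mixedSpace K → ENNReal) (ε • x) =
      (Units.torsionOrder K : ENNReal) := by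
  obtain ⟨ε₀, h0⟩ := exists_unit_smul_mem hx
  rw [← (Equiv.mulRight ε₀).tsum_eq]
  have : ∀ ε : (𝓞 K)ˣ, (fundamentalCone K).indicator (1 : mixedSpace K → ENNReal)
      ((Equiv.mulRight ε₀ ε) • x) = ((Units.torsion K : Set (𝓞 K)ˣ)).indicator 1 ε := by
    intro ε
    rw [Equiv.coe_mulRight, mul_smul]
    have := unit_smul_mem_iff_mem_torsion h0 ε
    by_cases h : ε ∈ Units.torsion K
    · rw [Set.indicator_of_mem (this.2 h), Set.indicator_of_mem (show ε ∈ (Units.torsion K : Set (𝓞 K)ˣ) from h)]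
      rfl
    · rw [Set.indicator_of_notMem (fun h' => h (this.1 h')),
        Set.indicator_of_notMem (show ε ∉ (Units.torsion K : Set (𝓞 K)ˣ) from h)]
  simp_rw [this]
  rw [← tsum_subtype]
  simp only [Pi.one_apply]
  rw [ENNReal.tsum_one, Units.torsionOrder]
  have hf : Finite (Units.torsion K : Set (𝓞 K)ˣ) := inferInstanceAs (Finite (Units.torsion K))
  rw [ENat.card_eq_coe_natCard]
  rfl

lemma unfold_cone {g : mixedSpace K → ENNReal} (hg : Measurable g) :
    ∑' ε : (𝓞 K)ˣ, ∫⁻ x in fundamentalCone K, g (mixedEmbedding K (ε : K) * x) =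
      Units.torsionOrder K * ∫⁻ x, g x := by
  have hC := measurableSet_fundamentalCone K
  have hmul : ∀ a : mixedSpace K, Measurable fun x : mixedSpace K => a * x := fun a =>
    (continuous_mulE a).measurable
  have h1 : ∀ ε : (𝓞 K)ˣ, ∫⁻ x in fundamentalCone K, g (mixedEmbedding K (ε : K) * x) =
      ∫⁻ x, (fundamentalCone K).indicator (1 : mixedSpace K → ENNReal) (ε⁻¹ • x) * g x := by
    intro ε
    have hN : mixedEmbedding.norm (mixedEmbedding K (ε : K)) = 1 := norm_unit ε
    have hm : Measurable fun x : mixedSpace K =>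
      (fundamentalCone K).indicator (1 : mixedSpace K → ENNReal) (ε⁻¹ • x) * g x :=
        ((measurable_one.indicator hC).comp (hmul _)).mul hg
    have := lintegral_mulE (a := mixedEmbedding K (ε : K)) (by rw [hN]; exact one_ne_zero) hm
    rw [hN, inv_one, ENNReal.ofReal_one, one_mul] at this
    rw [← this, ← lintegral_indicator hC]
    refine lintegral_congr fun x => ?_
    have hx : ε⁻¹ • (mixedEmbedding K (ε : K) * x) = x := inv_smul_smul ε x
    rw [hx]
    by_cases hxC : x ∈ fundamentalCone K
    · simp [hxC]
    · simp [hxC]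
  simp_rw [h1]
  rw [← lintegral_tsum]
  · rw [← lintegral_const_mul _ hg]
    refine lintegral_congr_ae ?_
    have : ∀ᵐ x : mixedSpace K, mixedEmbedding.norm x ≠ 0 := by
      rw [ae_iff]; simpa using null_norm_zero (K := K)
    filter_upwards [this] with x hx
    rw [ENNReal.tsum_mul_right, ← count_cone hx]
    congr 1
    exact (Equiv.inv (𝓞 K)ˣ).tsum_eq (fun ε => (fundamentalCone K).indicator (1 : mixedSpace K → ENNReal) (ε • x))
  · intro ε
    exact (((measurable_one.indicator hC).comp (hmul _)).mul hg).aemeasurable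

/-- principal ideals inside I -/
noncomputable def pmap (I : FractionalIdeal (𝓞 K)⁰ K) (a : nz I) : FractionalIdeal (𝓞 K)⁰ K :=
  FractionalIdeal.spanSingleton _ a.1

noncomputable def gen {I : FractionalIdeal (𝓞 K)⁰ K} (i : Set.range (pmap I)) : nz I := i.2.choose

lemma gen_spec {I : FractionalIdeal (𝓞 K)⁰ K} (i : Set.range (pmap I)) :
    FractionalIdeal.spanSingleton _ (gen i).1 = i.1 := i.2.choose_spec

noncomputable def nzEquiv (I : FractionalIdeal (𝓞 K)⁰ K) :
    (Set.range (pmap I)) × (𝓞 K)ˣ ≃ nz I := by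
  refine Equiv.ofBijective (fun p => ⟨((p.2 : 𝓞 K) : K) * (gen p.1).1, ?_, ?_⟩) ⟨?_, ?_⟩
  · have := (I : Submodule (𝓞 K) K).smul_mem (p.2 : 𝓞 K) (gen p.1).2.1
    rwa [Algebra.smul_def] at this
  · exact mul_ne_zero (by simp) (gen p.1).2.2
  · rintro ⟨i, ε⟩ ⟨j, ε'⟩ h
    have h' : ((ε : 𝓞 K) : K) * (gen i).1 = ((ε' : 𝓞 K) : K) * (gen j).1 := congrArg Subtype.val h
    have hsp : ∀ (ε : (𝓞 K)ˣ) (i : Set.range (pmap I)),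
        FractionalIdeal.spanSingleton (𝓞 K)⁰ (((ε : 𝓞 K) : K) * (gen i).1) = i.1 := by
      intro ε i
      rw [← gen_spec, eq_comm, FractionalIdeal.spanSingleton_eq_spanSingleton]
      exact ⟨ε, by rw [Units.smul_def, Algebra.smul_def]⟩
    have hij : i = j := by
      apply Subtype.ext
      rw [← hsp ε i, ← hsp ε' j, h']
    subst hij
    have := mul_right_cancel₀ (gen i).2.2 h'
    refine Prod.ext rfl (Units.ext (RingOfIntegers.ext this))
  · intro a
    have := gen_spec (⟨pmap I a, a, rfl⟩ : Set.range (pmap I))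
    obtain ⟨z, hz⟩ := FractionalIdeal.spanSingleton_eq_spanSingleton.1 this
    refine ⟨⟨⟨pmap I a, a, rfl⟩, z⟩, Subtype.ext ?_⟩
    rw [Units.smul_def, Algebra.smul_def] at hz
    exact hz

lemma nzEquiv_apply (I : FractionalIdeal (𝓞 K)⁰ K) (p) :
    (nzEquiv I p).1 = ((p.2 : 𝓞 K) : K) * (gen p.1).1 := rfl

lemma sum_nz (I : FractionalIdeal (𝓞 K)⁰ K) (F : K → ENNReal) :
    ∑' a : nz I, F a.1 = ∑' i : Set.range (pmap I), ∑' ε : (𝓞 K)ˣ, F (((ε : 𝓞 K) : K) * (gen i).1) := by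
  rw [← (nzEquiv I).tsum_eq, ENNReal.tsum_prod']
  rfl

/-- sum of powers of norms of principal ideals in `I` -/
noncomputable def SI (I : FractionalIdeal (𝓞 K)⁰ K) (q : ℝ) : ENNReal :=
  ∑' i : Set.range (pmap I), ENNReal.ofReal ((FractionalIdeal.absNorm i.1 : ℝ) ^ q)

lemma norm_gen {I : FractionalIdeal (𝓞 K)⁰ K} (i : Set.range (pmap I)) :
    mixedEmbedding.norm (mixedEmbedding K (gen i).1) = (FractionalIdeal.absNorm i.1 : ℝ) := by
  rw [mixedEmbedding.norm_eq_norm, ← gen_spec, FractionalIdeal.absNorm_span_singleton]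

lemma normE_cont : Continuous (fun x : mixedSpace K => mixedEmbedding.norm x) :=
  mixedEmbedding.continuous_norm K

/-- Mellin integral -/
noncomputable def ME (h : mixedSpace K → ENNReal) (p : ℝ) : ENNReal :=
  ∫⁻ x : mixedSpace K, h x * ENNReal.ofReal (mixedEmbedding.norm x ^ p)

lemma meas_pow (p : ℝ) : Measurable fun x : mixedSpace K => ENNReal.ofReal (mixedEmbedding.norm x ^ p) :=
  ENNReal.measurable_ofReal.comp (normE_cont.measurable.pow_const p)

lemma ME_scale {h : mixedSpace K → ENNReal} (hh : Measurable h) (p : ℝ) {a : mixedSpace K}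
    (ha : mixedEmbedding.norm a ≠ 0) :
    ∫⁻ x : mixedSpace K, h (a * x) * ENNReal.ofReal (mixedEmbedding.norm x ^ p) =
      ENNReal.ofReal (mixedEmbedding.norm a ^ (-(1 + p))) * ME h p := by
  have hpos : 0 < mixedEmbedding.norm a := lt_of_le_of_ne (mixedEmbedding.norm_nonneg a) (Ne.symm ha)
  have := lintegral_mulE ha (hh.mul (meas_pow (K := K) p))
  rw [ME]
  have h2 : ∀ x : mixedSpace K, h (a * x) * ENNReal.ofReal (mixedEmbedding.norm (a * x) ^ p) =
      ENNReal.ofReal (mixedEmbedding.norm a ^ p) *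
        (h (a * x) * ENNReal.ofReal (mixedEmbedding.norm x ^ p)) := by
    intro x
    rw [map_mul, Real.mul_rpow hpos.le (mixedEmbedding.norm_nonneg x), ENNReal.ofReal_mul (by positivity)]
    ring
  have h3 : Measurable fun x : mixedSpace K => h (a * x) * ENNReal.ofReal (mixedEmbedding.norm x ^ p) :=
    (hh.comp (continuous_mulE a).measurable).mul (meas_pow p)
  simp only [Pi.mul_apply] at this
  simp_rw [h2] at this
  rw [lintegral_const_mul _ h3] at this
  have h4 : mixedEmbedding.norm a ^ (-(1 + p)) =
      (mixedEmbedding.norm a ^ p)⁻¹ * (mixedEmbedding.norm a)⁻¹ := by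
    rw [Real.rpow_neg hpos.le, Real.rpow_add hpos, Real.rpow_one, mul_inv, mul_comm]
  rw [h4, ENNReal.ofReal_mul (by positivity), mul_assoc, ← this, ← mul_assoc, ← ENNReal.ofReal_mul (by positivity),
    inv_mul_cancel₀ (by positivity), ENNReal.ofReal_one, one_mul]

lemma unfold_sum (I : FractionalIdeal (𝓞 K)⁰ K) {h : mixedSpace K → ENNReal} (hh : Measurable h) (p : ℝ) :
    ∑' a : nz I, ∫⁻ x in fundamentalCone K, h (mixedEmbedding K a.1 * x) *
      ENNReal.ofReal (mixedEmbedding.norm x ^ p) =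
    Units.torsionOrder K * (SI I (-(1 + p)) * ME h p) := by
  rw [sum_nz I (fun a => ∫⁻ x in fundamentalCone K, h (mixedEmbedding K a * x) *
      ENNReal.ofReal (mixedEmbedding.norm x ^ p)), SI, ← ENNReal.tsum_mul_right, ← ENNReal.tsum_mul_left]
  refine tsum_congr fun i => ?_
  have hm : Measurable fun x : mixedSpace K => h (mixedEmbedding K (gen i).1 * x) *
      ENNReal.ofReal (mixedEmbedding.norm x ^ p) :=
    (hh.comp (continuous_mulE _).measurable).mul (meas_pow p)
  have := unfold_cone hm
  rw [ME_scale hh p (emb_norm_ne (gen i).2.2), norm_gen] at this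
  rw [← this]
  refine tsum_congr fun ε => lintegral_congr fun x => ?_
  rw [map_mul, map_mul mixedEmbedding.norm, norm_unit, one_mul]
  congr 2
  ring

lemma unfold_sum_inv (I : FractionalIdeal (𝓞 K)⁰ K) {h : mixedSpace K → ENNReal} (hh : Measurable h) (p : ℝ) :
    ∑' a : nz I, ∫⁻ x in fundamentalCone K, h (mixedEmbedding K (a.1)⁻¹ * x) *
      ENNReal.ofReal (mixedEmbedding.norm x ^ p) =
    Units.torsionOrder K * (SI I (1 + p) * ME h p) := by
  rw [sum_nz I (fun a => ∫⁻ x in fundamentalCone K, h (mixedEmbedding K a⁻¹ * x) *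
      ENNReal.ofReal (mixedEmbedding.norm x ^ p)), SI, ← ENNReal.tsum_mul_right, ← ENNReal.tsum_mul_left]
  refine tsum_congr fun i => ?_
  have hm : Measurable fun x : mixedSpace K => h (mixedEmbedding K (gen i).1⁻¹ * x) *
      ENNReal.ofReal (mixedEmbedding.norm x ^ p) :=
    (hh.comp (continuous_mulE _).measurable).mul (meas_pow p)
  have := unfold_cone hm
  have hn : mixedEmbedding.norm (mixedEmbedding K (gen i).1⁻¹) = (FractionalIdeal.absNorm i.1 : ℝ)⁻¹ := by
    rw [← norm_gen]
    refine eq_inv_of_mul_eq_one_left ?_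
    rw [← map_mul, ← map_mul, inv_mul_cancel₀ (gen i).2.2, map_one, map_one]
  rw [ME_scale hh p (emb_norm_ne (inv_ne_zero (gen i).2.2)), hn, Real.inv_rpow (by
    rw [← norm_gen]; exact mixedEmbedding.norm_nonneg _), ← Real.rpow_neg (by
    rw [← norm_gen]; exact mixedEmbedding.norm_nonneg _), neg_neg] at this
  rw [← this, ← (Equiv.inv (𝓞 K)ˣ).tsum_eq]
  refine tsum_congr fun ε => lintegral_congr fun x => ?_
  have h2 : ((((Equiv.inv (𝓞 K)ˣ) ε : (𝓞 K)ˣ) : 𝓞 K) : K) * (gen i).1 = ((ε : K) * (gen i).1⁻¹)⁻¹ := by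
    rw [mul_inv, inv_inv, Equiv.inv_apply]
    congr 1
    exact map_units_inv (algebraMap (𝓞 K) K) ε
  rw [h2, inv_inv, map_mul, map_mul mixedEmbedding.norm, norm_unit, one_mul]
  congr 2
  ring

end mixed
end DH

end

section

open NumberField NumberField.InfinitePlace NumberField.mixedEmbedding MeasureTheory
open NumberField.mixedEmbedding.fundamentalCone

namespace DH
open scoped Classical nonZeroDivisors

section mixed
variable {K : Type*} [Field K] [NumberField K]

noncomputable def zL (K : Type*) [Field K] [NumberField K] (σ : ℝ) : ENNReal :=
  ∑' B : {B : Ideal (𝓞 K) // B ≠ ⊥}, ENNReal.ofReal ((Ideal.absNorm B.1 : ℝ) ^ (-σ))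

lemma pmap_le (I : FractionalIdeal (𝓞 K)⁰ K) (i : Set.range (pmap I)) : i.1 ≤ I := by
  rw [← gen_spec, FractionalIdeal.spanSingleton_le_iff_mem]
  exact (gen i).2.1

lemma pmap_ne (I : FractionalIdeal (𝓞 K)⁰ K) (i : Set.range (pmap I)) : i.1 ≠ 0 := by
  rw [← gen_spec, Ne, FractionalIdeal.spanSingleton_eq_zero_iff]
  exact (gen i).2.2

lemma exists_quot {I : FractionalIdeal (𝓞 K)⁰ K} (hI : I ≠ 0) (i : Set.range (pmap I)) :
    ∃ B : {B : Ideal (𝓞 K) // B ≠ ⊥}, ((B.1 : Ideal (𝓞 K)) : FractionalIdeal (𝓞 K)⁰ K) * I = i.1 := by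
  have h1 : i.1 * I⁻¹ ≤ 1 := by
    have := mul_le_mul_left (pmap_le I i) I⁻¹
    rwa [mul_inv_cancel₀ hI] at this
  obtain ⟨B, hB⟩ := FractionalIdeal.le_one_iff_exists_coeIdeal.1 h1
  have h2 : (B : FractionalIdeal (𝓞 K)⁰ K) * I = i.1 := by
    rw [hB, mul_assoc, inv_mul_cancel₀ hI, mul_one]
  refine ⟨⟨B, ?_⟩, h2⟩
  rintro rfl
  apply pmap_ne I i
  rw [← h2]; simp

lemma SI_le {I : FractionalIdeal (𝓞 K)⁰ K} (hI : I ≠ 0) (σ : ℝ) :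
    SI I (-σ) ≤ ENNReal.ofReal ((FractionalIdeal.absNorm I : ℝ) ^ (-σ)) * zL K σ := by
  rw [SI, zL, ← ENNReal.tsum_mul_left]
  choose B hB using exists_quot (K := K) hI
  have hinj : Function.Injective B := by
    intro i j h
    apply Subtype.ext
    rw [← hB i, ← hB j, h]
  refine le_trans ?_ (ENNReal.tsum_comp_le_tsum_of_injective hinj _)
  refine ENNReal.tsum_le_tsum fun i => le_of_eq ?_
  rw [← hB i, map_mul, FractionalIdeal.coeIdeal_absNorm, ← ENNReal.ofReal_mul (Real.rpow_nonneg (by exact_mod_cast FractionalIdeal.absNorm_nonneg I) _),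
    ← Real.mul_rpow (by exact_mod_cast FractionalIdeal.absNorm_nonneg I) (by positivity)]
  push_cast
  rw [mul_comm]

/-- representative ideals -/
noncomputable def repI (c : ClassGroup (𝓞 K)) : (Ideal (𝓞 K))⁰ :=
  (NumberField.exists_ideal_in_class_of_norm_le c).choose

lemma repI_spec (c : ClassGroup (𝓞 K)) : ClassGroup.mk0 (repI c) = c :=
  (NumberField.exists_ideal_in_class_of_norm_le c).choose_spec.1

lemma repI_norm (c : ClassGroup (𝓞 K)) : (Ideal.absNorm (repI c).1 : ℝ) ≤
    (4 / Real.pi) ^ nrComplexPlaces K *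
      ((Module.finrank ℚ K).factorial / (Module.finrank ℚ K) ^ (Module.finrank ℚ K) * Real.sqrt |discr K|) :=
  (NumberField.exists_ideal_in_class_of_norm_le c).choose_spec.2

lemma repI_ne (c : ClassGroup (𝓞 K)) : (repI c).1 ≠ ⊥ := nonZeroDivisors.ne_zero (repI c).2

noncomputable def repJ (c : ClassGroup (𝓞 K)) : (FractionalIdeal (𝓞 K)⁰ K)ˣ :=
  FractionalIdeal.mk0 K (repI c)

lemma repJ_coe (c : ClassGroup (𝓞 K)) : (repJ c : FractionalIdeal (𝓞 K)⁰ K) = ((repI c).1 : Ideal (𝓞 K)) :=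
  FractionalIdeal.coe_mk0 K _

lemma repJ_norm (c : ClassGroup (𝓞 K)) :
    (FractionalIdeal.absNorm (repJ c : FractionalIdeal (𝓞 K)⁰ K) : ℝ) = Ideal.absNorm (repI c).1 := by
  rw [repJ_coe, FractionalIdeal.coeIdeal_absNorm]; simp

lemma class_decomp (σ : ℝ) :
    zL K σ = ∑ c : ClassGroup (𝓞 K), ENNReal.ofReal ((Ideal.absNorm (repI c).1 : ℝ) ^ σ) *
      SI (repJ c : FractionalIdeal (𝓞 K)⁰ K) (-σ) := by
  have hq : ∀ (c : ClassGroup (𝓞 K)) (i : Set.range (pmap (repJ c : FractionalIdeal (𝓞 K)⁰ K))),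
      ∃ B : {B : Ideal (𝓞 K) // B ≠ ⊥}, ((B.1 : Ideal (𝓞 K)) : FractionalIdeal (𝓞 K)⁰ K) * (repJ c : FractionalIdeal (𝓞 K)⁰ K) = i.1 :=
    fun c i => exists_quot (repJ c).ne_zero i
  choose B hB using hq
  have hcl : ∀ c i, ClassGroup.mk0 ⟨(B c i).1, mem_nonZeroDivisors_of_ne_zero (B c i).2⟩ * c = 1 := by
    intro c i
    have h1 : ((B c i).1 : FractionalIdeal (𝓞 K)⁰ K) * ((repI c).1 : Ideal (𝓞 K)) = i.1 :=
      (congrArg (((B c i).1 : FractionalIdeal (𝓞 K)⁰ K) * ·) (repJ_coe c)).symm.trans (hB c i)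
    rw [← FractionalIdeal.coeIdeal_mul] at h1
    have hmem : (gen i).1 ∈ (((repI c).1 : Ideal (𝓞 K)) : FractionalIdeal (𝓞 K)⁰ K) := by
      rw [← repJ_coe]; exact (gen i).2.1
    rw [FractionalIdeal.mem_coeIdeal] at hmem
    obtain ⟨a, _, ha2⟩ := hmem
    have h2 := gen_spec i
    rw [← ha2, ← FractionalIdeal.coeIdeal_span_singleton] at h2
    rw [← h2, FractionalIdeal.coeIdeal_inj] at h1
    calc ClassGroup.mk0 ⟨(B c i).1, mem_nonZeroDivisors_of_ne_zero (B c i).2⟩ * c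
        = ClassGroup.mk0 ⟨(B c i).1, mem_nonZeroDivisors_of_ne_zero (B c i).2⟩ * ClassGroup.mk0 (repI c) :=
          congrArg _ (repI_spec c).symm
      _ = 1 := by
        rw [← map_mul, ClassGroup.mk0_eq_one_iff]
        change Submodule.IsPrincipal ((B c i).1 * (repI c).1)
        rw [h1]
        exact ⟨a, rfl⟩
  have hbij : Function.Bijective (fun p : Σ c, Set.range (pmap (repJ c : FractionalIdeal (𝓞 K)⁰ K)) => B p.1 p.2) := by
    constructor
    · rintro ⟨c, i⟩ ⟨c', i'⟩ h
      have h' : B c i = B c' i' := h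
      have h1 := hcl c i
      have h2 := hcl c' i'
      rw [h'] at h1
      have hc : c = c' := mul_left_cancel (h1.trans h2.symm)
      subst hc
      have : i = i' := by
        apply Subtype.ext
        rw [← hB c i, ← hB c i', h']
      rw [this]
    · intro A
      let c : ClassGroup (𝓞 K) := (ClassGroup.mk0 ⟨A.1, mem_nonZeroDivisors_of_ne_zero A.2⟩)⁻¹
      have h1 : ClassGroup.mk0 (⟨A.1, mem_nonZeroDivisors_of_ne_zero A.2⟩ * repI c) = 1 := by
        rw [map_mul, repI_spec, mul_inv_cancel]
      rw [ClassGroup.mk0_eq_one_iff] at h1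
      obtain ⟨a, ha⟩ := h1.principal
      have ha' : A.1 * (repI c).1 = Ideal.span {a} := ha
      have ha0 : a ≠ 0 := by
        rintro rfl
        have : A.1 * (repI c).1 = 0 := by rw [ha']; simp
        rcases mul_eq_zero.1 this with h | h
        · exact A.2 h
        · exact repI_ne c h
      have hmem : a ∈ (repI c).1 := Ideal.mul_le_right (I := A.1) (by rw [ha']; exact Ideal.mem_span_singleton_self a)
      have hfr : ((A.1 : Ideal (𝓞 K)) : FractionalIdeal (𝓞 K)⁰ K) * (repJ c : FractionalIdeal (𝓞 K)⁰ K) =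
          FractionalIdeal.spanSingleton (𝓞 K)⁰ (algebraMap (𝓞 K) K a) := by
        rw [repJ_coe, ← FractionalIdeal.coeIdeal_mul, ha', FractionalIdeal.coeIdeal_span_singleton]
      let a' : nz (repJ c : FractionalIdeal (𝓞 K)⁰ K) := ⟨algebraMap (𝓞 K) K a, by
        rw [repJ_coe, FractionalIdeal.mem_coeIdeal]; exact ⟨a, hmem, rfl⟩, by
        simpa using ha0⟩
      refine ⟨⟨c, ⟨pmap _ a', a', rfl⟩⟩, ?_⟩
      apply Subtype.ext
      have h2 := hB c ⟨pmap _ a', a', rfl⟩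
      have h3 := h2.trans hfr.symm
      have h4 := mul_right_cancel₀ (repJ c).ne_zero h3
      exact FractionalIdeal.coeIdeal_inj.1 h4
  rw [zL, ← (Equiv.ofBijective _ hbij).tsum_eq, ENNReal.tsum_sigma', tsum_fintype]
  refine Finset.sum_congr rfl fun c _ => ?_
  rw [SI, ← ENNReal.tsum_mul_left]
  refine tsum_congr fun i => ?_
  have hpos : 0 < (Ideal.absNorm (repI c).1 : ℝ) := by
    have := Ideal.absNorm_pos_iff_mem_nonZeroDivisors.2 (repI c).2
    exact_mod_cast this
  change ENNReal.ofReal ((Ideal.absNorm (B c i).1 : ℝ) ^ (-σ)) = _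
  rw [← hB c i, map_mul, FractionalIdeal.coeIdeal_absNorm, repJ_coe, FractionalIdeal.coeIdeal_absNorm,
    ← ENNReal.ofReal_mul (by positivity)]
  push_cast
  rw [Real.mul_rpow (by positivity) (by positivity), Real.rpow_neg hpos.le]
  congr 1
  field_simp

end mixed
end DH

end

section

open MeasureTheory ProbabilityTheory

namespace DH

section mellin
variable {α : Type*} [MeasurableSpace α] {μ : Measure α} {Nm : α → ℝ} {u : α → ENNReal}

/-- Mellin type lower integral -/
noncomputable def LI (μ : Measure α) (Nm : α → ℝ) (u : α → ENNReal) (q : ℝ) : ENNReal :=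
  ∫⁻ x, u x * ENNReal.ofReal (Nm x ^ q) ∂μ

noncomputable def mel (μ : Measure α) (Nm : α → ℝ) (u : α → ENNReal) (s : ℂ) : ℂ :=
  complexMGF (fun x => Real.log (Nm x)) (μ.withDensity u) (s - 1)

lemma lint_exp (hN : Measurable Nm) (hpos : ∀ᵐ x ∂μ, 0 < Nm x) (hu : Measurable u) (q : ℝ) :
    ∫⁻ x, ENNReal.ofReal (Real.exp (q * Real.log (Nm x))) ∂(μ.withDensity u) = LI μ Nm u q := by
  rw [lintegral_withDensity_eq_lintegral_mul _ hu (by fun_prop), LI]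
  refine lintegral_congr_ae ?_
  filter_upwards [hpos] with x hx
  rw [Pi.mul_apply, Real.rpow_def_of_pos hx, mul_comm q]

lemma mgf_eq_LI (hN : Measurable Nm) (hpos : ∀ᵐ x ∂μ, 0 < Nm x) (hu : Measurable u) (q : ℝ) :
    mgf (fun x => Real.log (Nm x)) (μ.withDensity u) q = (LI μ Nm u q).toReal := by
  rw [mgf, integral_eq_lintegral_of_nonneg_ae (Filter.Eventually.of_forall fun x => by positivity)
    (Measurable.aestronglyMeasurable (by fun_prop)), lint_exp hN hpos hu]

lemma LI_le (hpos : ∀ᵐ x ∂μ, 0 < Nm x) (hN : Measurable Nm) (hu : Measurable u) {q : ℝ} (h1 : -8 ≤ q) (h2 : q ≤ 1) :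
    LI μ Nm u q ≤ LI μ Nm u (-8) + LI μ Nm u 1 := by
  rw [LI, LI, LI, ← lintegral_add_left (by fun_prop)]
  refine lintegral_mono_ae ?_
  filter_upwards [hpos] with x hx
  rw [← mul_add, ← ENNReal.ofReal_add (by positivity) (by positivity)]
  gcongr
  rcases le_total (Nm x) 1 with h | h
  · have := Real.rpow_le_rpow_of_exponent_ge hx h h1
    exact le_add_of_le_of_nonneg this (Real.rpow_nonneg hx.le _)
  · have := Real.rpow_le_rpow_of_exponent_le h h2
    exact le_add_of_nonneg_of_le (Real.rpow_nonneg hx.le _) this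

lemma mel_real (hN : Measurable Nm) (hpos : ∀ᵐ x ∂μ, 0 < Nm x) (hu : Measurable u) (σ : ℝ) :
    mel μ Nm u σ = ((LI μ Nm u (σ - 1)).toReal : ℂ) := by
  rw [mel, ← mgf_eq_LI hN hpos hu, ← complexMGF_ofReal]
  push_cast
  rfl

lemma mel_bound (hN : Measurable Nm) (hpos : ∀ᵐ x ∂μ, 0 < Nm x) (hu : Measurable u)
    (hf : LI μ Nm u (-8) + LI μ Nm u 1 ≠ ⊤) {s : ℂ} (h1 : -7 ≤ s.re) (h2 : s.re ≤ 2) :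
    ‖mel μ Nm u s‖ ≤ (LI μ Nm u (-8) + LI μ Nm u 1).toReal := by
  refine norm_complexMGF_le_mgf.trans ?_
  rw [mgf_eq_LI hN hpos hu]
  refine ENNReal.toReal_mono hf (LI_le hpos hN hu ?_ ?_) <;> simp <;> linarith

lemma mel_diff (hN : Measurable Nm) (hpos : ∀ᵐ x ∂μ, 0 < Nm x) (hu : Measurable u)
    (hf : LI μ Nm u (-8) + LI μ Nm u 1 ≠ ⊤) :
    DifferentiableOn ℂ (mel μ Nm u) {s | -7 < s.re ∧ s.re < 2} := by
  have hset : Set.Icc (-8) 1 ⊆ integrableExpSet (fun x => Real.log (Nm x)) (μ.withDensity u) := by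
    intro q hq
    refine ⟨Measurable.aestronglyMeasurable (by fun_prop), ?_⟩
    rw [hasFiniteIntegral_iff_ofReal (Filter.Eventually.of_forall fun x => by positivity), lint_exp hN hpos hu]
    exact (LI_le hpos hN hu hq.1 hq.2).trans_lt hf.lt_top
  intro s hs
  have hin : (s - 1).re ∈ interior (integrableExpSet (fun x => Real.log (Nm x)) (μ.withDensity u)) := by
    apply interior_mono hset
    rw [interior_Icc]
    simp only [Complex.sub_re, Complex.one_re]
    exact ⟨by linarith [hs.1], by linarith [hs.2]⟩
  have h := (hasDerivAt_complexMGF hin).differentiableAt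
  have : DifferentiableAt ℂ (fun s : ℂ => complexMGF (fun x => Real.log (Nm x)) (μ.withDensity u) (s - 1)) s :=
    DifferentiableAt.comp (f := fun s : ℂ => s - 1) s h (by fun_prop)
  exact this.differentiableWithinAt

lemma push_lint (hN : Measurable Nm) (hpos : ∀ᵐ x ∂μ, 0 < Nm x) {v T : ℝ} (hv : 0 ≤ v) (hT : 0 < T)
    (hμ : ∀ t : ℝ, 0 < t → μ {x | Nm x ≤ t} = ENNReal.ofReal (v * t)) {q : ℝ} (hq : -1 < q) :
    ∫⁻ x in {x | Nm x ≤ T}, ENNReal.ofReal (Nm x ^ q) ∂μ = ENNReal.ofReal (v * (T ^ (q + 1) / (q + 1))) := by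
  have hm : ∀ t : ℝ, MeasurableSet {x | Nm x ≤ t} := fun t => measurableSet_le hN measurable_const
  have e : (μ.restrict {x | Nm x ≤ T}).map Nm = ENNReal.ofReal v • (volume.restrict (Set.Ioc 0 T)) := by
    have hfin : IsFiniteMeasure ((μ.restrict {x | Nm x ≤ T}).map Nm) := by
      constructor
      rw [Measure.map_apply hN MeasurableSet.univ]
      simp [hμ T hT]
    refine Measure.ext_of_Iic _ _ fun a => ?_
    rw [Measure.map_apply hN measurableSet_Iic, Measure.restrict_apply (hN measurableSet_Iic)]
    rw [Measure.smul_apply, Measure.restrict_apply measurableSet_Iic, smul_eq_mul]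
    rcases le_or_gt a 0 with ha | ha
    · have h1 : Set.Iic a ∩ Set.Ioc 0 T = ∅ := by
        ext x; simp; intro h2 h3; linarith
      rw [h1, measure_empty, mul_zero]
      refine measure_mono_null ?_ (ae_iff.1 hpos)
      rintro x ⟨h2, _⟩
      have : Nm x ≤ a := h2
      change ¬ (0 < Nm x)
      linarith
    · have h1 : Set.Iic a ∩ Set.Ioc 0 T = Set.Ioc 0 (min a T) := by
        ext x; simp; tauto
      have h2 : Nm ⁻¹' Set.Iic a ∩ {x | Nm x ≤ T} = {x | Nm x ≤ min a T} := by
        ext x; simp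
      rw [h1, h2, hμ _ (lt_min ha hT), Real.volume_Ioc, sub_zero, ENNReal.ofReal_mul hv]
  have e1 : ∫⁻ x in {x | Nm x ≤ T}, ENNReal.ofReal (Nm x ^ q) ∂μ =
      ∫⁻ y, ENNReal.ofReal (y ^ q) ∂((μ.restrict {x | Nm x ≤ T}).map Nm) := by
    rw [lintegral_map (by fun_prop) hN]
  rw [e1, e, lintegral_smul_measure, smul_eq_mul]
  have hintg : IntegrableOn (fun y : ℝ => y ^ q) (Set.Ioc 0 T) := by
    have := intervalIntegral.intervalIntegrable_rpow' (a := 0) (b := T) hq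
    exact (intervalIntegrable_iff_integrableOn_Ioc_of_le hT.le).1 this
  rw [← ofReal_integral_eq_lintegral_ofReal hintg, ← ENNReal.ofReal_mul hv,
    ← intervalIntegral.integral_of_le hT.le, integral_rpow (Or.inl hq), Real.zero_rpow (by linarith), sub_zero]
  rw [Filter.EventuallyLE, ae_restrict_iff' measurableSet_Ioc]
  exact Filter.Eventually.of_forall fun y hy => Real.rpow_nonneg hy.1.le _

end mellin
end DH

end

section

open MeasureTheory ProbabilityTheory

namespace DH

section mellin
variable {α : Type*} [MeasurableSpace α] {μ : Measure α} {Nm : α → ℝ}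

lemma mellin_cont (hN : Measurable Nm) (hpos : ∀ᵐ x ∂μ, 0 < Nm x) {Ψ : α → ℝ} (hΨ : Measurable Ψ)
    (hΨ0 : ∀ x, 0 ≤ Ψ x) {κ T v W D : ℝ} (hκ : 0 < κ) (hT : 0 < T) (hT1 : T ≤ 1) (hv : 0 ≤ v)
    (hμ : ∀ t : ℝ, 0 < t → μ {x | Nm x ≤ t} = ENNReal.ofReal (v * t))
    (hW0 : 0 ≤ W) (hD0 : 0 ≤ D)
    (hW : LI μ Nm (fun x => ENNReal.ofReal (Ψ x)) 1 ≤ ENNReal.ofReal W)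
    (hD : LI μ Nm (fun x => ENNReal.ofReal |Ψ x + 1 - κ / Nm x|) (-8) ≤ ENNReal.ofReal D) :
    ∃ h : ℂ → ℂ, DifferentiableOn ℂ h {s | -7 < s.re ∧ s.re < 2} ∧
      (∀ s : ℂ, -7 ≤ s.re → s.re ≤ 2 → ‖h s‖ ≤ (T ^ (-9 : ℝ) + 1) * W + 4 * D) ∧
      ∀ σ : ℝ, 1 < σ → σ ≤ 2 →
        LI μ Nm (fun x => ENNReal.ofReal (Ψ x)) (σ - 1) ≠ ⊤ ∧
        (((LI μ Nm (fun x => ENNReal.ofReal (Ψ x)) (σ - 1)).toReal : ℝ) : ℂ) =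
          h σ + ((κ * v * (T ^ (σ - 1) / (σ - 1)) : ℝ) : ℂ) - ((v * (T ^ σ / σ) : ℝ) : ℂ) := by
  have hm : MeasurableSet {x | Nm x ≤ T} := measurableSet_le hN measurable_const
  set S : Set α := {x | Nm x ≤ T} with hS
  set R : α → ℝ := fun x => Ψ x + 1 - κ / Nm x with hR
  have hRm : Measurable R := by fun_prop
  set u1 : α → ENNReal := Sᶜ.indicator (fun x => ENNReal.ofReal (Ψ x)) with hu1
  set u2 : α → ENNReal := S.indicator (fun x => ENNReal.ofReal (R x)) with hu2
  set u3 : α → ENNReal := S.indicator (fun x => ENNReal.ofReal (- R x)) with hu3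
  have m1 : Measurable u1 := (by fun_prop : Measurable fun x => ENNReal.ofReal (Ψ x)).indicator hm.compl
  have m2 : Measurable u2 := (by fun_prop : Measurable fun x => ENNReal.ofReal (R x)).indicator hm
  have m3 : Measurable u3 := (by fun_prop : Measurable fun x => ENNReal.ofReal (- R x)).indicator hm
  have b1 : LI μ Nm u1 (-8) + LI μ Nm u1 1 ≤ ENNReal.ofReal ((T ^ (-9 : ℝ) + 1) * W) := by
    have h1 : LI μ Nm u1 1 ≤ ENNReal.ofReal W := by
      refine le_trans (lintegral_mono fun x => ?_) hW
      gcongr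
      exact Set.indicator_le_self _ _ _
    have h2 : LI μ Nm u1 (-8) ≤ ENNReal.ofReal (T ^ (-9 : ℝ)) * LI μ Nm u1 1 := by
      rw [LI, LI, ← lintegral_const_mul _ (by fun_prop)]
      refine lintegral_mono fun x => ?_
      by_cases hx : x ∈ S
      · simp [hu1, hx]
      · have hx' : T < Nm x := not_le.1 hx
        have hx0 : 0 < Nm x := hT.trans hx'
        rw [mul_left_comm, ← ENNReal.ofReal_mul (by positivity)]
        gcongr
        have e : Nm x ^ (-8 : ℝ) = Nm x ^ (-9 : ℝ) * Nm x ^ (1 : ℝ) := by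
          rw [← Real.rpow_add hx0]; norm_num
        rw [e]
        gcongr ?_ * _
        exact Real.rpow_le_rpow_of_nonpos hT hx'.le (by norm_num)
    calc _ ≤ ENNReal.ofReal (T ^ (-9 : ℝ)) * ENNReal.ofReal W + ENNReal.ofReal W := by
          refine add_le_add (h2.trans ?_) h1
          gcongr
      _ = _ := by
          rw [← ENNReal.ofReal_mul (by positivity), ← ENNReal.ofReal_add (by positivity) hW0]
          congr 1; ring
  have key : ∀ u : α → ENNReal, (∀ x, u x ≤ S.indicator (fun x => ENNReal.ofReal |R x|) x) →
      LI μ Nm u (-8) + LI μ Nm u 1 ≤ ENNReal.ofReal (2 * D) := by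
    intro u hu
    have h1 : LI μ Nm u (-8) ≤ ENNReal.ofReal D := by
      refine le_trans (lintegral_mono fun x => ?_) hD
      gcongr
      exact (hu x).trans (Set.indicator_le_self _ _ _)
    have h2 : LI μ Nm u 1 ≤ LI μ Nm u (-8) := by
      refine lintegral_mono_ae ?_
      filter_upwards [hpos] with x hx
      by_cases hxS : x ∈ S
      · refine mul_le_mul' le_rfl (ENNReal.ofReal_le_ofReal ?_)
        have : Nm x ≤ T := hxS
        exact Real.rpow_le_rpow_of_exponent_ge hx (this.trans hT1) (show (-8:ℝ) ≤ 1 by norm_num)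
      · have : u x = 0 := by
          have := hu x
          simpa [hxS] using this
        simp [this]
    rw [two_mul, ENNReal.ofReal_add hD0 hD0]
    exact add_le_add h1 (h2.trans h1)
  have b2 := key u2 (fun x => by
    refine Set.indicator_le_indicator ?_
    exact ENNReal.ofReal_le_ofReal (le_abs_self _))
  have b3 := key u3 (fun x => by
    refine Set.indicator_le_indicator ?_
    exact ENNReal.ofReal_le_ofReal (neg_le_abs _))
  have f1 := (b1.trans_lt ENNReal.ofReal_lt_top).ne
  have f2 := (b2.trans_lt ENNReal.ofReal_lt_top).ne
  have f3 := (b3.trans_lt ENNReal.ofReal_lt_top).ne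
  refine ⟨fun s => mel μ Nm u1 s + mel μ Nm u2 s - mel μ Nm u3 s,
    ((mel_diff hN hpos m1 f1).add (mel_diff hN hpos m2 f2)).sub (mel_diff hN hpos m3 f3), ?_, ?_⟩
  · intro s h1 h2
    have c1 := (mel_bound hN hpos m1 f1 h1 h2).trans (ENNReal.toReal_le_of_le_ofReal (by positivity) b1)
    have c2 := (mel_bound hN hpos m2 f2 h1 h2).trans (ENNReal.toReal_le_of_le_ofReal (by positivity) b2)
    have c3 := (mel_bound hN hpos m3 f3 h1 h2).trans (ENNReal.toReal_le_of_le_ofReal (by positivity) b3)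
    have := norm_sub_le (mel μ Nm u1 s + mel μ Nm u2 s) (mel μ Nm u3 s)
    have := norm_add_le (mel μ Nm u1 s) (mel μ Nm u2 s)
    linarith
  · intro σ hσ1 hσ2
    have q1 : -8 ≤ σ - 1 := by linarith
    have q2 : σ - 1 ≤ 1 := by linarith
    have g1 := ((LI_le hpos hN m1 q1 q2).trans_lt f1.lt_top).ne
    have g2 := ((LI_le hpos hN m2 q1 q2).trans_lt f2.lt_top).ne
    have g3 := ((LI_le hpos hN m3 q1 q2).trans_lt f3.lt_top).ne
    have hp1 := push_lint hN hpos hv hT hμ (q := σ - 1) (by linarith)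
    have hp2 := push_lint hN hpos hv hT hμ (q := σ - 2) (by linarith)
    have s1 : LI μ Nm (fun x => ENNReal.ofReal (Ψ x)) (σ - 1) =
        ∫⁻ x in S, ENNReal.ofReal (Ψ x) * ENNReal.ofReal (Nm x ^ (σ - 1)) ∂μ + LI μ Nm u1 (σ - 1) := by
      rw [LI, ← lintegral_add_compl _ hm, LI, ← lintegral_indicator hm.compl]
      congr 2
      ext x
      by_cases hx : x ∈ S <;> simp [hu1, hx]
    have s2 : LI μ Nm u2 (σ - 1) = ∫⁻ x in S, ENNReal.ofReal (R x) * ENNReal.ofReal (Nm x ^ (σ - 1)) ∂μ := by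
      rw [LI, ← lintegral_indicator hm]
      congr 2
      ext x
      by_cases hx : x ∈ S <;> simp [hu2, hx]
    have s3 : LI μ Nm u3 (σ - 1) = ∫⁻ x in S, ENNReal.ofReal (- R x) * ENNReal.ofReal (Nm x ^ (σ - 1)) ∂μ := by
      rw [LI, ← lintegral_indicator hm]
      congr 2
      ext x
      by_cases hx : x ∈ S <;> simp [hu3, hx]
    set A := ∫⁻ x in S, ENNReal.ofReal (Ψ x) * ENNReal.ofReal (Nm x ^ (σ - 1)) ∂μ with hA
    have main : A + LI μ Nm u3 (σ - 1) + ENNReal.ofReal (v * (T ^ (σ - 1 + 1) / (σ - 1 + 1))) =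
        LI μ Nm u2 (σ - 1) + ENNReal.ofReal κ * ENNReal.ofReal (v * (T ^ (σ - 2 + 1) / (σ - 2 + 1))) := by
      rw [← hp1, ← hp2, s2, s3, hA, ← lintegral_add_left (by fun_prop), ← lintegral_add_left (by fun_prop),
        ← lintegral_const_mul _ (by fun_prop), ← lintegral_add_left (by fun_prop)]
      refine lintegral_congr_ae ?_
      filter_upwards [ae_restrict_of_ae hpos] with x hx
      have e1 : Nm x ^ (σ - 2) = Nm x ^ (σ - 1) / Nm x := by
        rw [← Real.rpow_sub_one hx.ne']; congr 1; ring
      have hn : 0 ≤ Nm x ^ (σ - 1) := by positivity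
      have hn2 : 0 ≤ Nm x ^ (σ - 2) := by positivity
      have hneg : ENNReal.ofReal (R x) = ENNReal.ofReal (max (R x) 0) := by
        simp
      have hneg2 : ENNReal.ofReal (-R x) = ENNReal.ofReal (max (-R x) 0) := by
        simp
      have hmm : max (R x) 0 - max (-R x) 0 = R x := by
        rcases le_total (R x) 0 with h | h
        · rw [max_eq_right h, max_eq_left (by linarith)]; ring
        · rw [max_eq_left h, max_eq_right (by linarith)]; ring
      rw [hneg, hneg2, ← ENNReal.ofReal_mul (hΨ0 x), ← ENNReal.ofReal_mul (by positivity),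
        ← ENNReal.ofReal_mul (by positivity), ← ENNReal.ofReal_mul (by positivity),
        ← ENNReal.ofReal_add (mul_nonneg (hΨ0 x) hn) (by positivity), ← ENNReal.ofReal_add _ hn,
        ← ENNReal.ofReal_add (by positivity) (by positivity)]
      · congr 1
        rw [e1]
        have : Ψ x = max (R x) 0 - max (-R x) 0 - 1 + κ / Nm x := by
          rw [hmm, hR]; ring
        rw [this]
        ring
      · have := mul_nonneg (hΨ0 x) hn
        positivity
    have gA : A ≠ ⊤ := by
      refine ne_top_of_le_ne_top ?_ (le_self_add.trans (le_self_add.trans main.le))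
      exact ENNReal.add_ne_top.2 ⟨g2, ENNReal.mul_ne_top ENNReal.ofReal_ne_top ENNReal.ofReal_ne_top⟩
    refine ⟨by rw [s1]; exact ENNReal.add_ne_top.2 ⟨gA, g1⟩, ?_⟩
    have mainR := congrArg ENNReal.toReal main
    have e1 : σ - 1 + 1 = σ := by ring
    have e2 : σ - 2 + 1 = σ - 1 := by ring
    have p1 : 0 < σ - 1 := by linarith
    have p0 : 0 < σ := by linarith
    rw [ENNReal.toReal_add (ENNReal.add_ne_top.2 ⟨gA, g3⟩) ENNReal.ofReal_ne_top,
      ENNReal.toReal_add gA g3, ENNReal.toReal_add g2 (ENNReal.mul_ne_top ENNReal.ofReal_ne_top ENNReal.ofReal_ne_top),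
      ENNReal.toReal_mul, e1, e2, ENNReal.toReal_ofReal (by positivity), ENNReal.toReal_ofReal (by positivity),
      ENNReal.toReal_ofReal (by positivity)] at mainR
    have fin : (LI μ Nm (fun x => ENNReal.ofReal (Ψ x)) (σ - 1)).toReal =
        ((LI μ Nm u1 (σ - 1)).toReal + (LI μ Nm u2 (σ - 1)).toReal - (LI μ Nm u3 (σ - 1)).toReal) +
        κ * v * (T ^ (σ - 1) / (σ - 1)) - v * (T ^ σ / σ) := by
      rw [s1, ENNReal.toReal_add gA g1]
      linarith
    simp only []
    rw [fin, mel_real hN hpos m1, mel_real hN hpos m2, mel_real hN hpos m3]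
    push_cast
    ring

end mellin
end DH

end

section

open NumberField NumberField.InfinitePlace NumberField.mixedEmbedding MeasureTheory
open NumberField.mixedEmbedding.fundamentalCone

namespace DH
open scoped Classical nonZeroDivisors Pointwise

section mixed
variable {K : Type*} [Field K] [NumberField K]

lemma cone_vol {t : ℝ} (ht : 0 < t) :
    (volume.restrict (fundamentalCone K)) {x : mixedSpace K | mixedEmbedding.norm x ≤ t} =
      ENNReal.ofReal ((volume (normLeOne K)).toReal * t) := by
  have hn : (Module.finrank ℚ K : ℝ) ≠ 0 := by
    exact_mod_cast (Module.finrank_pos (R := ℚ) (M := K)).ne'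
  set c : ℝ := t ^ ((Module.finrank ℚ K : ℝ)⁻¹) with hc
  have hc0 : 0 < c := by positivity
  have hcn : c ^ Module.finrank ℚ K = t := by
    rw [hc, ← Real.rpow_natCast, ← Real.rpow_mul ht.le, inv_mul_cancel₀ hn, Real.rpow_one]
  have hm : MeasurableSet {x : mixedSpace K | mixedEmbedding.norm x ≤ t} :=
    measurableSet_le normE_cont.measurable measurable_const
  have e : {x : mixedSpace K | mixedEmbedding.norm x ≤ t} ∩ fundamentalCone K = c • normLeOne K := by
    ext x
    rw [Set.mem_smul_set_iff_inv_smul_mem₀ hc0.ne', mem_normLeOne, smul_mem_iff_mem (inv_ne_zero hc0.ne'),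
      mixedEmbedding.norm_smul, abs_of_pos (inv_pos.2 hc0), inv_pow, hcn, inv_mul_le_iff₀ ht, mul_one, and_comm]
    rfl
  have hfin : volume (normLeOne K) ≠ ⊤ := by
    rw [volume_normLeOne]
    refine ENNReal.mul_ne_top (ENNReal.mul_ne_top ?_ ?_) ENNReal.ofReal_ne_top
    · exact ENNReal.pow_ne_top (by simp)
    · exact ENNReal.pow_ne_top (by simp)
  rw [Measure.restrict_apply hm, e, Measure.addHaar_smul, mixedEmbedding.finrank, hcn, abs_of_pos ht,
    ENNReal.ofReal_mul ENNReal.toReal_nonneg, ENNReal.ofReal_toReal hfin, mul_comm]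

noncomputable def psiM (J : (FractionalIdeal (𝓞 K)⁰ K)ˣ) (x : mixedSpace K) : ENNReal :=
  ∑' a : nz (J : FractionalIdeal (𝓞 K)⁰ K), ENNReal.ofReal (fE (mixedEmbedding K a.1 * x))

lemma meas_fE (a : mixedSpace K) : Measurable fun x : mixedSpace K => ENNReal.ofReal (fE (a * x)) :=
  ENNReal.measurable_ofReal.comp (fE_cont.comp (continuous_mulE a)).measurable

lemma meas_gE (a : mixedSpace K) : Measurable fun x : mixedSpace K => ENNReal.ofReal (gE (a * x)) :=
  ENNReal.measurable_ofReal.comp (gE_cont.comp (continuous_mulE a)).measurable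

lemma meas_fE2 (a : mixedSpace K) (p : ℝ) : Measurable fun x : mixedSpace K =>
    ENNReal.ofReal (fE (a * x)) * ENNReal.ofReal (mixedEmbedding.norm x ^ p) :=
  (meas_fE a).mul (meas_pow p)

lemma meas_gE2 (a : mixedSpace K) (p : ℝ) : Measurable fun x : mixedSpace K =>
    ENNReal.ofReal (gE (a * x)) * ENNReal.ofReal (mixedEmbedding.norm x ^ p) :=
  (meas_gE a).mul (meas_pow p)

lemma lint_tsum {α ι : Type*} [MeasurableSpace α] [Countable ι] (μ : Measure α) (F : ι → α → ENNReal)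
    (hF : ∀ i, Measurable (F i)) : ∑' i, ∫⁻ x, F i x ∂μ = ∫⁻ x, ∑' i, F i x ∂μ :=
  (lintegral_tsum (fun i => (hF i).aemeasurable)).symm

lemma lint_tsum_const {α ι : Type*} [MeasurableSpace α] [Countable ι] (μ : Measure α) (F : ι → α → ENNReal)
    (hF : ∀ i, Measurable (F i)) (c : ENNReal) :
    c * ∑' i, ∫⁻ x, F i x ∂μ = ∫⁻ x, c * ∑' i, F i x ∂μ := by
  rw [lint_tsum μ F hF, lintegral_const_mul _ (Measurable.tsum fun i => hF i)]

instance countable_nz (I : FractionalIdeal (𝓞 K)⁰ K) : Countable (nz I) := by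
  have := countable_K K
  unfold nz
  infer_instance

lemma meas_psiM (J : (FractionalIdeal (𝓞 K)⁰ K)ˣ) : Measurable (psiM J) :=
  Measurable.tsum fun _ => meas_fE _

lemma cone_pos : ∀ᵐ x ∂(volume.restrict (fundamentalCone K)), 0 < mixedEmbedding.norm x := by
  rw [ae_restrict_iff' (measurableSet_fundamentalCone K)]
  exact Filter.Eventually.of_forall fun x hx => norm_pos_of_mem hx

lemma psiM_eq (J : (FractionalIdeal (𝓞 K)⁰ K)ˣ) {x : mixedSpace K} (hx : 0 < mixedEmbedding.norm x) :
    psiM J x = ENNReal.ofReal (psiJ J x) := (ofReal_psiJ J hx.ne').symm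

lemma psiM_toReal (J : (FractionalIdeal (𝓞 K)⁰ K)ˣ) {x : mixedSpace K} (hx : 0 < mixedEmbedding.norm x) :
    (psiM J x).toReal = psiJ J x := by
  rw [psiM_eq J hx, ENNReal.toReal_ofReal (psiJ_nonneg J x)]

lemma LI_psi (J : (FractionalIdeal (𝓞 K)⁰ K)ˣ) (q : ℝ) :
    LI (volume.restrict (fundamentalCone K)) (fun x : mixedSpace K => mixedEmbedding.norm x)
      (fun x : mixedSpace K => ENNReal.ofReal (psiM J x).toReal) q =
    Units.torsionOrder K * (SI (J : FractionalIdeal (𝓞 K)⁰ K) (-(1 + q)) *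
      ME (fun x : mixedSpace K => ENNReal.ofReal (fE x)) q) := by
  rw [← unfold_sum _ (h := fun x : mixedSpace K => ENNReal.ofReal (fE x)) (ENNReal.measurable_ofReal.comp fE_cont.measurable), LI]
  rw [lint_tsum (volume.restrict (fundamentalCone K)) (fun (a : nz (J : FractionalIdeal (𝓞 K)⁰ K)) (x : mixedSpace K) =>
    ENNReal.ofReal (fE (mixedEmbedding K a.1 * x)) * ENNReal.ofReal (mixedEmbedding.norm x ^ q))
    (fun a => meas_fE2 (mixedEmbedding K a.1) q)]
  refine lintegral_congr_ae ?_
  filter_upwards [cone_pos] with x hx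
  rw [psiM_toReal J hx, ← psiM_eq J hx, psiM, ENNReal.tsum_mul_right]

lemma LI_R (J : (FractionalIdeal (𝓞 K)⁰ K)ˣ) :
    LI (volume.restrict (fundamentalCone K)) (fun x : mixedSpace K => mixedEmbedding.norm x)
      (fun x : mixedSpace K => ENNReal.ofReal |(psiM J x).toReal + 1 - (aE K / covol J) / mixedEmbedding.norm x|) (-8) ≤
    ENNReal.ofReal (covol J)⁻¹ * (Units.torsionOrder K *
      (SI (FractionalIdeal.dual ℤ ℚ (J : FractionalIdeal (𝓞 K)⁰ K)) (-8) *
      ME (fun x : mixedSpace K => ENNReal.ofReal (gE x)) (-9))) := by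
  have e8 : (-8 : ℝ) = 1 + (-9) := by norm_num
  have hu := unfold_sum_inv (FractionalIdeal.dual ℤ ℚ (J : FractionalIdeal (𝓞 K)⁰ K))
    (h := fun x : mixedSpace K => ENNReal.ofReal (gE x)) (ENNReal.measurable_ofReal.comp gE_cont.measurable) (-9)
  rw [← e8] at hu
  refine le_trans ?_ (mul_le_mul' le_rfl hu.le)
  have hu2 := lint_tsum_const (volume.restrict (fundamentalCone K))
    (fun (a : nz (FractionalIdeal.dual ℤ ℚ (J : FractionalIdeal (𝓞 K)⁰ K))) (x : mixedSpace K) =>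
    ENNReal.ofReal (gE (mixedEmbedding K (a.1)⁻¹ * x)) * ENNReal.ofReal (mixedEmbedding.norm x ^ (-9 : ℝ)))
    (fun a => meas_gE2 (mixedEmbedding K (a.1)⁻¹) (-9)) (ENNReal.ofReal (covol J)⁻¹)
  rw [hu2, LI]
  refine lintegral_mono_ae ?_
  filter_upwards [cone_pos] with x hx
  have h := poisson_bound J hx.ne'
  rw [psiM_toReal J hx, div_div, ENNReal.tsum_mul_right]
  refine le_trans (mul_le_mul' h le_rfl) (le_of_eq ?_)
  have e : mixedEmbedding.norm x ^ (-9 : ℝ) = (mixedEmbedding.norm x)⁻¹ * mixedEmbedding.norm x ^ (-8 : ℝ) := by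
    rw [← Real.rpow_neg_one, ← Real.rpow_add hx]; norm_num
  rw [e, mul_inv, ENNReal.ofReal_mul (inv_nonneg.2 (covol_pos J).le), ENNReal.ofReal_mul (inv_nonneg.2 hx.le)]
  ring

theorem cont_J (J : (FractionalIdeal (𝓞 K)⁰ K)ˣ) (hA : 0 < aE K) {T W D : ℝ} (hT : 0 < T) (hT1 : T ≤ 1)
    (hW0 : 0 ≤ W) (hD0 : 0 ≤ D)
    (hW : SI (J : FractionalIdeal (𝓞 K)⁰ K) (-2) * ME (fun x : mixedSpace K => ENNReal.ofReal (fE x)) 1 ≤ ENNReal.ofReal W)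
    (hD : SI (FractionalIdeal.dual ℤ ℚ (J : FractionalIdeal (𝓞 K)⁰ K)) (-8) *
      ME (fun x : mixedSpace K => ENNReal.ofReal (gE x)) (-9) ≤ ENNReal.ofReal D) :
    ∃ (h : ℂ → ℂ) (v : ℝ), 0 ≤ v ∧ DifferentiableOn ℂ h {s | -7 < s.re ∧ s.re < 2} ∧
      (∀ s : ℂ, -7 ≤ s.re → s.re ≤ 2 → ‖h s‖ ≤ (T ^ (-9 : ℝ) + 1) * W + 4 * ((covol J)⁻¹ * D)) ∧
      ∀ σ : ℝ, 1 < σ → σ ≤ 2 →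
        SI (J : FractionalIdeal (𝓞 K)⁰ K) (-σ) * ME (fun x : mixedSpace K => ENNReal.ofReal (fE x)) (σ - 1) ≠ ⊤ ∧
        (((SI (J : FractionalIdeal (𝓞 K)⁰ K) (-σ) * ME (fun x : mixedSpace K => ENNReal.ofReal (fE x)) (σ - 1)).toReal : ℝ) : ℂ) =
          h σ + ((aE K / covol J * v * (T ^ (σ - 1) / (σ - 1)) : ℝ) : ℂ) - ((v * (T ^ σ / σ) : ℝ) : ℂ) := by
  set w : ℝ := (Units.torsionOrder K : ℝ) with hw
  have hw0 : 0 < w := by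
    have := Units.torsionOrder_pos K
    rw [hw]; exact_mod_cast this
  have hwE : ((Units.torsionOrder K : ℕ) : ENNReal) = ENNReal.ofReal w := by
    rw [hw, ENNReal.ofReal_natCast]
  have hcov := covol_pos J
  obtain ⟨h, hd, hb, hi⟩ := mellin_cont (μ := volume.restrict (fundamentalCone K))
    (Nm := fun x : mixedSpace K => mixedEmbedding.norm x) normE_cont.measurable cone_pos
    (Ψ := fun x => (psiM J x).toReal) (meas_psiM J).ennreal_toReal (fun x => ENNReal.toReal_nonneg)
    (κ := aE K / covol J) (T := T) (v := (volume (normLeOne K)).toReal) (W := w * W)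
    (D := (covol J)⁻¹ * (w * D)) (by positivity) hT hT1
    ENNReal.toReal_nonneg (fun t ht => cone_vol ht) (by positivity) (by positivity)
    (by
      rw [LI_psi, hwE, ENNReal.ofReal_mul hw0.le, show -(1 + (1:ℝ)) = -2 by norm_num]
      gcongr)
    (by
      refine (LI_R J).trans ?_
      rw [hwE, ENNReal.ofReal_mul (by positivity), ENNReal.ofReal_mul hw0.le]
      gcongr)
  refine ⟨fun s => h s / w, (volume (normLeOne K)).toReal / w, by positivity, hd.div_const _, ?_, ?_⟩
  · intro s h1 h2
    rw [norm_div, Complex.norm_real, Real.norm_of_nonneg hw0.le, div_le_iff₀ hw0]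
    refine (hb s h1 h2).trans (le_of_eq ?_)
    ring
  · intro σ h1 h2
    obtain ⟨i1, i2⟩ := hi σ h1 h2
    rw [LI_psi, show -(1 + (σ - 1)) = -σ by ring] at i1 i2
    have hne : SI (J : FractionalIdeal (𝓞 K)⁰ K) (-σ) *
        ME (fun x : mixedSpace K => ENNReal.ofReal (fE x)) (σ - 1) ≠ ⊤ := by
      intro hh
      rw [hh, hwE, ENNReal.mul_top (by simpa using hw0)] at i1
      exact i1 rfl
    refine ⟨hne, ?_⟩
    rw [ENNReal.toReal_mul, hwE, ENNReal.toReal_ofReal hw0.le] at i2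
    have hwC : (w : ℂ) ≠ 0 := by exact_mod_cast hw0.ne'
    have : (((SI (J : FractionalIdeal (𝓞 K)⁰ K) (-σ) * ME (fun x : mixedSpace K => ENNReal.ofReal (fE x)) (σ - 1)).toReal : ℝ) : ℂ)
        = ((w * (SI (J : FractionalIdeal (𝓞 K)⁰ K) (-σ) * ME (fun x : mixedSpace K => ENNReal.ofReal (fE x)) (σ - 1)).toReal : ℝ) : ℂ) / w := by
      push_cast
      field_simp
    rw [this, i2]
    push_cast
    ring

end mixed
end DH

end

section

open MeasureTheory

namespace DH

/-- the polynomial inverse of the local integral -/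
noncomputable def pB (s : ℂ) : ℂ := (∏ j ∈ Finset.range 21, (s + j)) / (Nat.factorial 20 : ℂ)
noncomputable def pR (a : ℝ) : ℝ := (∏ j ∈ Finset.range 21, (a + j)) / (Nat.factorial 20 : ℝ)

lemma pB_ofReal (a : ℝ) : pB a = (pR a : ℂ) := by
  unfold pB pR; push_cast; rfl

lemma pR_pos {a : ℝ} (ha : 0 < a) : 0 < pR a := by
  unfold pR
  refine div_pos (Finset.prod_pos fun j _ => by positivity) (by positivity)

lemma pR_mono {a b : ℝ} (ha : 0 < a) (hab : a ≤ b) : pR a ≤ pR b := by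
  unfold pR
  gcongr

lemma pR_one : pR 1 = 21 := by
  unfold pR
  norm_num [Finset.prod_range_succ, Nat.factorial]

lemma pB_bound (s : ℂ) : ‖pB s‖ ≤ (‖s‖ + 20) ^ 21 := by
  unfold pB
  rw [norm_div, norm_prod]
  have h1 : ∏ j ∈ Finset.range 21, ‖s + j‖ ≤ ∏ j ∈ Finset.range 21, (‖s‖ + 20) := by
    refine Finset.prod_le_prod (fun _ _ => norm_nonneg _) fun j hj => ?_
    refine (norm_add_le _ _).trans ?_
    rw [Complex.norm_natCast]
    have : (j : ℝ) ≤ 20 := by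
      have := Finset.mem_range.1 hj
      exact_mod_cast Nat.lt_succ_iff.1 this
    linarith
  rw [Finset.prod_const, Finset.card_range] at h1
  refine (div_le_self (by positivity) ?_).trans h1
  rw [Complex.norm_natCast]
  exact_mod_cast Nat.one_le_iff_ne_zero.2 (Nat.factorial_ne_zero 20)

lemma pB_diff : Differentiable ℂ pB := by
  unfold pB; fun_prop

lemma beta_real {a : ℝ} (ha : 0 < a) :
    ∫ u in Set.Ioi (0:ℝ), phi u * u ^ (a - 1) = (pR a)⁻¹ := by
  have h1 : ∫ u in Set.Ioi (0:ℝ), phi u * u ^ (a - 1) = ∫ u in (0:ℝ)..1, u ^ (a - 1) * (1 - u) ^ 20 := by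
    rw [intervalIntegral.integral_of_le zero_le_one, ← integral_indicator measurableSet_Ioi,
      ← integral_indicator measurableSet_Ioc]
    congr 1
    ext u
    by_cases h0 : 0 < u
    · by_cases h1 : u ≤ 1
      · rw [Set.indicator_of_mem (Set.mem_Ioi.2 h0), Set.indicator_of_mem (Set.mem_Ioc.2 ⟨h0, h1⟩), phi,
          max_eq_right (by linarith), mul_comm]
      · rw [Set.indicator_of_mem (Set.mem_Ioi.2 h0), Set.indicator_of_notMem (fun h => h1 h.2),
          phi_eq_zero (by linarith), zero_mul]
    · rw [Set.indicator_of_notMem (show u ∉ Set.Ioi (0:ℝ) from fun h => h0 h),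
        Set.indicator_of_notMem (show u ∉ Set.Ioc (0:ℝ) 1 from fun h => h0 h.1)]
  have h2 := Complex.betaIntegral_eval_nat_add_one_right (u := (a : ℂ)) (by simpa using ha) 20
  have h3 : Complex.betaIntegral (a : ℂ) ((20 : ℕ) + 1) = ((∫ u in (0:ℝ)..1, u ^ (a - 1) * (1 - u) ^ 20 : ℝ) : ℂ) := by
    rw [Complex.betaIntegral, ← intervalIntegral.integral_ofReal]
    refine intervalIntegral.integral_congr fun u hu => ?_
    rw [Set.uIcc_of_le zero_le_one] at hu
    rw [Complex.ofReal_mul, Complex.ofReal_cpow hu.1]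
    push_cast
    congr 1
    rw [show (20 + 1 - 1 : ℂ) = ((20 : ℕ) : ℂ) by norm_num, Complex.cpow_natCast]
  rw [h1]
  have h4 : ((∫ u in (0:ℝ)..1, u ^ (a - 1) * (1 - u) ^ 20 : ℝ) : ℂ) = (((pR a)⁻¹ : ℝ) : ℂ) := by
    rw [← h3, h2, Complex.ofReal_inv, ← pB_ofReal, pB, inv_div]
  exact_mod_cast h4

lemma subst_sq {a : ℝ} :
    ∫ y in Set.Ioi (0:ℝ), phi (y ^ 2) * y ^ (2 * a - 1) = (∫ u in Set.Ioi (0:ℝ), phi u * u ^ (a - 1)) / 2 := by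
  have h := integral_comp_rpow_Ioi (fun u : ℝ => phi u * u ^ (a - 1)) (p := 2) (by norm_num)
  rw [← h, ← integral_div]
  refine setIntegral_congr_fun measurableSet_Ioi fun y hy => ?_
  have hy : 0 < y := hy
  simp only [smul_eq_mul, abs_two]
  have e1 : y ^ (2 - 1 : ℝ) = y := by norm_num
  have e2 : (y ^ (2:ℝ)) ^ (a - 1) = y ^ (2 * a - 2) := by
    rw [← Real.rpow_mul hy.le]; congr 1; ring
  have e3 : y ^ (2 * a - 1) = y * y ^ (2 * a - 2) := by
    rw [show 2 * a - 1 = 1 + (2 * a - 2) by ring, Real.rpow_add hy, Real.rpow_one]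
  rw [e1, e2, e3, Real.rpow_two]
  ring

lemma locR {q : ℝ} (hq : -1 < q) : ∫ y : ℝ, phi (‖y‖ ^ 2) * ‖y‖ ^ q = (pR ((q + 1) / 2))⁻¹ := by
  have h := integral_fun_norm_addHaar (volume : Measure ℝ) (fun r : ℝ => phi (r ^ 2) * r ^ q)
  rw [h]
  have : q = 2 * ((q + 1) / 2) - 1 := by ring
  simp only [Module.finrank_self, Measure.real, Real.volume_ball]
  simp only [tsub_self, pow_zero, one_mul, smul_eq_mul]
  rw [← beta_real (by linarith : 0 < (q + 1) / 2)]
  have h2 := subst_sq (a := (q + 1) / 2)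
  rw [← this] at h2
  rw [h2]
  norm_num
  ring

lemma locC {q : ℝ} (hq : -1 < q) : ∫ z : ℂ, phi (‖z‖ ^ 2) * (‖z‖ ^ 2) ^ q = Real.pi * (pR (q + 1))⁻¹ := by
  have h := integral_fun_norm_addHaar (volume : Measure ℂ) (fun r : ℝ => phi (r ^ 2) * (r ^ 2) ^ q)
  rw [h]
  simp only [Complex.finrank_real_complex, Measure.real, Complex.volume_ball]
  rw [← beta_real (by linarith : 0 < q + 1)]
  have h2 := subst_sq (a := q + 1)
  have h3 : ∫ y in Set.Ioi (0:ℝ), y ^ (2 - 1) • (phi (y ^ 2) * (y ^ 2) ^ q) =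
      ∫ y in Set.Ioi (0:ℝ), phi (y ^ 2) * y ^ (2 * (q + 1) - 1) := by
    refine setIntegral_congr_fun measurableSet_Ioi fun y hy => ?_
    have hy : 0 < y := hy
    simp only [smul_eq_mul]
    rw [← Real.rpow_natCast_mul hy.le, show 2 * (q + 1) - 1 = 1 + (2 : ℕ) * q by push_cast; ring,
      Real.rpow_add hy, Real.rpow_one]
    norm_num
    ring
  rw [h3, h2]
  simp
  ring

lemma locR_int {q : ℝ} (hq : 0 ≤ q) : Integrable fun y : ℝ => phi (‖y‖ ^ 2) * ‖y‖ ^ q := by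
  refine Continuous.integrable_of_hasCompactSupport ?_ ?_
  · have := phi_cont
    exact (phi_cont.comp (by fun_prop)).mul (continuous_norm.rpow_const fun y => Or.inr hq)
  · refine HasCompactSupport.of_support_subset_isCompact (isCompact_closedBall (0:ℝ) 1) fun y hy => ?_
    by_contra h
    apply hy
    have : 1 < ‖y‖ := by simpa using h
    simp only []
    rw [phi_eq_zero (by nlinarith), zero_mul]

lemma locC_int {q : ℝ} (hq : 0 ≤ q) : Integrable fun z : ℂ => phi (‖z‖ ^ 2) * (‖z‖ ^ 2) ^ q := by
  refine Continuous.integrable_of_hasCompactSupport ?_ ?_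
  · exact (phi_cont.comp (by fun_prop)).mul ((continuous_norm.pow 2).rpow_const fun y => Or.inr hq)
  · refine HasCompactSupport.of_support_subset_isCompact (isCompact_closedBall (0:ℂ) 1) fun y hy => ?_
    by_contra h
    apply hy
    have : 1 < ‖y‖ := by simpa using h
    simp only []
    rw [phi_eq_zero (by nlinarith), zero_mul]

lemma psi_dec {r : ℝ} (hr : 0 < r) {k : ℕ} (hk : k ≤ 18) : psi r * (r ^ k)⁻¹ ≤ cpsi * 2 ^ k * ((1 + r) ^ k)⁻¹ := by
  have hc : 0 ≤ cpsi := zero_le_one.trans cpsi_one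
  rw [psi, mul_assoc, mul_assoc]
  refine mul_le_mul_of_nonneg_left ?_ hc
  rw [← div_eq_mul_inv, ← div_eq_mul_inv, div_le_div_iff₀ (by positivity) (by positivity)]
  rcases le_total r 1 with h | h
  · have h1 : r ^ 18 ≤ r ^ k := pow_le_pow_of_le_one hr.le h hk
    have h2 : min 1 (r ^ 18) ≤ r ^ k := (min_le_right _ _).trans h1
    have h3 : (1 + r) ^ k ≤ 2 ^ k := by gcongr; linarith
    have h4 : 0 ≤ min 1 (r ^ 18) := le_min zero_le_one (by positivity)
    nlinarith [mul_le_mul h2 h3 (by positivity) (by positivity)]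
  · have h3 : (1 + r) ^ k ≤ 2 ^ k * r ^ k := by rw [← mul_pow]; gcongr; linarith
    have h4 : min 1 (r ^ 18) ≤ 1 := min_le_left _ _
    have : 0 ≤ (1 + r) ^ k := by positivity
    nlinarith

lemma psiR_int : Integrable fun y : ℝ => psi ‖y‖ * ‖y‖ ^ (-9 : ℝ) := by
  have hi := (integrable_one_add_norm (E := ℝ) (μ := volume) (r := 9) (by simp)).const_mul (cpsi * 2 ^ 9)
  refine hi.mono' ?_ (Filter.Eventually.of_forall fun y => ?_)
  · have := psi_cont.measurable
    exact Measurable.aestronglyMeasurable (by fun_prop)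
  · rw [Real.norm_of_nonneg (mul_nonneg (psi_nonneg _) (by positivity))]
    rcases eq_or_lt_of_le (norm_nonneg y) with h | h
    · rw [← h, Real.zero_rpow (by norm_num), mul_zero]
      have := cpsi_one
      positivity
    · have := psi_dec h (k := 9) (by norm_num)
      rw [Real.rpow_neg h.le, Real.rpow_neg (by positivity)]
      exact_mod_cast this

lemma psiC_int : Integrable fun z : ℂ => psi ‖z‖ * (‖z‖ ^ 2) ^ (-9 : ℝ) := by
  have hi := (integrable_one_add_norm (E := ℂ) (μ := volume) (r := 18) (by simp; norm_num)).const_mul (cpsi * 2 ^ 18)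
  refine hi.mono' ?_ (Filter.Eventually.of_forall fun y => ?_)
  · have := psi_cont.measurable
    exact Measurable.aestronglyMeasurable (by fun_prop)
  · rw [Real.norm_of_nonneg (mul_nonneg (psi_nonneg _) (by positivity))]
    rcases eq_or_lt_of_le (norm_nonneg y) with h | h
    · rw [← h, zero_pow (by norm_num), Real.zero_rpow (by norm_num), mul_zero]
      have := cpsi_one
      positivity
    · have := psi_dec h (k := 18) (by norm_num)
      rw [Real.rpow_neg (by positivity), Real.rpow_neg (by positivity)]
      have e : (‖y‖ ^ 2) ^ (9 : ℝ) = ‖y‖ ^ 18 := by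
        rw [show (9:ℝ) = ((9:ℕ) : ℝ) by norm_num, Real.rpow_natCast]; ring
      rw [e]
      exact_mod_cast this

end DH

end

section

open NumberField NumberField.InfinitePlace NumberField.mixedEmbedding MeasureTheory
open NumberField.mixedEmbedding.fundamentalCone

namespace DH
open scoped Classical nonZeroDivisors
section mixed
variable {K : Type*} [Field K] [NumberField K]

lemma ME_prod {F : ℝ → ℝ} (hF0 : ∀ r, 0 ≤ F r) {q : ℝ} (h1 : Integrable fun y : ℝ => F ‖y‖ * ‖y‖ ^ q)
    (h2 : Integrable fun z : ℂ => F ‖z‖ * (‖z‖ ^ 2) ^ q) :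
    ME (fun x : mixedSpace K => ENNReal.ofReal ((∏ w, F ‖x.1 w‖) * ∏ w, F ‖x.2 w‖)) q =
      ENNReal.ofReal ((∫ y : ℝ, F ‖y‖ * ‖y‖ ^ q) ^ nrRealPlaces K *
        (∫ z : ℂ, F ‖z‖ * (‖z‖ ^ 2) ^ q) ^ nrComplexPlaces K) := by
  have h := lintegral_prodE (K := K) (F := fun _ y => F ‖y‖ * ‖y‖ ^ q) (G := fun _ z => F ‖z‖ * (‖z‖ ^ 2) ^ q)
    (fun _ => h1) (fun _ => h2) (fun _ y => mul_nonneg (hF0 _) (by positivity))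
    (fun _ y => mul_nonneg (hF0 _) (by positivity))
  rw [Finset.prod_const, Finset.prod_const] at h
  have e1 : (Finset.univ : Finset {w : InfinitePlace K // IsReal w}).card = nrRealPlaces K := by
    rw [Finset.card_univ]
  have e2 : (Finset.univ : Finset {w : InfinitePlace K // IsComplex w}).card = nrComplexPlaces K := by
    rw [Finset.card_univ]
  rw [e1, e2] at h
  rw [← h, ME]
  refine lintegral_congr fun x : mixedSpace K => ?_
  rw [← ENNReal.ofReal_mul (mul_nonneg (Finset.prod_nonneg fun _ _ => hF0 _) (Finset.prod_nonneg fun _ _ => hF0 _)),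
    norm_split, Finset.prod_mul_distrib, Finset.prod_mul_distrib,
    Real.mul_rpow (Finset.prod_nonneg fun _ _ => norm_nonneg _) (Finset.prod_nonneg fun _ _ => by positivity),
    ← Real.finsetProd_rpow _ _ (fun _ _ => norm_nonneg _), ← Real.finsetProd_rpow _ _ (fun _ _ => by positivity)]
  congr 1
  ring

/-- the local factor at infinity -/
noncomputable def zR (K : Type*) [Field K] [NumberField K] (σ : ℝ) : ℝ :=
  ((pR (σ / 2))⁻¹) ^ nrRealPlaces K * (Real.pi * (pR σ)⁻¹) ^ nrComplexPlaces K

lemma zR_pos {σ : ℝ} (hσ : 0 < σ) : 0 < zR K σ := by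
  have := pR_pos hσ
  have := pR_pos (half_pos hσ)
  unfold zR
  positivity

lemma ME_fE {σ : ℝ} (hσ : 1 ≤ σ) :
    ME (fun x : mixedSpace K => ENNReal.ofReal (fE x)) (σ - 1) = ENNReal.ofReal (zR K σ) := by
  have h := ME_prod (K := K) (F := fun r => phi (r ^ 2)) (fun _ => phi_nonneg _) (q := σ - 1)
    (locR_int (by linarith)) (locC_int (by linarith))
  rw [locR (by linarith), locC (by linarith)] at h
  rw [zR]
  rw [sub_add_cancel] at h
  exact h

lemma aE_eq : aE K = zR K 1 := by
  have h := integral_prodE (K := K) (fun _ y => phi (‖y‖ ^ 2)) (fun _ z => phi (‖z‖ ^ 2))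
  rw [Finset.prod_const, Finset.prod_const, Finset.card_univ, Finset.card_univ] at h
  have l1 := locR (q := 0) (by norm_num)
  have l2 := locC (q := 0) (by norm_num)
  simp only [Real.rpow_zero, mul_one] at l1 l2
  rw [l1, l2] at h
  rw [zR]
  rw [zero_add] at h
  exact h

/-- inverse of the factor at infinity -/
noncomputable def Qf (K : Type*) [Field K] [NumberField K] (s : ℂ) : ℂ :=
  (pB (s / 2)) ^ nrRealPlaces K * (pB s / Real.pi) ^ nrComplexPlaces K

lemma Qf_diff : Differentiable ℂ (Qf K) := by
  have := pB_diff
  unfold Qf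
  have h : Differentiable ℂ fun s : ℂ => pB (s / 2) := pB_diff.comp (by fun_prop)
  exact (h.pow _).mul ((pB_diff.div_const _).pow _)

lemma Qf_real {σ : ℝ} (hσ : 0 < σ) : Qf K σ * (zR K σ : ℂ) = 1 := by
  have h1 := (pR_pos hσ).ne'
  have h2 := (pR_pos (half_pos hσ)).ne'
  have h3 := Real.pi_ne_zero
  rw [Qf, zR, show ((σ : ℂ) / 2) = ((σ / 2 : ℝ) : ℂ) by push_cast; ring, pB_ofReal, pB_ofReal]
  norm_cast
  rw [show ∀ a b c d : ℝ, a * b * (c * d) = (a * c) * (b * d) by intros; ring, ← mul_pow, ← mul_pow,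
    mul_inv_cancel₀ h2, show pR σ / Real.pi * (Real.pi * (pR σ)⁻¹) = 1 by field_simp]
  simp

lemma rank_eq : nrRealPlaces K + 2 * nrComplexPlaces K = Module.finrank ℚ K :=
  card_add_two_mul_card_eq_rank K

lemma Qf_bound (s : ℂ) : ‖Qf K s‖ ≤ ((‖s‖ + 20) ^ 21) ^ (Module.finrank ℚ K) := by
  have h1 : 1 ≤ (‖s‖ + 20) ^ 21 := one_le_pow₀ (by linarith [norm_nonneg s])
  have h2 : ‖pB (s / 2)‖ ≤ (‖s‖ + 20) ^ 21 := by
    refine (pB_bound _).trans ?_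
    gcongr
    rw [norm_div]
    simp
  have h3 : ‖pB s / Real.pi‖ ≤ (‖s‖ + 20) ^ 21 := by
    rw [norm_div]
    refine (div_le_self (norm_nonneg _) ?_).trans (pB_bound _)
    rw [Complex.norm_real, Real.norm_of_nonneg Real.pi_pos.le]
    linarith [Real.pi_gt_three]
  rw [Qf, norm_mul, norm_pow, norm_pow]
  calc _ ≤ ((‖s‖ + 20) ^ 21) ^ nrRealPlaces K * ((‖s‖ + 20) ^ 21) ^ nrComplexPlaces K := by gcongr
    _ = ((‖s‖ + 20) ^ 21) ^ (nrRealPlaces K + nrComplexPlaces K) := (pow_add _ _ _).symm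
    _ ≤ _ := pow_le_pow_right₀ h1 (by rw [← rank_eq (K := K)]; omega)

lemma zR_two : zR K 2 ≤ 1 := by
  have h1 : 462 = pR 2 := by
    unfold pR
    norm_num [Finset.prod_range_succ, Nat.factorial]
  rw [zR, ← h1, show (2:ℝ) / 2 = 1 by norm_num, pR_one]
  have h2 : ((21:ℝ)⁻¹) ^ nrRealPlaces K ≤ 1 := pow_le_one₀ (by norm_num) (by norm_num)
  have h3 : (Real.pi * (462:ℝ)⁻¹) ^ nrComplexPlaces K ≤ 1 := by
    refine pow_le_one₀ (by positivity) ?_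
    have := Real.pi_lt_four
    rw [← div_eq_mul_inv, div_le_one (by norm_num)]
    linarith
  exact mul_le_one₀ h2 (by positivity) h3

lemma aE_pos : 0 < aE K := by rw [aE_eq]; exact zR_pos one_pos

lemma aE_lower : ((21:ℝ) ^ Module.finrank ℚ K)⁻¹ ≤ aE K := by
  rw [aE_eq, zR, pR_one]
  have h1 : (21:ℝ)⁻¹ ≤ (pR (1/2))⁻¹ := by
    rw [← pR_one]
    exact inv_anti₀ (pR_pos (by norm_num)) (pR_mono (by norm_num) (by norm_num))
  have h2 : (21:ℝ)⁻¹ ≤ Real.pi * 21⁻¹ := by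
    have := Real.pi_gt_three
    linarith
  calc ((21:ℝ) ^ Module.finrank ℚ K)⁻¹ = (21⁻¹ : ℝ) ^ Module.finrank ℚ K := (inv_pow _ _).symm
    _ ≤ (21⁻¹ : ℝ) ^ (nrRealPlaces K + nrComplexPlaces K) :=
      pow_le_pow_of_le_one (by norm_num) (by norm_num) (by rw [← rank_eq (K := K)]; omega)
    _ = (21⁻¹ : ℝ) ^ nrRealPlaces K * (21⁻¹ : ℝ) ^ nrComplexPlaces K := pow_add _ _ _
    _ ≤ _ := by gcongr

/-- absolute constant bounding the local integrals of psi -/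
noncomputable def cG : ℝ := max 1 (max (∫ y : ℝ, psi ‖y‖ * ‖y‖ ^ (-9 : ℝ)) (∫ z : ℂ, psi ‖z‖ * (‖z‖ ^ 2) ^ (-9 : ℝ)))
lemma cG_one : 1 ≤ cG := le_max_left _ _

lemma ME_gE : ME (fun x : mixedSpace K => ENNReal.ofReal (gE x)) (-9) ≤ ENNReal.ofReal (cG ^ Module.finrank ℚ K) := by
  have h := ME_prod (K := K) (F := psi) psi_nonneg psiR_int psiC_int
  have h0 : ∫ y : ℝ, psi ‖y‖ * ‖y‖ ^ (-9 : ℝ) ≤ cG := (le_max_left _ _).trans (le_max_right _ _)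
  have h1 : ∫ z : ℂ, psi ‖z‖ * (‖z‖ ^ 2) ^ (-9 : ℝ) ≤ cG := (le_max_right _ _).trans (le_max_right _ _)
  refine (le_of_eq h).trans (ENNReal.ofReal_le_ofReal ?_)
  have p0 : 0 ≤ ∫ y : ℝ, psi ‖y‖ * ‖y‖ ^ (-9 : ℝ) :=
    integral_nonneg fun y => mul_nonneg (psi_nonneg _) (by positivity)
  have p1 : 0 ≤ ∫ z : ℂ, psi ‖z‖ * (‖z‖ ^ 2) ^ (-9 : ℝ) :=
    integral_nonneg fun y => mul_nonneg (psi_nonneg _) (by positivity)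
  have hc : 0 ≤ cG := zero_le_one.trans cG_one
  calc _ ≤ cG ^ nrRealPlaces K * cG ^ nrComplexPlaces K :=
        mul_le_mul (pow_le_pow_left₀ p0 h0 _) (pow_le_pow_left₀ p1 h1 _) (by positivity) (by positivity)
    _ = cG ^ (nrRealPlaces K + nrComplexPlaces K) := (pow_add _ _ _).symm
    _ ≤ _ := pow_le_pow_right₀ cG_one (by rw [← rank_eq (K := K)]; omega)

lemma covol_eq (J : (FractionalIdeal (𝓞 K)⁰ K)ˣ) :
    covol J = (FractionalIdeal.absNorm (J : FractionalIdeal (𝓞 K)⁰ K)) *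
        (2⁻¹) ^ nrComplexPlaces K * √|(discr K : ℝ)| := by
  rw [covol, volume_fundamentalDomain_fractionalIdealLatticeBasis, volume_fundamentalDomain_latticeBasis,
    ENNReal.toReal_mul, ENNReal.toReal_mul, ENNReal.toReal_pow, ENNReal.toReal_inv, ENNReal.toReal_ofNat,
    ENNReal.coe_toReal, Real.coe_sqrt, coe_nnnorm, Int.norm_eq_abs,
    ENNReal.toReal_ofReal (Rat.cast_nonneg.mpr (FractionalIdeal.absNorm_nonneg J.val)), mul_assoc]

lemma absNorm_dual {J : FractionalIdeal (𝓞 K)⁰ K} (hJ : J ≠ 0) :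
    (FractionalIdeal.absNorm (FractionalIdeal.dual ℤ ℚ J) : ℝ) =
      ((FractionalIdeal.absNorm J : ℝ) * |(discr K : ℝ)|)⁻¹ := by
  have h : FractionalIdeal.dual ℤ ℚ J = (J * ((differentIdeal ℤ (𝓞 K) : Ideal (𝓞 K)) : FractionalIdeal (𝓞 K)⁰ K))⁻¹ := by
    rw [FractionalIdeal.dual_eq_mul_inv, coeIdeal_differentIdeal ℤ ℚ K (𝓞 K), mul_inv, inv_inv, mul_comm]
  rw [h, map_inv₀, map_mul, FractionalIdeal.coeIdeal_absNorm (K := K), NumberField.absNorm_differentIdeal (K := K)]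
  push_cast
  congr 2
  rw [Nat.cast_natAbs, Int.cast_abs]

end mixed
end DH

end

section

open NumberField NumberField.InfinitePlace NumberField.mixedEmbedding MeasureTheory
open NumberField.mixedEmbedding.fundamentalCone

namespace DH
open scoped Classical nonZeroDivisors
section mixed
variable {K : Type*} [Field K] [NumberField K]

/-- an absolute constant -/
noncomputable def cM : ℝ := 21 + cG + Real.exp (2 * ∑' m : ℕ, (m : ℝ) ^ (-(3 / 2 : ℝ)))

lemma cM_ge : 21 ≤ cM := by
  have := cG_one
  have := Real.exp_pos (2 * ∑' m : ℕ, (m : ℝ) ^ (-(3 / 2 : ℝ)))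
  unfold cM; linarith

lemma cM_cG : cG ≤ cM := by
  have := Real.exp_pos (2 * ∑' m : ℕ, (m : ℝ) ^ (-(3 / 2 : ℝ)))
  unfold cM; linarith

lemma cM_exp : Real.exp (2 * ∑' m : ℕ, (m : ℝ) ^ (-(3 / 2 : ℝ))) ≤ cM := by
  have := cG_one
  unfold cM; linarith

/-- the basic size parameter of the field -/
noncomputable def bX (K : Type*) [Field K] [NumberField K] : ℝ := cM ^ Module.finrank ℚ K * |(discr K : ℝ)|

lemma discr_one : 1 ≤ |(discr K : ℝ)| := by
  have := Int.one_le_abs (discr_ne_zero K)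
  exact_mod_cast this

lemma cMn_le : cM ^ Module.finrank ℚ K ≤ bX K := by
  have := cM_ge
  exact le_mul_of_one_le_right (by positivity) discr_one

lemma discr_le : |(discr K : ℝ)| ≤ bX K := by
  have := cM_ge
  exact le_mul_of_one_le_left (abs_nonneg _) (one_le_pow₀ (by linarith))

lemma bX_ge : 21 ≤ bX K := by
  refine le_trans ?_ cMn_le
  have h := cM_ge
  calc (21:ℝ) ≤ cM ^ 1 := by simpa using h
    _ ≤ _ := pow_le_pow_right₀ (by linarith) Module.finrank_pos

lemma cG_le : cG ^ Module.finrank ℚ K ≤ bX K :=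
  (pow_le_pow_left₀ (zero_le_one.trans cG_one) cM_cG _).trans cMn_le

lemma tsum_le_bX {σ : ℝ} (hσ : 3 / 2 ≤ σ) :
    ∑' I : {I : Ideal (𝓞 K) // I ≠ ⊥}, (Ideal.absNorm I.1 : ℝ) ^ (-σ) ≤ cM ^ Module.finrank ℚ K := by
  have h1 : ∑' I : {I : Ideal (𝓞 K) // I ≠ ⊥}, (Ideal.absNorm I.1 : ℝ) ^ (-σ) ≤
      ∑' I : {I : Ideal (𝓞 K) // I ≠ ⊥}, (Ideal.absNorm I.1 : ℝ) ^ (-(3 / 2 : ℝ)) := by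
    refine Summable.tsum_le_tsum (fun I => ?_) (summable_ideals (by linarith)) (summable_ideals (by norm_num))
    have : (1:ℝ) ≤ Ideal.absNorm I.1 := by exact_mod_cast absNorm_pos' I.2
    exact Real.rpow_le_rpow_of_exponent_le this (by linarith)
  refine h1.trans ((tsum_ideals_le (by norm_num)).trans ?_)
  rw [show ∀ a b : ℝ, 2 * (a * b) = a * (2 * b) by intros; ring, Real.exp_nat_mul]
  exact pow_le_pow_left₀ (Real.exp_pos _).le cM_exp _

lemma zL_eq {σ : ℝ} (hσ : 1 < σ) :
    zL K σ = ENNReal.ofReal (∑' I : {I : Ideal (𝓞 K) // I ≠ ⊥}, (Ideal.absNorm I.1 : ℝ) ^ (-σ)) := by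
  rw [zL, ENNReal.ofReal_tsum_of_nonneg (fun _ => by positivity) (summable_ideals hσ)]

lemma zL_le {σ : ℝ} (hσ : 3 / 2 ≤ σ) : zL K σ ≤ ENNReal.ofReal (bX K) := by
  rw [zL_eq (by linarith)]
  exact ENNReal.ofReal_le_ofReal ((tsum_le_bX hσ).trans cMn_le)

lemma repI_one (c : ClassGroup (𝓞 K)) : (1:ℝ) ≤ Ideal.absNorm (repI c).1 := by
  exact_mod_cast absNorm_pos' (repI_ne c)

lemma repI_le (c : ClassGroup (𝓞 K)) : (Ideal.absNorm (repI c).1 : ℝ) ≤ bX K := by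
  refine (repI_norm c).trans ?_
  have hp := Real.pi_gt_three
  have h1 : (4 / Real.pi) ^ nrComplexPlaces K ≤ cM ^ Module.finrank ℚ K := by
    have h := cM_ge
    calc (4 / Real.pi) ^ nrComplexPlaces K ≤ cM ^ nrComplexPlaces K := by
          refine pow_le_pow_left₀ (by positivity) ?_ _
          rw [div_le_iff₀ Real.pi_pos]
          nlinarith
      _ ≤ _ := pow_le_pow_right₀ (by linarith) (by rw [← rank_eq (K := K)]; omega)
  have h2 : ((Module.finrank ℚ K).factorial : ℝ) / (Module.finrank ℚ K : ℝ) ^ (Module.finrank ℚ K) ≤ 1 := by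
    refine div_le_one_of_le₀ ?_ (by positivity)
    exact_mod_cast Nat.factorial_le_pow _
  have h3 : Real.sqrt |(discr K : ℝ)| ≤ |(discr K : ℝ)| := by
    rw [Real.sqrt_le_left (abs_nonneg _)]
    have := discr_one (K := K)
    nlinarith
  have hs := Real.sqrt_nonneg |(discr K : ℝ)|
  rw [bX]
  refine mul_le_mul h1 ?_ (by positivity) (by have := cM_ge; positivity)
  refine le_trans ?_ h3
  have := mul_le_of_le_one_left hs h2
  simpa using this

lemma card_le : (Fintype.card (ClassGroup (𝓞 K)) : ℝ) ≤ bX K ^ 3 := by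
  have hX := bX_ge (K := K)
  have hinj : Function.Injective fun c : ClassGroup (𝓞 K) => (⟨(repI c).1, repI_ne c⟩ : {I : Ideal (𝓞 K) // I ≠ ⊥}) := by
    intro c c' h
    have h1 : (repI c).1 = (repI c').1 := by simpa using h
    rw [← repI_spec c, ← repI_spec c', Subtype.ext h1]
  have h1 : ∑ c : ClassGroup (𝓞 K), (Ideal.absNorm (repI c).1 : ℝ) ^ (-(2:ℝ)) ≤ bX K := by
    have hs := summable_ideals (L := K) (σ := 2) (by norm_num)
    have := Summable.tsum_le_tsum_of_inj _ hinj (f := fun c : ClassGroup (𝓞 K) => (Ideal.absNorm (repI c).1 : ℝ) ^ (-(2:ℝ)))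
      (fun I _ => by positivity) (fun c => le_rfl) (Summable.of_finite) hs
    rw [tsum_fintype] at this
    exact this.trans ((tsum_le_bX (by norm_num)).trans cMn_le)
  have h2 : ∑ c : ClassGroup (𝓞 K), (bX K ^ 2)⁻¹ ≤ ∑ c : ClassGroup (𝓞 K), (Ideal.absNorm (repI c).1 : ℝ) ^ (-(2:ℝ)) := by
    refine Finset.sum_le_sum fun c _ => ?_
    rw [Real.rpow_neg (by positivity), Real.rpow_two]
    have := repI_one c
    have := repI_le c
    gcongr
  rw [Finset.sum_const, Finset.card_univ, nsmul_eq_mul] at h2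
  have h3 := h2.trans h1
  rw [← div_eq_mul_inv, div_le_iff₀ (by positivity)] at h3
  calc _ ≤ _ := h3
    _ = _ := by ring

end mixed
end DH

end

section

open NumberField NumberField.InfinitePlace NumberField.mixedEmbedding MeasureTheory
open NumberField.mixedEmbedding.fundamentalCone

namespace DH
open scoped Classical nonZeroDivisors
section mixed
variable {K : Type*} [Field K] [NumberField K]

lemma covol_le (c : ClassGroup (𝓞 K)) : covol (repJ c) ≤ bX K ^ 2 := by
  have hX := bX_ge (K := K)
  have h3 : Real.sqrt |(discr K : ℝ)| ≤ |(discr K : ℝ)| := by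
    rw [Real.sqrt_le_left (abs_nonneg _)]
    have := discr_one (K := K)
    nlinarith
  have h4 : ((2:ℝ)⁻¹) ^ nrComplexPlaces K ≤ 1 := pow_le_one₀ (by norm_num) (by norm_num)
  rw [covol_eq, repJ_norm, sq]
  refine mul_le_mul ?_ (h3.trans discr_le) (Real.sqrt_nonneg _) (by positivity)
  exact (mul_le_of_le_one_right (by positivity) h4).trans (repI_le c)

lemma covol_inv (c : ClassGroup (𝓞 K)) : (covol (repJ c))⁻¹ ≤ bX K := by
  have hX := bX_ge (K := K)
  have hM := cM_ge
  have h3 : 1 ≤ Real.sqrt |(discr K : ℝ)| := Real.one_le_sqrt.2 discr_one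
  have h4 : ((2:ℝ) ^ nrComplexPlaces K) ≤ bX K := by
    refine le_trans ?_ cMn_le
    calc ((2:ℝ) ^ nrComplexPlaces K) ≤ cM ^ nrComplexPlaces K := pow_le_pow_left₀ (by norm_num) (by linarith) _
      _ ≤ _ := pow_le_pow_right₀ (by linarith) (by rw [← rank_eq (K := K)]; omega)
  refine inv_le_of_inv_le₀ (by linarith) ?_
  rw [covol_eq, repJ_norm]
  have h5 : (bX K)⁻¹ ≤ ((2:ℝ)⁻¹) ^ nrComplexPlaces K := by
    rw [inv_pow]; exact inv_anti₀ (by positivity) h4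
  have h6 := repI_one c
  have h7 : 0 < ((2:ℝ)⁻¹) ^ nrComplexPlaces K := by positivity
  calc _ ≤ _ := h5
    _ ≤ (Ideal.absNorm (repI c).1 : ℝ) * ((2:ℝ)⁻¹) ^ nrComplexPlaces K := le_mul_of_one_le_left h7.le h6
    _ ≤ _ := le_mul_of_one_le_right (by positivity) h3

lemma kappa_ge (c : ClassGroup (𝓞 K)) : (bX K ^ 3)⁻¹ ≤ aE K / covol (repJ c) := by
  have hX := bX_ge (K := K)
  have hc := covol_pos (repJ c)
  rw [le_div_iff₀ hc]
  have h1 : (bX K)⁻¹ ≤ aE K := by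
    refine le_trans ?_ aE_lower
    refine inv_anti₀ (by positivity) ((pow_le_pow_left₀ (by norm_num) cM_ge _).trans cMn_le)
  refine le_trans ?_ h1
  calc (bX K ^ 3)⁻¹ * covol (repJ c) ≤ (bX K ^ 3)⁻¹ * bX K ^ 2 := by
        gcongr; exact covol_le c
    _ = _ := by field_simp

lemma hW_c (c : ClassGroup (𝓞 K)) : SI (repJ c : FractionalIdeal (𝓞 K)⁰ K) (-2) *
    ME (fun x : mixedSpace K => ENNReal.ofReal (fE x)) 1 ≤ ENNReal.ofReal (bX K) := by
  have hX := bX_ge (K := K)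
  have h1 := SI_le (repJ c).ne_zero 2
  have h2 : ME (fun x : mixedSpace K => ENNReal.ofReal (fE x)) 1 = ENNReal.ofReal (zR K 2) := by
    rw [← ME_fE (by norm_num)]; norm_num
  have h3 : ENNReal.ofReal (zR K 2) ≤ 1 := ENNReal.ofReal_le_one.2 zR_two
  have h4 : ENNReal.ofReal ((FractionalIdeal.absNorm (repJ c : FractionalIdeal (𝓞 K)⁰ K) : ℝ) ^ (-(2:ℝ))) ≤ 1 := by
    refine ENNReal.ofReal_le_one.2 ?_
    rw [repJ_norm]
    exact Real.rpow_le_one_of_one_le_of_nonpos (repI_one c) (by norm_num)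
  rw [h2]
  calc _ ≤ (1 * ENNReal.ofReal (bX K)) * 1 :=
        mul_le_mul' (h1.trans (mul_le_mul' h4 (zL_le (by norm_num)))) h3
    _ = _ := by simp

lemma hD_c (c : ClassGroup (𝓞 K)) : SI (FractionalIdeal.dual ℤ ℚ (repJ c : FractionalIdeal (𝓞 K)⁰ K)) (-8) *
      ME (fun x : mixedSpace K => ENNReal.ofReal (gE x)) (-9) ≤ ENNReal.ofReal (bX K ^ 18) := by
  have hX := bX_ge (K := K)
  have h0 : FractionalIdeal.dual ℤ ℚ (repJ c : FractionalIdeal (𝓞 K)⁰ K) ≠ 0 := by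
    rw [FractionalIdeal.dual_ne_zero_iff]; exact (repJ c).ne_zero
  have h1 := SI_le h0 8
  have h4 : ENNReal.ofReal ((FractionalIdeal.absNorm (FractionalIdeal.dual ℤ ℚ (repJ c : FractionalIdeal (𝓞 K)⁰ K)) : ℝ) ^ (-(8:ℝ))) ≤
      ENNReal.ofReal (bX K ^ 16) := by
    refine ENNReal.ofReal_le_ofReal ?_
    rw [absNorm_dual (repJ c).ne_zero, repJ_norm, Real.inv_rpow (by positivity), Real.rpow_neg (by positivity), inv_inv]
    have := repI_le c
    have := repI_one c
    have := discr_le (K := K)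
    calc _ ≤ (bX K * bX K) ^ (8:ℝ) := by gcongr
      _ = (bX K * bX K) ^ 8 := by exact_mod_cast Real.rpow_natCast (bX K * bX K) 8
      _ = _ := by ring
  have h5 : ME (fun x : mixedSpace K => ENNReal.ofReal (gE x)) (-9) ≤ ENNReal.ofReal (bX K) :=
    ME_gE.trans (ENNReal.ofReal_le_ofReal cG_le)
  calc _ ≤ (ENNReal.ofReal (bX K ^ 16) * ENNReal.ofReal (bX K)) * ENNReal.ofReal (bX K) :=
        mul_le_mul' (h1.trans (mul_le_mul' h4 (zL_le (by norm_num)))) h5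
    _ = _ := by
      rw [← ENNReal.ofReal_mul (by positivity), ← ENNReal.ofReal_mul (by positivity)]
      congr 1

/-- pure inequality for the constants -/
lemma num_v {X κ v T Z H : ℝ} (hX : 21 ≤ X) (hT : T = (X ^ 3)⁻¹) (hκ : T ≤ κ) (hv : 0 ≤ v) (hZ : Z ≤ X) (hH : H ≤ X ^ 29)
    (h : κ * v * T - v * (T ^ 2 / 2) ≤ Z + H) : κ * v ≤ X ^ 33 ∧ v ≤ X ^ 36 := by
  have hT0 : 0 < T := by rw [hT]; positivity
  have h1 : v * T ^ 2 ≤ κ * v * T := by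
    have := mul_le_mul_of_nonneg_right hκ (mul_nonneg hv hT0.le)
    nlinarith
  have h2 : κ * v * T ≤ 2 * (X + X ^ 29) := by nlinarith
  have h3 : 2 * (X + X ^ 29) ≤ X ^ 30 := by
    have : X ≤ X ^ 29 := le_self_pow₀ (by linarith) (by norm_num)
    have h0 : 0 ≤ X ^ 29 := by positivity
    calc 2 * (X + X ^ 29) ≤ 21 * X ^ 29 := by linarith
      _ ≤ X * X ^ 29 := by gcongr
      _ = X ^ 30 := by ring
  have h4 : κ * v ≤ X ^ 33 := by
    have : κ * v = (κ * v * T) * X ^ 3 := by rw [hT]; field_simp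
    rw [this]
    calc _ ≤ X ^ 30 * X ^ 3 := by gcongr; exact h2.trans h3
      _ = X ^ 33 := by ring
  refine ⟨h4, ?_⟩
  have h5 : v = T * v * X ^ 3 := by rw [hT]; field_simp
  rw [h5]
  calc _ ≤ X ^ 33 * X ^ 3 := by
        gcongr
        exact (mul_le_mul_of_nonneg_right hκ hv).trans h4
    _ = X ^ 36 := by ring

lemma num_h {X T W D e : ℝ} (hX : 21 ≤ X) (hT : T = (X ^ 3)⁻¹) (hW : W = X) (hD : D = X ^ 18) (he : e ≤ X) :
    (T ^ (-9 : ℝ) + 1) * W + 4 * (e * D) ≤ X ^ 29 := by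
  have h1 : T ^ (-9 : ℝ) = X ^ 27 := by
    rw [hT, Real.inv_rpow (by positivity), Real.rpow_neg (by positivity), inv_inv]
    have := Real.rpow_natCast (X ^ 3) 9
    push_cast at this
    rw [this]; ring
  rw [h1, hW, hD]
  have h2 : e * X ^ 18 ≤ X ^ 19 := by
    calc _ ≤ X * X ^ 18 := by gcongr
      _ = _ := by ring
  have h3 : X ≤ X ^ 28 := le_self_pow₀ (by linarith) (by norm_num)
  have h4 : X ^ 19 ≤ X ^ 28 := pow_le_pow_right₀ (by linarith) (by norm_num)
  calc (X ^ 27 + 1) * X + 4 * (e * X ^ 18) = X ^ 28 + X + 4 * (e * X ^ 18) := by ring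
    _ ≤ 21 * X ^ 28 := by linarith
    _ ≤ X * X ^ 28 := by gcongr
    _ = _ := by ring

lemma norm_T_pow {T : ℝ} (hT : 0 < T) (hT1 : T ≤ 1) {s : ℂ} {k : ℕ} (hs : -(k:ℝ) ≤ s.re) :
    ‖(T : ℂ) ^ s‖ ≤ (T⁻¹) ^ k := by
  rw [Complex.norm_cpow_eq_rpow_re_of_pos hT]
  calc T ^ s.re ≤ T ^ (-(k:ℝ)) := Real.rpow_le_rpow_of_exponent_ge hT hT1 hs
    _ = _ := by rw [Real.rpow_neg hT.le, Real.rpow_natCast, inv_pow]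

theorem cont_class (c : ClassGroup (𝓞 K)) :
    ∃ G : ℂ → ℂ, DifferentiableOn ℂ G {s | -7 < s.re ∧ s.re < 2} ∧
      (∀ s : ℂ, -7 ≤ s.re → s.re ≤ 2 → ‖G s‖ ≤ bX K ^ 58 * ((‖s‖ + 20) ^ 21) ^ (Module.finrank ℚ K) * (‖s‖ + 1) ^ 2) ∧
      ∀ σ : ℝ, 1 < σ → σ < 2 → SI (repJ c : FractionalIdeal (𝓞 K)⁰ K) (-σ) ≠ ⊤ ∧
        G σ = σ * (σ - 1) * ((SI (repJ c : FractionalIdeal (𝓞 K)⁰ K) (-σ)).toReal : ℂ) := by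
  have hX := bX_ge (K := K)
  set X := bX K with hXd
  obtain ⟨T, hT⟩ : ∃ T : ℝ, T = (X ^ 3)⁻¹ := ⟨_, rfl⟩
  have hT0 : 0 < T := by rw [hT]; positivity
  have hT1 : T ≤ 1 := by rw [hT]; exact inv_le_one_of_one_le₀ (one_le_pow₀ (by linarith))
  obtain ⟨h, v, hv, hd, hb, hi⟩ := cont_J (repJ c) aE_pos hT0 hT1 (W := X) (D := X ^ 18) (by linarith) (by positivity)
    (hW_c c) (hD_c c)
  set κ := aE K / covol (repJ c) with hκd
  have hκ : T ≤ κ := by rw [hT]; exact kappa_ge c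
  have hb' : ∀ s : ℂ, -7 ≤ s.re → s.re ≤ 2 → ‖h s‖ ≤ X ^ 29 := fun s h1 h2 =>
    (hb s h1 h2).trans (num_h hX hT rfl rfl (covol_inv c))
  have hkv : κ * v ≤ X ^ 33 ∧ v ≤ X ^ 36 := by
    have h2 := (hi 2 (by norm_num) le_rfl).2
    have e1 : (SI (repJ c : FractionalIdeal (𝓞 K)⁰ K) (-2) *
        ME (fun x : mixedSpace K => ENNReal.ofReal (fE x)) (2 - 1)).toReal ≤ X := by
      refine ENNReal.toReal_le_of_le_ofReal (by linarith) ?_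
      have := hW_c c
      rw [show (2 - 1 : ℝ) = 1 by norm_num]
      exact this
    refine num_v (Z := _) (H := ‖h ((2:ℝ):ℂ)‖) hX hT hκ hv e1 (hb' _ (by norm_num) (by norm_num)) ?_
    have h3 := congrArg Complex.re h2
    rw [Complex.sub_re, Complex.add_re, Complex.ofReal_re, Complex.ofReal_re, Complex.ofReal_re] at h3
    have h4 := (abs_le.1 (Complex.abs_re_le_norm (h ((2:ℝ):ℂ)))).1
    have e2 : κ * v * (T ^ ((2:ℝ) - 1) / ((2:ℝ) - 1)) = κ * v * T := by norm_num
    have e3 : v * (T ^ (2:ℝ) / 2) = v * (T ^ 2 / 2) := by norm_num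
    rw [e2, e3] at h3
    linarith
  have hTi : T⁻¹ = X ^ 3 := by rw [hT, inv_inv]
  have hTne : (T : ℂ) ≠ 0 := by exact_mod_cast hT0.ne'
  refine ⟨fun s => Qf K s * (s * (s - 1) * h s + (κ * v : ℝ) * (T : ℂ) ^ (s - 1) * s - (v : ℝ) * (T : ℂ) ^ s * (s - 1)),
    ?_, ?_, ?_⟩
  · have hp : Differentiable ℂ fun s : ℂ => (T : ℂ) ^ s := fun s =>
      DifferentiableAt.const_cpow differentiableAt_id (Or.inl hTne)
    have hp1 : Differentiable ℂ fun s : ℂ => (T : ℂ) ^ (s - 1) := fun s =>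
      DifferentiableAt.const_cpow (by fun_prop) (Or.inl hTne)
    refine (Qf_diff.differentiableOn).mul (DifferentiableOn.sub (DifferentiableOn.add ?_ ?_) ?_)
    · exact DifferentiableOn.mul (by fun_prop) hd
    · exact Differentiable.differentiableOn (by fun_prop)
    · exact Differentiable.differentiableOn (by fun_prop)
  · intro s h1 h2
    have hm : ‖s‖ ≤ ‖s‖ + 1 := by linarith
    have hm1 : ‖s - 1‖ ≤ ‖s‖ + 1 := (norm_sub_le _ _).trans (by simp)
    have hs0 := norm_nonneg s
    have t1 : ‖(T : ℂ) ^ (s - 1)‖ ≤ X ^ 24 := by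
      refine (norm_T_pow hT0 hT1 (k := 8) ?_).trans (le_of_eq ?_)
      · simp; linarith
      · rw [hTi]; ring
    have t2 : ‖(T : ℂ) ^ s‖ ≤ X ^ 21 := by
      refine (norm_T_pow hT0 hT1 (k := 7) ?_).trans (le_of_eq ?_)
      · simp; linarith
      · rw [hTi]; ring
    have hκv0 : 0 ≤ κ * v := mul_nonneg (hT0.le.trans hκ) hv
    have b1 : ‖s * (s - 1) * h s‖ ≤ (‖s‖ + 1) ^ 2 * X ^ 29 := by
      rw [norm_mul, norm_mul, sq]
      have := hb' s h1 h2
      gcongr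
    have b2 : ‖((κ * v : ℝ) : ℂ) * (T : ℂ) ^ (s - 1) * s‖ ≤ (‖s‖ + 1) ^ 2 * X ^ 57 := by
      rw [norm_mul, norm_mul, Complex.norm_real, Real.norm_of_nonneg hκv0]
      calc _ ≤ X ^ 33 * X ^ 24 * (‖s‖ + 1) := by gcongr; exact hkv.1
        _ = X ^ 57 * (‖s‖ + 1) := by ring
        _ ≤ X ^ 57 * (‖s‖ + 1) ^ 2 := by gcongr; exact le_self_pow₀ (by linarith) (by norm_num)
        _ = _ := by ring
    have b3 : ‖((v : ℝ) : ℂ) * (T : ℂ) ^ s * (s - 1)‖ ≤ (‖s‖ + 1) ^ 2 * X ^ 57 := by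
      rw [norm_mul, norm_mul, Complex.norm_real, Real.norm_of_nonneg hv]
      calc _ ≤ X ^ 36 * X ^ 21 * (‖s‖ + 1) := by gcongr; exact hkv.2
        _ = X ^ 57 * (‖s‖ + 1) := by ring
        _ ≤ X ^ 57 * (‖s‖ + 1) ^ 2 := by gcongr; exact le_self_pow₀ (by linarith) (by norm_num)
        _ = _ := by ring
    have b4 : ‖s * (s - 1) * h s + (κ * v : ℝ) * (T : ℂ) ^ (s - 1) * s - (v : ℝ) * (T : ℂ) ^ s * (s - 1)‖ ≤
        (‖s‖ + 1) ^ 2 * X ^ 58 := by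
      refine (norm_sub_le _ _).trans ((add_le_add (norm_add_le _ _) le_rfl).trans ?_)
      have h29 : X ^ 29 ≤ X ^ 57 := pow_le_pow_right₀ (by linarith) (by norm_num)
      have h57 : 0 ≤ X ^ 57 := by positivity
      calc _ ≤ (‖s‖ + 1) ^ 2 * X ^ 29 + (‖s‖ + 1) ^ 2 * X ^ 57 + (‖s‖ + 1) ^ 2 * X ^ 57 := add_le_add (add_le_add b1 b2) b3
        _ = (‖s‖ + 1) ^ 2 * (X ^ 29 + X ^ 57 + X ^ 57) := by ring
        _ ≤ (‖s‖ + 1) ^ 2 * (X * X ^ 57) := by gcongr; nlinarith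
        _ = _ := by ring
    rw [norm_mul]
    calc _ ≤ ((‖s‖ + 20) ^ 21) ^ (Module.finrank ℚ K) * ((‖s‖ + 1) ^ 2 * X ^ 58) :=
          mul_le_mul (Qf_bound s) b4 (norm_nonneg _) (by positivity)
      _ = _ := by ring
  · intro σ h1 h2
    obtain ⟨i1, i2⟩ := hi σ h1 h2.le
    have hz := zR_pos (K := K) (σ := σ) (by linarith)
    rw [ME_fE h1.le] at i1 i2
    have hne : SI (repJ c : FractionalIdeal (𝓞 K)⁰ K) (-σ) ≠ ⊤ := by
      intro ht
      rw [ht, ENNReal.top_mul (by simpa using hz)] at i1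
      exact i1 rfl
    refine ⟨hne, ?_⟩
    have hQ := Qf_real (K := K) (σ := σ) (by linarith)
    rw [ENNReal.toReal_mul, ENNReal.toReal_ofReal hz.le] at i2
    have e1 : (T : ℂ) ^ ((σ : ℂ) - 1) = ((T ^ (σ - 1) : ℝ) : ℂ) := by
      rw [Complex.ofReal_cpow hT0.le]; push_cast; rfl
    have e2 : (T : ℂ) ^ (σ : ℂ) = ((T ^ σ : ℝ) : ℂ) := by
      rw [Complex.ofReal_cpow hT0.le]
    beta_reduce
    rw [e1, e2]
    have h3 : (σ : ℂ) ≠ 0 := by exact_mod_cast (by linarith : σ ≠ 0)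
    have h4 : (σ : ℂ) - 1 ≠ 0 := by exact_mod_cast (by linarith : σ - 1 ≠ 0)
    have e3 : (σ : ℂ) * (σ - 1) * h σ + ((κ * v : ℝ) : ℂ) * ((T ^ (σ - 1) : ℝ) : ℂ) * σ - (v : ℝ) * ((T ^ σ : ℝ) : ℂ) * (σ - 1) =
        σ * (σ - 1) * (h σ + ((κ * v * (T ^ (σ - 1) / (σ - 1)) : ℝ) : ℂ) - ((v * (T ^ σ / σ) : ℝ) : ℂ)) := by
      push_cast
      field_simp
    rw [e3, ← i2]
    push_cast
    linear_combination ((σ:ℂ) * (σ - 1) * ((SI (repJ c : FractionalIdeal (𝓞 K)⁰ K) (-σ)).toReal : ℂ)) * hQ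

theorem cont_all :
    ∃ G : ℂ → ℂ, DifferentiableOn ℂ G {s | -7 < s.re ∧ s.re < 2} ∧
      (∀ s : ℂ, -7 ≤ s.re → s.re ≤ 2 → ‖G s‖ ≤ bX K ^ 63 * ((‖s‖ + 20) ^ 21) ^ (Module.finrank ℚ K) * (‖s‖ + 1) ^ 2) ∧
      ∀ σ : ℝ, 1 < σ → σ < 2 → G σ = σ * (σ - 1) *
        ((∑' I : {I : Ideal (𝓞 K) // I ≠ ⊥}, (Ideal.absNorm I.1 : ℝ) ^ (-σ) : ℝ) : ℂ) := by
  have hX := bX_ge (K := K)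
  choose G hd hb hi using cont_class (K := K)
  refine ⟨fun s => ∑ c, ((Ideal.absNorm (repI c).1 : ℝ) : ℂ) ^ s * G c s, ?_, ?_, ?_⟩
  · refine DifferentiableOn.fun_sum fun c _ => DifferentiableOn.mul ?_ (hd c)
    have hne : ((Ideal.absNorm (repI c).1 : ℝ) : ℂ) ≠ 0 := by
      have := repI_one c
      exact_mod_cast (by linarith : (Ideal.absNorm (repI c).1 : ℝ) ≠ 0)
    exact fun s _ => (DifferentiableAt.const_cpow differentiableAt_id (Or.inl hne)).differentiableWithinAt
  · intro s h1 h2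
    refine (norm_sum_le _ _).trans ?_
    have hs0 := norm_nonneg s
    calc _ ≤ ∑ c : ClassGroup (𝓞 K), bX K ^ 2 * (bX K ^ 58 * ((‖s‖ + 20) ^ 21) ^ (Module.finrank ℚ K) * (‖s‖ + 1) ^ 2) := by
          refine Finset.sum_le_sum fun c _ => ?_
          rw [norm_mul]
          refine mul_le_mul ?_ (hb c s h1 h2) (norm_nonneg _) (by positivity)
          have h3 := repI_one c
          rw [Complex.norm_cpow_eq_rpow_re_of_pos (by linarith)]
          calc _ ≤ (Ideal.absNorm (repI c).1 : ℝ) ^ (2:ℝ) := Real.rpow_le_rpow_of_exponent_le h3 h2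
            _ = (Ideal.absNorm (repI c).1 : ℝ) ^ 2 := by norm_num
            _ ≤ _ := by gcongr; exact repI_le c
      _ = (Fintype.card (ClassGroup (𝓞 K)) : ℝ) * (bX K ^ 2 * (bX K ^ 58 * ((‖s‖ + 20) ^ 21) ^ (Module.finrank ℚ K) * (‖s‖ + 1) ^ 2)) := by
          rw [Finset.sum_const, Finset.card_univ, nsmul_eq_mul]
      _ ≤ bX K ^ 3 * (bX K ^ 2 * (bX K ^ 58 * ((‖s‖ + 20) ^ 21) ^ (Module.finrank ℚ K) * (‖s‖ + 1) ^ 2)) := by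
          gcongr; exact card_le
      _ = _ := by ring
  · intro σ h1 h2
    have h3 := class_decomp (K := K) σ
    rw [zL_eq h1] at h3
    have h4 := congrArg ENNReal.toReal h3
    rw [ENNReal.toReal_ofReal (tsum_nonneg fun _ => by positivity),
      ENNReal.toReal_sum (fun c _ => ENNReal.mul_ne_top ENNReal.ofReal_ne_top (hi c σ h1 h2).1)] at h4
    rw [h4, Complex.ofReal_sum, Finset.mul_sum]
    refine Finset.sum_congr rfl fun c _ => ?_
    rw [(hi c σ h1 h2).2, ENNReal.toReal_mul, ENNReal.toReal_ofReal (by positivity), Complex.ofReal_mul,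
      Complex.ofReal_cpow (by positivity)]
    ring

end mixed
end DH

end

section

open NumberField MeasureTheory ProbabilityTheory

namespace DH

lemma strip_conn : IsPreconnected ({s : ℂ | -7 < s.re ∧ s.re < 2} \ {1}) := by
  have hA : IsPreconnected {s : ℂ | 1 < s.re ∧ s.re < 2} :=
    ((convex_halfSpace_re_gt 1).inter (convex_halfSpace_re_lt 2)).isPreconnected
  have hS : Convex ℝ {s : ℂ | -7 < s.re ∧ s.re < 2} :=
    (convex_halfSpace_re_gt (-7)).inter (convex_halfSpace_re_lt 2)
  have hB : IsPreconnected ({s : ℂ | -7 < s.re ∧ s.re < 2} ∩ {s : ℂ | 0 < s.im}) :=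
    (hS.inter (convex_halfSpace_im_gt 0)).isPreconnected
  have hC : IsPreconnected ({s : ℂ | -7 < s.re ∧ s.re < 2} ∩ {s : ℂ | s.im < 0}) :=
    (hS.inter (convex_halfSpace_im_lt 0)).isPreconnected
  have hD : IsPreconnected ({s : ℂ | -7 < s.re ∧ s.re < 2} ∩ {s : ℂ | s.re < 1}) :=
    (hS.inter (convex_halfSpace_re_lt 1)).isPreconnected
  have h1 := IsPreconnected.union (⟨3/2, 1⟩ : ℂ) (by norm_num) (by norm_num) hA hB
  have h2 := IsPreconnected.union (⟨3/2, -1⟩ : ℂ) (by norm_num) (by norm_num) h1 hC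
  have h3 := IsPreconnected.union (⟨0, -1⟩ : ℂ) (by norm_num) (by norm_num) h2 hD
  convert h3 using 1
  ext s
  simp only [Set.mem_sdiff, Set.mem_ofPred_eq, Set.mem_singleton_iff, Set.mem_union, Set.mem_inter_iff]
  constructor
  · rintro ⟨⟨a, b⟩, c⟩
    rcases lt_trichotomy s.im 0 with h | h | h
    · exact Or.inl (Or.inr ⟨⟨a, b⟩, h⟩)
    · rcases lt_trichotomy s.re 1 with h' | h' | h'
      · exact Or.inr ⟨⟨a, b⟩, h'⟩
      · exact absurd (Complex.ext (by simpa using h') (by simpa using h)) c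
      · exact Or.inl (Or.inl (Or.inl ⟨h', b⟩))
    · exact Or.inl (Or.inl (Or.inr ⟨⟨a, b⟩, h⟩))
  · rintro (((⟨a, b⟩ | ⟨⟨a, b⟩, c⟩) | ⟨⟨a, b⟩, c⟩) | ⟨⟨a, b⟩, c⟩)
    · exact ⟨⟨by linarith, b⟩, fun h => by rw [h] at a; simp at a⟩
    · exact ⟨⟨a, b⟩, fun h => by rw [h] at c; simp at c⟩
    · exact ⟨⟨a, b⟩, fun h => by rw [h] at c; simp at c⟩
    · exact ⟨⟨a, b⟩, fun h => by rw [h] at c; simp at c⟩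

/-- dividing out a linear factor -/
lemma div_lin {f : ℂ → ℂ} (hf : Differentiable ℂ f) {a s : ℂ} {M : ℝ}
    (h : ∀ z ∈ Metric.closedBall s 1, ‖(z - a) * f z‖ ≤ M) : ‖f s‖ ≤ 2 * M := by
  have key : ∀ z ∈ Metric.closedBall s 1, 1 / 2 ≤ ‖z - a‖ → ‖f z‖ ≤ 2 * M := by
    intro z hz hza
    have := h z hz
    rw [norm_mul] at this
    have h0 := norm_nonneg (f z)
    nlinarith
  by_cases hs : 1 / 2 ≤ ‖s - a‖
  · exact key s (Metric.mem_closedBall_self zero_le_one) hs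
  · push Not at hs
    refine Complex.norm_le_of_forall_mem_frontier_norm_le (U := Metric.ball s 1) Metric.isBounded_ball
      hf.diffContOnCl (fun z hz => ?_) (subset_closure (Metric.mem_ball_self one_pos))
    rw [frontier_ball _ one_ne_zero] at hz
    have hz' : ‖z - s‖ = 1 := by simpa [dist_eq_norm] using hz
    refine key z (Metric.sphere_subset_closedBall hz) ?_
    have h1 : ‖z - s‖ ≤ ‖z - a‖ + ‖s - a‖ := by
      have := norm_sub_le (z - a) (s - a)
      simpa using this
    linarith

section main
variable {L : Type} [Field L] [NumberField L]

lemma norm_tsum_le {s : ℂ} (hs : 1 < s.re) :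
    ‖∑' I : {I : Ideal (𝓞 L) // I ≠ ⊥}, (Ideal.absNorm I.1 : ℂ) ^ (-s)‖ ≤
      ∑' I : {I : Ideal (𝓞 L) // I ≠ ⊥}, (Ideal.absNorm I.1 : ℝ) ^ (-s.re) := by
  refine tsum_of_norm_bounded (summable_ideals hs).hasSum fun I => ?_
  have : (0:ℝ) < Ideal.absNorm I.1 := by exact_mod_cast absNorm_pos' I.2
  have h := Complex.norm_cpow_eq_rpow_re_of_pos this (-s)
  push_cast at h
  rw [h, Complex.neg_re]

lemma tsum_real (σ : ℝ) :
    ∑' I : {I : Ideal (𝓞 L) // I ≠ ⊥}, (Ideal.absNorm I.1 : ℂ) ^ (-(σ:ℂ)) =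
      ((∑' I : {I : Ideal (𝓞 L) // I ≠ ⊥}, (Ideal.absNorm I.1 : ℝ) ^ (-σ) : ℝ) : ℂ) := by
  rw [Complex.ofReal_tsum]
  refine tsum_congr fun I => ?_
  rw [Complex.ofReal_cpow (by positivity)]
  push_cast; rfl

/-- growth of the zeta function near the critical strip -/
theorem zeta_ext {ζ : ℂ → ℂ} (ha : ∀ s : ℂ, s ≠ 1 → AnalyticAt ℂ ζ s)
    (hz : ∀ s : ℂ, 1 < s.re → ζ s = ∑' I : {I : Ideal (𝓞 L) // I ≠ ⊥}, (Ideal.absNorm I.1 : ℂ) ^ (-s)) :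
    ∃ F : ℂ → ℂ, Differentiable ℂ F ∧ (∀ s, s ≠ 1 → F s = (s - 1) * ζ s) ∧
      ∀ s : ℂ, -7 < s.re →
        ‖s * F s‖ ≤ bX L ^ 63 * ((‖s‖ + 20) ^ 21) ^ (Module.finrank ℚ L) * (‖s‖ + 1) ^ 2 := by
  obtain ⟨G, hd, hb, hi⟩ := cont_all (K := L)
  have hX := bX_ge (K := L)
  have hSo : IsOpen {s : ℂ | -7 < s.re ∧ s.re < 2} :=
    (isOpen_lt continuous_const Complex.continuous_re).inter (isOpen_lt Complex.continuous_re continuous_const)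
  have heq : Set.EqOn G (fun s => s * (s - 1) * ζ s) ({s : ℂ | -7 < s.re ∧ s.re < 2} \ {1}) := by
    refine AnalyticOnNhd.eqOn_of_preconnected_of_frequently_eq (z₀ := ((3/2 : ℝ) : ℂ)) ?_ ?_ strip_conn ?_ ?_
    · exact (hd.analyticOnNhd hSo).mono Set.sdiff_subset
    · intro s hs
      have := ha s hs.2
      fun_prop
    · refine ⟨⟨by norm_num, by norm_num⟩, ?_⟩
      intro h
      have := congrArg Complex.re h
      norm_num at this
    · have ht : Filter.Tendsto (fun x : ℝ => (x : ℂ)) (nhdsWithin (3/2) {3/2}ᶜ) (nhdsWithin ((3/2:ℝ):ℂ) {((3/2:ℝ):ℂ)}ᶜ) := by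
        refine tendsto_nhdsWithin_iff.2 ⟨(Complex.continuous_ofReal.tendsto _).mono_left nhdsWithin_le_nhds, ?_⟩
        filter_upwards [self_mem_nhdsWithin] with x hx h
        exact hx (Complex.ofReal_injective h)
      refine ht.frequently (Filter.Eventually.frequently ?_)
      have hm : Set.Ioo (1:ℝ) 2 ∈ nhdsWithin (3/2:ℝ) {3/2}ᶜ :=
        mem_nhdsWithin_of_mem_nhds (Ioo_mem_nhds (by norm_num) (by norm_num))
      filter_upwards [hm] with σ hσ
      rw [hi σ hσ.1 hσ.2, hz σ (by simpa using hσ.1), tsum_real]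
  refine ⟨fun s => if s = 1 then G 1 else (s - 1) * ζ s, ?_, fun s hs => if_neg hs, ?_⟩
  · intro s
    by_cases hs : s = 1
    · have h1 : DifferentiableAt ℂ (fun z => G z / z) s := by
        refine DifferentiableAt.div (hd.differentiableAt (hSo.mem_nhds ?_)) differentiableAt_id ?_
        · rw [hs]; norm_num
        · rw [hs]; simp
      refine h1.congr_of_eventuallyEq ?_
      have hn : {s : ℂ | -7 < s.re ∧ s.re < 2} ∩ {0}ᶜ ∈ nhds s := by
        refine (hSo.inter isOpen_compl_singleton).mem_nhds ?_
        rw [hs]; norm_num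
      filter_upwards [hn] with z hzz
      by_cases hz1 : z = 1
      · simp [hz1]
      · have h0 : z ≠ 0 := hzz.2
        rw [if_neg hz1, heq ⟨hzz.1, hz1⟩]
        field_simp
    · have h1 : DifferentiableAt ℂ (fun z => (z - 1) * ζ z) s := by
        have := (ha s hs).differentiableAt
        fun_prop
      refine h1.congr_of_eventuallyEq ?_
      filter_upwards [isOpen_compl_singleton.mem_nhds hs] with z hz1
      exact if_neg hz1
  · intro s hs
    by_cases h2 : s.re < 2
    · have e : s * (if s = 1 then G 1 else (s - 1) * ζ s) = G s := by
        by_cases h1 : s = 1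
        · simp [h1]
        · rw [if_neg h1, heq ⟨⟨hs, h2⟩, h1⟩]; ring
      rw [e]
      exact hb s hs.le h2.le
    · push Not at h2
      have h1 : s ≠ 1 := by rintro rfl; norm_num at h2
      beta_reduce
      rw [if_neg h1, hz s (by linarith), norm_mul, norm_mul]
      have b1 := (norm_tsum_le (L := L) (s := s) (by linarith)).trans ((tsum_le_bX (by linarith)).trans cMn_le)
      have b2 : ‖s - 1‖ ≤ ‖s‖ + 1 := (norm_sub_le _ _).trans (by simp)
      have hs0 := norm_nonneg s
      have b3 : (1:ℝ) ≤ ((‖s‖ + 20) ^ 21) ^ (Module.finrank ℚ L) := one_le_pow₀ (one_le_pow₀ (by linarith))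
      have b4 : bX L ≤ bX L ^ 63 := le_self_pow₀ (by linarith) (by norm_num)
      calc _ ≤ (‖s‖ + 1) * ((‖s‖ + 1) * bX L ^ 63) := by
            gcongr
            · linarith
            · exact b1.trans b4
        _ = bX L ^ 63 * 1 * (‖s‖ + 1) ^ 2 := by ring
        _ ≤ _ := by gcongr

lemma zeta_lower (t : ℝ) :
    (bX L)⁻¹ ≤ ‖Complex.exp (complexMGF (fun y : ℝ => -|y|) (zmeas L) (2 + t * Complex.I))‖ := by
  have hX := bX_ge (K := L)
  set c : ℂ := 2 + t * Complex.I with hc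
  have hre : c.re = 2 := by simp [hc]
  have h1 := norm_complexMGF_le_mgf (X := fun y : ℝ => -|y|) (μ := zmeas L) (z := c)
  rw [hre] at h1
  have h2 : Real.exp (mgf (fun y : ℝ => -|y|) (zmeas L) 2) ≤ bX L := by
    have h3 := zeta_exp (L := L) (s := ((2:ℝ):ℂ)) (by norm_num)
    rw [complexMGF_ofReal, tsum_real, ← Complex.ofReal_exp] at h3
    rw [← Complex.ofReal_injective h3]
    exact (tsum_le_bX (by norm_num)).trans cMn_le
  rw [Complex.norm_exp]
  have h4 := (abs_le.1 (Complex.abs_re_le_norm (complexMGF (fun y : ℝ => -|y|) (zmeas L) c))).1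
  calc (bX L)⁻¹ ≤ (Real.exp (mgf (fun y : ℝ => -|y|) (zmeas L) 2))⁻¹ := inv_anti₀ (Real.exp_pos _) h2
    _ = Real.exp (-(mgf (fun y : ℝ => -|y|) (zmeas L) 2)) := (Real.exp_neg _).symm
    _ ≤ _ := Real.exp_le_exp.2 (by linarith)

end main
end DH

end

section

open NumberField

namespace DH
open MeasureTheory ProbabilityTheory

/-- exponent constant -/
noncomputable def cB : ℝ := 64 * (1 + Real.log cM / Real.log 2) + 118

lemma cB_pos : 0 < cB := by
  have h1 : 0 ≤ Real.log cM := Real.log_nonneg (by linarith [cM_ge])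
  have h2 : 0 < Real.log 2 := Real.log_pos (by norm_num)
  unfold cB; positivity

section main
variable {L : Type} [Field L] [NumberField L]

lemma log_form {τ : ℝ} (hτ : 2 ≤ τ) :
    Real.log (|(discr L : ℝ)| * τ ^ Module.finrank ℚ L) =
      Real.log |(discr L : ℝ)| + Module.finrank ℚ L * Real.log τ := by
  have := discr_one (K := L)
  rw [Real.log_mul (by positivity) (by positivity), Real.log_pow]

/-- the final size estimate -/
lemma size_le {τ ℒ : ℝ} (hτ : 2 ≤ τ)
    (hℒ : ℒ = Real.log |(discr L : ℝ)| + Module.finrank ℚ L * Real.log τ) :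
    8 * bX L ^ 64 * (15 * τ) ^ (23 * Module.finrank ℚ L) ≤ Real.exp (cB * ℒ) := by
  have hM := cM_ge
  have hd := discr_one (K := L)
  have hX := bX_ge (K := L)
  have hn : (1:ℝ) ≤ Module.finrank ℚ L := by exact_mod_cast (Module.finrank_pos : 0 < Module.finrank ℚ L)
  set n : ℝ := ((Module.finrank ℚ L : ℕ) : ℝ) with hnd
  have l2 : 0 < Real.log 2 := Real.log_pos (by norm_num)
  have lτ : Real.log 2 ≤ Real.log τ := Real.log_le_log (by norm_num) hτ
  have ld : 0 ≤ Real.log |(discr L : ℝ)| := Real.log_nonneg hd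
  have lM : 0 ≤ Real.log cM := Real.log_nonneg (by linarith)
  have l15 : Real.log 15 ≤ 4 * Real.log 2 := by
    have : Real.log ((2:ℝ) ^ 4) = 4 * Real.log 2 := by rw [Real.log_pow]; norm_num
    rw [← this]
    exact Real.log_le_log (by norm_num) (by norm_num)
  have l8 : Real.log 8 = 3 * Real.log 2 := by
    have : Real.log ((2:ℝ) ^ 3) = 3 * Real.log 2 := by rw [Real.log_pow]; norm_num
    rw [← this]; norm_num
  have lX : Real.log (bX L) = n * Real.log cM + Real.log |(discr L : ℝ)| := by
    rw [bX, Real.log_mul (by positivity) (by positivity), Real.log_pow]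
  rw [← Real.log_le_iff_le_exp (by positivity), Real.log_mul (by positivity) (by positivity),
    Real.log_mul (by positivity) (by positivity), Real.log_pow, Real.log_pow,
    Real.log_mul (by positivity) (by positivity), l8, lX]
  push_cast
  rw [← hnd]
  have nt : n * Real.log 2 ≤ n * Real.log τ := by gcongr
  have h1 : n * Real.log cM ≤ Real.log cM / Real.log 2 * ℒ := by
    rw [div_mul_eq_mul_div, le_div_iff₀ l2]
    have : n * Real.log 2 ≤ ℒ := by rw [hℒ]; linarith
    calc n * Real.log cM * Real.log 2 = Real.log cM * (n * Real.log 2) := by ring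
      _ ≤ _ := by gcongr
  have h2 : Real.log 2 ≤ n * Real.log τ := by nlinarith
  have h3 : n * (Real.log 15 + Real.log τ) ≤ 5 * (n * Real.log τ) := by
    calc n * (Real.log 15 + Real.log τ) ≤ n * (5 * Real.log τ) := by gcongr; linarith
      _ = _ := by ring
  have e : cB * ℒ = 64 * ℒ + 64 * (Real.log cM / Real.log 2 * ℒ) + 118 * ℒ := by unfold cB; ring
  rw [e]
  have : 0 ≤ n * Real.log τ := by nlinarith
  nlinarith

theorem main_ineq {ζ : ℂ → ℂ} (ha : ∀ s : ℂ, s ≠ 1 → AnalyticAt ℂ ζ s)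
    (hz : ∀ s : ℂ, 1 < s.re → ζ s = ∑' I : {I : Ideal (𝓞 L) // I ≠ ⊥}, (Ideal.absNorm I.1 : ℂ) ^ (-s))
    {β : ℝ} (hβ0 : 0 < β) (hβ1 : β < 1) (hβ : ζ β = 0) {ρ : ℂ} (hρ0 : 0 < ρ.re) (hρ1 : ρ.re < 1)
    (hρ : ζ ρ = 0) (hne : ρ ≠ β) {ℒ : ℝ}
    (hℒ : ℒ = Real.log |(discr L : ℝ)| + Module.finrank ℚ L * Real.log (|ρ.im| + 2)) (hℒ0 : 0 < ℒ)
    {k : ℕ} (hk : 41520 * (cB * ℒ) ≤ k) (hk1 : 1 ≤ k) :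
    Real.log (1 / (32 * (1 - β) * k)) ≤ k * (1 - ρ.re) := by
  obtain ⟨F, hF, hFz, hFb⟩ := zeta_ext ha hz
  have hX := bX_ge (K := L)
  have hFβ : F β = 0 := by
    rw [hFz _ (by exact_mod_cast hβ1.ne), hβ, mul_zero]
  have hH : Differentiable ℂ (dslope F β) := by
    rw [← differentiableOn_univ] at hF ⊢
    exact (Complex.differentiableOn_dslope Filter.univ_mem).2 hF
  have hmul : ∀ s, (s - β) * dslope F β s = F s := by
    intro s
    have := sub_smul_dslope F (β : ℂ) s
    rw [smul_eq_mul, hFβ, sub_zero] at this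
    exact this
  have hHe : ∀ s : ℂ, 1 < s.re → dslope F β s = (s - 1) / (s - β) *
      Complex.exp (complexMGF (fun y : ℝ => -|y|) (zmeas L) s) := by
    intro s hs
    have h1 : s ≠ 1 := by rintro rfl; simp at hs
    have h2 : s - β ≠ 0 := by
      intro h
      have := congrArg Complex.re h
      simp at this
      linarith
    rw [← zeta_exp hs, ← hz s hs, div_mul_eq_mul_div, eq_div_iff h2, mul_comm, hmul, hFz s h1]
  have hlow : ∀ t : ℝ, (2 * bX L)⁻¹ ≤ ‖dslope F β (2 + t * Complex.I)‖ := by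
    intro t
    set c : ℂ := 2 + t * Complex.I with hc
    have hre : c.re = 2 := by simp [hc]
    rw [hHe c (by rw [hre]; norm_num), norm_mul, mul_inv, norm_div]
    refine mul_le_mul ?_ (zeta_lower t) (by positivity) (by positivity)
    have h1 : 1 ≤ ‖c - 1‖ := by
      have := Complex.re_le_norm (c - 1)
      rw [Complex.sub_re, hre, Complex.one_re] at this
      linarith
    have h2 : ‖c - β‖ ≤ ‖c - 1‖ + 1 := by
      have h3 : c - β = (c - 1) + ((1 - β : ℝ) : ℂ) := by push_cast; ring
      rw [h3]
      refine (norm_add_le _ _).trans ?_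
      rw [Complex.norm_real, Real.norm_of_nonneg (by linarith)]
      linarith
    have h4 : 0 < ‖c - β‖ := by
      have := Complex.re_le_norm (c - β)
      rw [Complex.sub_re, hre, Complex.ofReal_re] at this
      linarith
    rw [le_div_iff₀ h4]
    linarith
  have hup : ∀ t : ℝ, |t| ≤ |ρ.im| → ∀ s ∈ Metric.closedBall (2 + t * Complex.I) 6,
      ‖dslope F β s‖ ≤ Real.exp (cB * ℒ) * ‖dslope F β (2 + t * Complex.I)‖ := by
    intro t ht s hs
    have hτ : 2 ≤ |ρ.im| + 2 := by linarith [abs_nonneg ρ.im]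
    have hsz := size_le (L := L) hτ hℒ
    set τ := |ρ.im| + 2 with hτd
    have hn : 1 ≤ Module.finrank ℚ L := Module.finrank_pos
    have hM : ∀ w ∈ Metric.closedBall (2 + t * Complex.I) 8,
        ‖w * F w‖ ≤ bX L ^ 63 * (15 * τ) ^ (23 * Module.finrank ℚ L) := by
      intro w hw
      rw [Metric.mem_closedBall, dist_eq_norm] at hw
      have h1 : -7 < w.re := by
        have := (abs_le.1 ((Complex.abs_re_le_norm _).trans hw)).1
        simp at this
        linarith
      have h2 : ‖w‖ ≤ τ + 8 := by
        have h3 : ‖w‖ ≤ ‖w - (2 + t * Complex.I)‖ + ‖(2 + t * Complex.I : ℂ)‖ := by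
          have := norm_add_le (w - (2 + t * Complex.I)) (2 + t * Complex.I)
          simpa using this
        have h4 : ‖(2 + t * Complex.I : ℂ)‖ ≤ 2 + |t| := by
          refine (norm_add_le _ _).trans ?_
          simp
        linarith
      have hw0 := norm_nonneg w
      refine (hFb w h1).trans ?_
      rw [mul_assoc]
      refine mul_le_mul_of_nonneg_left ?_ (by positivity)
      calc ((‖w‖ + 20) ^ 21) ^ (Module.finrank ℚ L) * (‖w‖ + 1) ^ 2
          ≤ ((15 * τ) ^ 21) ^ (Module.finrank ℚ L) * (15 * τ) ^ 2 := by gcongr <;> linarith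
        _ = (15 * τ) ^ (21 * Module.finrank ℚ L + 2) := by rw [← pow_mul, ← pow_add]
        _ ≤ _ := pow_le_pow_right₀ (by linarith) (by omega)
    set M := bX L ^ 63 * (15 * τ) ^ (23 * Module.finrank ℚ L) with hMd
    have hF7 : ∀ w ∈ Metric.closedBall (2 + t * Complex.I) 7, ‖F w‖ ≤ 2 * M := by
      intro w hw
      refine div_lin hF (a := 0) fun z hzz => ?_
      rw [sub_zero]
      refine hM z ?_
      rw [Metric.mem_closedBall] at hw hzz ⊢
      linarith [dist_triangle z w (2 + t * Complex.I)]
    have hH6 : ‖dslope F β s‖ ≤ 2 * (2 * M) := by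
      refine div_lin hH (a := β) fun z hzz => ?_
      rw [hmul]
      refine hF7 z ?_
      rw [Metric.mem_closedBall] at hs hzz ⊢
      linarith [dist_triangle z s (2 + t * Complex.I)]
    refine hH6.trans ?_
    calc 2 * (2 * M) = 8 * bX L ^ 64 * (15 * τ) ^ (23 * Module.finrank ℚ L) * (2 * bX L)⁻¹ := by
          rw [hMd]; field_simp; ring
      _ ≤ _ := mul_le_mul hsz (hlow t) (by positivity) (Real.exp_pos _).le
  have hc : ∀ t : ℝ, dslope F β (2 + t * Complex.I) ≠ 0 := by
    intro t h
    have := hlow t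
    rw [h, norm_zero] at this
    have h2 : 0 < (2 * bX L)⁻¹ := by positivity
    linarith
  have hc0 := hc 0
  have hup0 := hup 0 (by simp)
  simp only [Complex.ofReal_zero, zero_mul, add_zero] at hc0 hup0
  have hHρ : dslope F β ρ = 0 := by
    have h1 := hmul ρ
    have h2 : ρ ≠ 1 := by rintro rfl; simp at hρ1
    rw [hFz ρ h2, hρ, mul_zero] at h1
    exact (mul_eq_zero.1 h1).resolve_left (sub_ne_zero.2 hne)
  exact dh_core hH (t := ρ.im) (B := cB * ℒ) (δ := 1 - β) (mul_pos cB_pos hℒ0) (by linarith) hc0 (hc _) hup0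
    (hup _ le_rfl) (fun k => hpos_of_mgf (fun y => by simp) zint_set hβ1 hHe _ k) hHρ hρ0 hρ1 rfl k hk1 hk

end main
end DH

end


/-- **Deuring–Heilbronn phenomenon (general form).** -/
theorem deuring_heilbronn_all_number_fields (η : ℝ) (hη0 : 0 < η) (hη1 : η ≤ 1) :
    ∃ c₁ : ℝ, 0 < c₁ ∧ ∃ c₂ : ℝ, 0 < c₂ ∧
      ∀ (L : Type) [Field L] [NumberField L],
        1 < Module.finrank ℚ L →
        ∀ ζ : ℂ → ℂ,
          (∀ s : ℂ, s ≠ 1 → AnalyticAt ℂ ζ s) →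
          (∀ s : ℂ, 1 < s.re →
            ζ s = ∑' I : {I : Ideal (𝓞 L) // I ≠ ⊥}, (Ideal.absNorm I.1 : ℂ) ^ (-s)) →
        ∀ β₁ : ℝ, (0 < β₁ ∧ β₁ < 1 ∧ ζ β₁ = 0 ∧
            1 - 1 / (29.57 * (Real.log |(NumberField.discr L : ℝ)| +
              (Module.finrank ℚ L : ℝ) * Real.log 2)) ≤ β₁) →
        ∀ ρ : ℂ, (0 < ρ.re ∧ ρ.re < 1 ∧ ζ ρ = 0 ∧ ρ ≠ (β₁ : ℂ)) →
          ρ.re ≤ 1 - η ∨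
          ρ.re ≤ 1 - c₂ *
            Real.log (c₁ / ((1 - β₁) *
              Real.log (|(NumberField.discr L : ℝ)| * (|ρ.im| + 2) ^ (Module.finrank ℚ L)))) /
            Real.log (|(NumberField.discr L : ℝ)| * (|ρ.im| + 2) ^ (Module.finrank ℚ L)) := by
  obtain ⟨C, hC⟩ : ∃ C : ℝ, C = 41520 * DH.cB + 1 := ⟨_, rfl⟩
  have hcB := DH.cB_pos
  have hC0 : 0 < C := by rw [hC]; positivity
  refine ⟨1 / (32 * C), by positivity, 1 / C, by positivity, ?_⟩
  intro L _ _ hn ζ ha hz β₁ hβ ρ hρ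
  right
  obtain ⟨hβ0, hβ1, hβz, -⟩ := hβ
  obtain ⟨hρ0, hρ1, hρz, hne⟩ := hρ
  have hτ : 2 ≤ |ρ.im| + 2 := by linarith [abs_nonneg ρ.im]
  obtain ⟨ℒ, hℒ⟩ : ∃ ℒ : ℝ, ℒ = Real.log (|(NumberField.discr L : ℝ)| * (|ρ.im| + 2) ^ (Module.finrank ℚ L)) :=
    ⟨_, rfl⟩
  rw [← hℒ]
  have hℒ' := hℒ
  rw [DH.log_form hτ] at hℒ'
  have hℒ1 : 1 ≤ ℒ := by
    have h1 : (2:ℝ) ≤ (Module.finrank ℚ L : ℕ) := by exact_mod_cast hn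
    have h2 : Real.log 2 ≤ Real.log (|ρ.im| + 2) := Real.log_le_log (by norm_num) hτ
    have h3 := Real.log_two_gt_d9
    have h4 : 0 ≤ Real.log |(NumberField.discr L : ℝ)| := Real.log_nonneg DH.discr_one
    rw [hℒ']
    nlinarith
  have hB : 0 ≤ 41520 * (DH.cB * ℒ) := by positivity
  set k : ℕ := ⌈41520 * (DH.cB * ℒ)⌉₊ with hk
  have hk1 : 1 ≤ k := Nat.one_le_ceil_iff.2 (by positivity)
  have hk0 : (1:ℝ) ≤ k := by exact_mod_cast hk1
  have hkC : (k : ℝ) ≤ C * ℒ := by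
    have := (Nat.ceil_lt_add_one hB).le
    rw [← hk] at this
    rw [hC]
    nlinarith
  have h := DH.main_ineq ha hz hβ0 hβ1 hβz hρ0 hρ1 hρz hne hℒ' (by linarith) (Nat.le_ceil _) hk1
  rw [← hk] at h
  have hδ : 0 < 1 - β₁ := by linarith
  have h1 : Real.log (1 / (32 * C) / ((1 - β₁) * ℒ)) ≤ C * ℒ * (1 - ρ.re) := by
    calc Real.log (1 / (32 * C) / ((1 - β₁) * ℒ)) ≤ Real.log (1 / (32 * (1 - β₁) * k)) := by
          refine Real.log_le_log (by positivity) ?_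
          rw [div_div]
          refine one_div_le_one_div_of_le (by positivity) ?_
          calc 32 * (1 - β₁) * k ≤ 32 * (1 - β₁) * (C * ℒ) := by gcongr
            _ = _ := by ring
      _ ≤ k * (1 - ρ.re) := h
      _ ≤ _ := mul_le_mul_of_nonneg_right hkC (by linarith)
  have h2 : 1 / C * Real.log (1 / (32 * C) / ((1 - β₁) * ℒ)) / ℒ ≤ 1 - ρ.re := by
    rw [div_le_iff₀ (by linarith), one_div, inv_mul_le_iff₀ hC0]
    linarith
  linarith
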